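/- Let γ be a symmetrical graph (possibly with loops) on I = {1,2,3,4,5,6}. If γ is a subgraph of γ1, of γ2, or of γ3, then every 2-connected claw-o-heavy and P6-γ-heavy graph is hamiltonian. Here E(γ1) = {14,15,16,24,25,26,34,35,36}, E(γ2) = {11,12,14,15,16,25,26,36,56,66}, and E(γ3) = {13,14,15,25,26,36,46}. -/

import Mathlib

/-- A graph is 2-connected if it has at least 3 vertices and deleting any
single vertex leaves a connected graph. -/
def TwoConnected {V : Type*} [Fintype V] (G : SimpleGraph V) : Prop :=
  3 ≤ Fintype.card V ∧ ∀ v : V, (G.induce ({v}ᶜ : Set V)).Connected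

/-- A graph `G` of order `n` is claw-o-heavy if every induced copy of the claw `K_{1,3}`
(with center `a` and leaves `b₁, b₂, b₃`) contains two nonadjacent vertices whose
degree sum in `G` is at least `n`. -/
def ClawOHeavy {V : Type*} [Fintype V] (G : SimpleGraph V) [DecidableRel G.Adj] : Prop :=
  ∀ a b₁ b₂ b₃ : V, b₁ ≠ b₂ → b₁ ≠ b₃ → b₂ ≠ b₃ →
    G.Adj a b₁ → G.Adj a b₂ → G.Adj a b₃ →
    ¬ G.Adj b₁ b₂ → ¬ G.Adj b₁ b₃ → ¬ G.Adj b₂ b₃ →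
    ∃ u v : V, u ∈ ({a, b₁, b₂, b₃} : Set V) ∧ v ∈ ({a, b₁, b₂, b₃} : Set V) ∧
      u ≠ v ∧ ¬ G.Adj u v ∧ Fintype.card V ≤ G.degree u + G.degree v

/-- `v 0, v 1, …, v 5` is an induced path on 6 vertices in `G`. -/
def IsInducedP6 {V : Type*} (G : SimpleGraph V) (v : Fin 6 → V) : Prop :=
  Function.Injective v ∧
    ∀ i j : Fin 6, G.Adj (v i) (v j) ↔ (i.val + 1 = j.val ∨ j.val + 1 = i.val)

/- The paper indexes the vertices of `P₆` by `I = {1,…,6}`; here we use `Fin 6 = {0,…,5}`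
(so paper-index `i` corresponds to `i - 1 : Fin 6`).  A graph (possibly with loops) on `I`
is modelled as a set of unordered pairs (`Sym2 (Fin 6)`); a loop at `i` is `s(i, i)`. -/

/-- `γ` is symmetrical: `ij ∈ E(γ)` iff `(7-i)(7-j) ∈ E(γ)` (in `Fin 6` terms,
the map `i ↦ 7 - i` on `{1,…,6}` is `Fin.rev : i ↦ 5 - i`). -/
def SymmetricalGamma (γ : Set (Sym2 (Fin 6))) : Prop :=
  ∀ e : Sym2 (Fin 6), e ∈ γ ↔ e.map Fin.rev ∈ γ

/-- A graph `G` of order `n` is `P₆`-`γ`-heavy if for every induced path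
`v 0, …, v 5` on 6 vertices there is an edge (or loop) `ij` of `γ` with
`d(v i) + d(v j) ≥ n`. -/
def P6GammaHeavy {V : Type*} [Fintype V] (G : SimpleGraph V) [DecidableRel G.Adj]
    (γ : Set (Sym2 (Fin 6))) : Prop :=
  ∀ v : Fin 6 → V, IsInducedP6 G v →
    ∃ i j : Fin 6, s(i, j) ∈ γ ∧ Fintype.card V ≤ G.degree (v i) + G.degree (v j)

/-- `γ₁`, with paper edge set `{14,15,16,24,25,26,34,35,36}`. -/
def gamma1 : Set (Sym2 (Fin 6)) :=
  {s(0,3), s(0,4), s(0,5), s(1,3), s(1,4), s(1,5), s(2,3), s(2,4), s(2,5)}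

/-- `γ₂`, with paper edge set `{11,12,14,15,16,25,26,36,56,66}`. -/
def gamma2 : Set (Sym2 (Fin 6)) :=
  {s(0,0), s(0,1), s(0,3), s(0,4), s(0,5), s(1,4), s(1,5), s(2,5), s(4,5), s(5,5)}

/-- `γ₃`, with paper edge set `{13,14,15,25,26,36,46}`. -/
def gamma3 : Set (Sym2 (Fin 6)) :=
  {s(0,2), s(0,3), s(0,4), s(1,4), s(1,5), s(2,5), s(3,5)}

namespace ClawHeavy

open SimpleGraph

/-- `Link G a b l`: the list `l` is the vertex sequence of a walk of `G` from `a` to `b`. -/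
inductive Link {V : Type*} (G : SimpleGraph V) : V → V → List V → Prop
  | single (a : V) : Link G a a [a]
  | cons {a b c : V} {l : List V} : G.Adj a b → Link G b c l → Link G a c (a :: l)

namespace Link

variable {V : Type*} {G H : SimpleGraph V} {a b c d x : V} {l l' : List V}

theorem append (h : Link G a b l) (hbc : G.Adj b c) (h' : Link G c d l') :
    Link G a d (l ++ l') := by
  induction h with
  | single a => exact cons hbc h'
  | cons hab _ ih => exact cons hab (ih hbc)

theorem reverse (h : Link G a b l) : Link G b a l.reverse := by
  induction h with
  | single a => exact single a
  | cons hab _ ih => simpa using ih.append hab.symm (single _)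

theorem mono (hGH : G ≤ H) (h : Link G a b l) : Link H a b l := by
  induction h with
  | single a => exact single a
  | cons hab _ ih => exact cons (hGH hab) ih

theorem head_mem (h : Link G a b l) : a ∈ l := by cases h <;> simp

theorem last_mem (h : Link G a b l) : b ∈ l := by
  induction h <;> simp_all

theorem eq_singleton (h : Link G a a l) (hl : l.Nodup) : l = [a] := by
  cases h with
  | single => rfl
  | cons _ h' => exact absurd h'.last_mem (List.nodup_cons.1 hl).1

theorem split (h : Link G a b l) (hx : x ∈ l) (hxa : x ≠ a) :
    ∃ c l₁ l₂, l = l₁ ++ l₂ ∧ Link G a c l₁ ∧ G.Adj c x ∧ Link G x b l₂ := by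
  induction h with
  | single a => simp_all
  | @cons a b c l hab h ih =>
    by_cases hxb : x = b
    · subst hxb
      exact ⟨a, [a], l, rfl, single a, hab, h⟩
    · obtain ⟨e, l₁, l₂, rfl, h₁, h₂, h₃⟩ := ih (by simp_all) hxb
      exact ⟨e, a :: l₁, l₂, rfl, cons hab h₁, h₂, h₃⟩

end Link

/-- `l` is the vertex sequence of a Hamilton path of `M` from `a` to `b`. -/
def HamPath {V : Type*} (M : SimpleGraph V) (a b : V) (l : List V) : Prop :=
  Link M a b l ∧ l.Nodup ∧ ∀ v, v ∈ l

/-- `M` has a Hamilton path with adjacent ends. -/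
def Ham {V : Type*} (M : SimpleGraph V) : Prop :=
  ∃ a b l, HamPath M a b l ∧ M.Adj b a

/-- The degree of `v` in `M`. -/
noncomputable def dg {V : Type*} (M : SimpleGraph V) (v : V) : ℕ := (M.neighborSet v).ncard

section

variable {V : Type*} {M N F : SimpleGraph V} {a b u v : V} {l l' : List V}

theorem HamPath.reverse (h : HamPath M a b l) : HamPath M b a l.reverse :=
  ⟨h.1.reverse, by simpa using h.2.1, by simpa using h.2.2⟩

theorem HamPath.ham_of_perm (h : HamPath N a b l) (hp : l'.Perm l) (h' : Link M u v l')
    (hvu : M.Adj v u) : Ham M :=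
  ⟨u, v, l', ⟨h', hp.nodup_iff.2 h.2.1, fun x => hp.mem_iff.2 (h.2.2 x)⟩, hvu⟩

theorem Ham.mono (hMN : M ≤ N) (h : Ham M) : Ham N := by
  obtain ⟨a, b, l, hl, hba⟩ := h
  exact ⟨a, b, l, ⟨hl.1.mono hMN, hl.2⟩, hMN hba⟩

theorem HamPath.length_eq (h : HamPath M a b l) : l.length = Nat.card V := by
  classical
  rw [← Set.ncard_univ, ← List.toFinset_card_of_nodup h.2.1, ← Set.ncard_coe_finset]
  congr 1
  ext x
  simp [h.2.2 x]

theorem Link.of_sup_edge (h : Link (M ⊔ edge u v) a b l) (hl : l.Nodup) :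
    Link M a b l ∨ ∃ l₁ l₂, l = l₁ ++ l₂ ∧
      ((Link M a u l₁ ∧ Link M v b l₂) ∨ (Link M a v l₁ ∧ Link M u b l₂)) := by
  induction h with
  | single a => exact Or.inl (.single a)
  | @cons a b c l hab h ih =>
    rw [List.nodup_cons] at hl
    have hab' : M.Adj a b ∨ (a = u ∧ b = v) ∨ (a = v ∧ b = u) := by
      rw [SimpleGraph.sup_adj, SimpleGraph.edge_adj] at hab
      tauto
    rcases ih hl.2 with h1 | ⟨l₁, l₂, rfl, h2⟩
    · rcases hab' with h | ⟨rfl, rfl⟩ | ⟨rfl, rfl⟩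
      · exact Or.inl (.cons h h1)
      · exact Or.inr ⟨[a], l, rfl, Or.inl ⟨.single a, h1⟩⟩
      · exact Or.inr ⟨[a], l, rfl, Or.inr ⟨.single a, h1⟩⟩
    · rcases hab' with h | h
      · refine Or.inr ⟨a :: l₁, l₂, rfl, ?_⟩
        rcases h2 with h2 | h2
        · exact Or.inl ⟨.cons h h2.1, h2.2⟩
        · exact Or.inr ⟨.cons h h2.1, h2.2⟩
      · exfalso
        have h3 := hl.1
        rw [List.mem_append] at h3
        have key : u ∈ l₁ ++ l₂ ∧ v ∈ l₁ ++ l₂ := by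
          rcases h2 with ⟨h4, h5⟩ | ⟨h4, h5⟩
          · exact ⟨by simp [h4.last_mem], by simp [h5.head_mem]⟩
          · exact ⟨by simp [h5.head_mem], by simp [h4.last_mem]⟩
        rcases h with ⟨rfl, rfl⟩ | ⟨rfl, rfl⟩
        · exact hl.1 key.1
        · exact hl.1 key.2

theorem exists_hamPath_of_ham_sup_edge (hn : 3 ≤ Nat.card V) (h : Ham (M ⊔ edge u v))
    (hM : ¬ Ham M) : ∃ l, HamPath M u v l := by
  obtain ⟨a, b, l, hl, hba⟩ := h
  have hlen := hl.length_eq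
  have hba' : M.Adj b a ∨ (b = u ∧ a = v) ∨ (b = v ∧ a = u) := by
    rw [SimpleGraph.sup_adj, SimpleGraph.edge_adj] at hba
    tauto
  have hnd := hl.2.1
  rcases hl.1.of_sup_edge hl.2.1 with h1 | ⟨l₁, l₂, rfl, h2⟩
  · have h1' : HamPath M a b l := ⟨h1, hl.2⟩
    rcases hba' with h | ⟨rfl, rfl⟩ | ⟨rfl, rfl⟩
    · exact absurd ⟨a, b, l, h1', h⟩ hM
    · exact ⟨_, h1'.reverse⟩
    · exact ⟨_, h1'⟩
  · have hp : (l₂ ++ l₁).Perm (l₁ ++ l₂) := List.perm_append_comm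
    rw [List.nodup_append] at hnd
    have hP : ∀ {x y : V}, Link M x y (l₂ ++ l₁) → HamPath M x y (l₂ ++ l₁) := fun hxy =>
      ⟨hxy, hp.nodup_iff.2 hl.2.1, fun z => hp.mem_iff.2 (hl.2.2 z)⟩
    rcases h2 with ⟨h4, h5⟩ | ⟨h4, h5⟩
    · rcases hba' with h | ⟨rfl, rfl⟩ | ⟨rfl, rfl⟩
      · exact ⟨_, (hP (h5.append h h4)).reverse⟩
      · exact absurd rfl (hnd.2.2 _ h4.last_mem _ h5.last_mem)
      · have e1 := h4.eq_singleton hnd.1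
        have e2 := h5.eq_singleton hnd.2.1
        subst e1 e2
        simp at hlen
        omega
    · rcases hba' with h | ⟨rfl, rfl⟩ | ⟨rfl, rfl⟩
      · exact ⟨_, hP (h5.append h h4)⟩
      · have e1 := h4.eq_singleton hnd.1
        have e2 := h5.eq_singleton hnd.2.1
        subst e1 e2
        simp at hlen
        omega
      · exact absurd rfl (hnd.2.2 _ h4.last_mem _ h5.last_mem)

theorem Link.countP_add_countP_le (P Q : V → Prop) [DecidablePred P] [DecidablePred Q]
    (h : Link M a b l)
    (hc : ∀ c d l₁ l₂, l = l₁ ++ l₂ → Link M a c l₁ → M.Adj c d → Link M d b l₂ →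
      P d → Q c → False) :
    l.countP (fun x => P x) + l.countP (fun x => Q x) + 1 ≤
      l.length + (if P a then 1 else 0) + (if Q b then 1 else 0) := by
  induction h with
  | single a => simp [List.countP_cons]
  | @cons a b c l hab h ih =>
    have h1 := ih fun e f l₁ l₂ he h₁ h₂ h₃ =>
      hc e f (a :: l₁) l₂ (by simp [he]) (.cons hab h₁) h₂ h₃
    have h2 := hc a b [a] l rfl (.single a) hab h
    simp only [List.countP_cons, List.length_cons, decide_eq_true_eq]
    split_ifs at * <;> first | omega | (exfalso; tauto)

theorem HamPath.countP_eq_dg (h : HamPath M a b l) (u : V) [DecidablePred (N.Adj u)] :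
    l.countP (fun x => N.Adj u x) = dg N u := by
  classical
  rw [List.countP_eq_length_filter, ← List.toFinset_card_of_nodup (h.2.1.filter _),
    ← Set.ncard_coe_finset, dg]
  congr 1
  ext x
  simp [h.2.2 x]

/-- The crossing argument of Ore. -/
theorem HamPath.ham_of_le (h : HamPath M u v l) (hd : Nat.card V ≤ dg M u + dg M v) :
    Ham M := by
  classical
  by_contra hM
  have h1 := h.1.countP_add_countP_le (fun x => M.Adj u x) (fun x => M.Adj v x) (by
    intro c d l₁ l₂ e h₁ h₂ h₃ hud hvc
    refine hM (h.ham_of_perm (M := M) (l' := l₁.reverse ++ l₂) ?_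
      (h₁.reverse.append hud h₃) hvc)
    rw [e]
    exact (List.reverse_perm l₁).append_right l₂)
  rw [h.countP_eq_dg, h.countP_eq_dg, h.length_eq] at h1
  simp at h1
  omega

theorem dg_mono [Finite V] (h : M ≤ N) (x : V) : dg M x ≤ dg N x :=
  Set.ncard_le_ncard (fun _ hy => h hy) (Set.toFinite _)

/-- Between a non-Hamiltonian graph and a supergraph `N` there is a non-Hamiltonian graph in
which all the missing pairs of `N` are joined by Hamilton paths. -/
theorem exists_saturated [Finite V] (hn : 3 ≤ Nat.card V) (hFN : F ≤ N) (hF : ¬ Ham F) :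
    ∃ M, F ≤ M ∧ M ≤ N ∧ ¬ Ham M ∧
      ∀ a b, N.Adj a b → ¬ M.Adj a b → ∃ l, HamPath M a b l := by
  obtain ⟨M, hFM, hM⟩ := (Set.toFinite {M : SimpleGraph V | F ≤ M ∧ M ≤ N ∧ ¬ Ham M}).exists_le_maximal
    (a := F) ⟨le_rfl, hFN, hF⟩
  refine ⟨M, hM.1.1, hM.1.2.1, hM.1.2.2, fun a b hab hab' => ?_⟩
  refine exists_hamPath_of_ham_sup_edge hn ?_ hM.1.2.2
  by_contra hh
  have hle : M ⊔ edge a b ≤ M := hM.2 ⟨hM.1.1.trans le_sup_left, ?_, hh⟩ le_sup_left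
  · refine hab' (hle ?_)
    rw [SimpleGraph.sup_adj, SimpleGraph.edge_adj]
    exact Or.inr ⟨Or.inl ⟨rfl, rfl⟩, hab.ne⟩
  · refine sup_le hM.1.2.1 ?_
    intro x y hxy
    rw [SimpleGraph.edge_adj] at hxy
    rcases hxy with ⟨⟨rfl, rfl⟩ | ⟨rfl, rfl⟩, -⟩
    · exact hab
    · exact hab.symm

/-- The graph joining the pairs of vertices whose degree sum in `F` is at least the order. -/
def heavyGraph (F : SimpleGraph V) : SimpleGraph V where
  Adj a b := a ≠ b ∧ Nat.card V ≤ dg F a + dg F b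
  symm := ⟨fun _ _ h => ⟨h.1.symm, by omega⟩⟩
  loopless := ⟨fun _ h => h.1 rfl⟩

theorem heavyGraph_adj : (heavyGraph F).Adj a b ↔ a ≠ b ∧ Nat.card V ≤ dg F a + dg F b :=
  Iff.rfl

theorem not_ham_sup_heavyGraph [Finite V] (hn : 3 ≤ Nat.card V) (hFM : F ≤ M) (hM : ¬ Ham M) :
    ¬ Ham (M ⊔ heavyGraph F) := by
  obtain ⟨M', h1, h2, h3, h4⟩ := exists_saturated hn (le_sup_left (a := M) (b := heavyGraph F)) hM
  suffices M ⊔ heavyGraph F ≤ M' from fun h => h3 (h.mono this)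
  intro a b hab
  by_contra hab'
  obtain ⟨l, hl⟩ := h4 a b hab hab'
  have h5 : (heavyGraph F).Adj a b := hab.resolve_left fun h => hab' (h1 h)
  refine h3 (hl.ham_of_le (h5.2.trans ?_))
  exact add_le_add (dg_mono (hFM.trans h1) a) (dg_mono (hFM.trans h1) b)

end

/-- Every induced claw has two leaves with degree sum at least the order. -/
def LeafHeavy {V : Type*} (F : SimpleGraph V) : Prop :=
  ∀ a b₁ b₂ b₃ : V, b₁ ≠ b₂ → b₁ ≠ b₃ → b₂ ≠ b₃ → F.Adj a b₁ → F.Adj a b₂ → F.Adj a b₃ →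
    F.Adj b₁ b₂ ∨ F.Adj b₁ b₃ ∨ F.Adj b₂ b₃ ∨
      (heavyGraph F).Adj b₁ b₂ ∨ (heavyGraph F).Adj b₁ b₃ ∨ (heavyGraph F).Adj b₂ b₃

/-- The neighbourhood of `c` is a clique. -/
def Simplicial {V : Type*} (F : SimpleGraph V) (c : V) : Prop :=
  ∀ a b, F.Adj c a → F.Adj c b → a ≠ b → F.Adj a b

/-- The local completion of `F` at `x`: the neighbourhood of `x` is made a clique. -/
def locComp {V : Type*} (F : SimpleGraph V) (x : V) : SimpleGraph V where
  Adj a b := a ≠ b ∧ (F.Adj a b ∨ (F.Adj x a ∧ F.Adj x b))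
  symm := ⟨fun _ _ h => ⟨h.1.symm, h.2.imp (fun h => h.symm) fun h => h.symm⟩⟩
  loopless := ⟨fun _ h => h.1 rfl⟩

/-- The subgraph of `G` consisting of the edges inside `S`. -/
def within {V : Type*} (G : SimpleGraph V) (S : Set V) : SimpleGraph V where
  Adj a b := G.Adj a b ∧ a ∈ S ∧ b ∈ S
  symm := ⟨fun _ _ h => ⟨h.1.symm, h.2.2, h.2.1⟩⟩
  loopless := ⟨fun _ h => h.1.ne rfl⟩

/-- The vertices that may be used to replace an edge `pq` of `F` by a path of `G`. -/
def detour {V : Type*} (F : SimpleGraph V) (p q : V) : Set V :=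
  {c | c = p ∨ c = q ∨ (Simplicial F c ∧ F.Adj c p ∧ F.Adj c q)}

/-- Each edge `pq` of `F` can be replaced by a path of `G` through simplicial vertices. -/
def Lifts {V : Type*} (G F : SimpleGraph V) : Prop :=
  ∀ p q, F.Adj p q → (within G (detour F p q)).Reachable p q

section

variable {V : Type*} {G F M : SimpleGraph V} {a b c p q u v x y z : V} {l : List V}

theorem le_locComp : F ≤ locComp F x := fun _ _ h => ⟨h.ne, Or.inl h⟩

theorem locComp_adj_of_not_adj (h : (locComp F x).Adj a b) (hb : ¬ F.Adj x b) : F.Adj a b :=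
  h.2.resolve_right fun h => hb h.2

theorem dg_le_dg_locComp [Finite V] (h : F.Adj x b) : dg F x ≤ dg (locComp F x) b := by
  classical
  refine Set.ncard_le_ncard_of_injOn (fun y => if y = b then x else y) ?_ ?_ (Set.toFinite _)
  · intro y hy
    rw [SimpleGraph.mem_neighborSet] at hy
    simp only [SimpleGraph.mem_neighborSet]
    split_ifs with hyb
    · exact le_locComp h.symm
    · exact ⟨fun e => hyb e.symm, Or.inr ⟨h, hy⟩⟩
  · intro y hy y' hy' he
    simp only [SimpleGraph.mem_neighborSet] at hy hy'
    have h1 := hy.ne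
    have h2 := hy'.ne
    simp only at he
    split_ifs at he <;> simp_all

theorem heavyGraph_mono_of_le [Finite V] (h : F ≤ M) : heavyGraph F ≤ heavyGraph M :=
  fun a b hab => ⟨hab.1, hab.2.trans (add_le_add (dg_mono h a) (dg_mono h b))⟩

theorem LeafHeavy.locComp_aux [Finite V] (h : LeafHeavy F) {b₁ b₂ b₃ : V}
    (h12 : b₁ ≠ b₂) (h13 : b₁ ≠ b₃) (h23 : b₂ ≠ b₃) (h1 : (locComp F x).Adj a b₁)
    (h2 : (locComp F x).Adj a b₂) (h3 : (locComp F x).Adj a b₃) (hF : ¬ F.Adj a b₁)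
    (n12 : ¬ (locComp F x).Adj b₁ b₂) (n13 : ¬ (locComp F x).Adj b₁ b₃)
    (n23 : ¬ (locComp F x).Adj b₂ b₃) :
    (heavyGraph (locComp F x)).Adj b₁ b₂ ∨ (heavyGraph (locComp F x)).Adj b₁ b₃ ∨
      (heavyGraph (locComp F x)).Adj b₂ b₃ := by
  have hx := h1.2.resolve_left hF
  have x2 : ¬ F.Adj x b₂ := fun h => n12 ⟨h12, Or.inr ⟨hx.2, h⟩⟩
  have x3 : ¬ F.Adj x b₃ := fun h => n13 ⟨h13, Or.inr ⟨hx.2, h⟩⟩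
  have e2 : x ≠ b₂ := by rintro rfl; exact n12 (le_locComp hx.2.symm)
  have e3 : x ≠ b₃ := by rintro rfl; exact n13 (le_locComp hx.2.symm)
  have hd := dg_le_dg_locComp hx.2
  have hm := fun y => dg_mono (le_locComp (F := F) (x := x)) y
  rcases h a x b₂ b₃ e2 e3 h23 hx.1.symm (locComp_adj_of_not_adj h2 x2)
    (locComp_adj_of_not_adj h3 x3) with h | h | h | h | h | h
  · exact absurd h x2
  · exact absurd h x3
  · exact absurd (le_locComp h) n23
  · have := hm b₂
    exact Or.inl ⟨h12, by have := h.2; omega⟩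
  · have := hm b₃
    exact Or.inr (Or.inl ⟨h13, by have := h.2; omega⟩)
  · exact Or.inr (Or.inr (heavyGraph_mono_of_le le_locComp h))

theorem LeafHeavy.locComp [Finite V] (h : LeafHeavy F) : LeafHeavy (locComp F x) := by
  intro a b₁ b₂ b₃ h12 h13 h23 h1 h2 h3
  by_contra! hcon
  obtain ⟨n12, n13, n23, k12, k13, k23⟩ := hcon
  by_cases f1 : F.Adj a b₁
  · by_cases f2 : F.Adj a b₂
    · by_cases f3 : F.Adj a b₃
      · have hle := le_locComp (F := F) (x := x)
        have hle' := heavyGraph_mono_of_le hle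
        rcases h a b₁ b₂ b₃ h12 h13 h23 f1 f2 f3 with h | h | h | h | h | h
        exacts [n12 (hle h), n13 (hle h), n23 (hle h), k12 (hle' h), k13 (hle' h), k23 (hle' h)]
      · rcases h.locComp_aux h13.symm h23.symm h12 h3 h1 h2 f3 (fun h => n13 h.symm)
          (fun h => n23 h.symm) n12 with h | h | h
        exacts [k13 h.symm, k23 h.symm, k12 h]
    · rcases h.locComp_aux h12.symm h23 h13 h2 h1 h3 f2 (fun h => n12 h.symm) n23 n13
        with h | h | h
      exacts [k12 h.symm, k23 h, k13 h]
  · rcases h.locComp_aux h12 h13 h23 h1 h2 h3 f1 n12 n13 n23 with h | h | h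
    exacts [k12 h, k13 h, k23 h]

theorem Simplicial.locComp (h : Simplicial F c) : Simplicial (locComp F x) c := by
  intro a b ha hb hab
  refine ⟨hab, ?_⟩
  by_cases hxc : F.Adj x c
  · have key : ∀ y, (ClawHeavy.locComp F x).Adj c y → y = x ∨ F.Adj x y := by
      intro y hy
      rcases hy.2 with h1 | h1
      · by_cases hyx : y = x
        · exact Or.inl hyx
        · exact Or.inr (h x y hxc.symm h1 (Ne.symm hyx))
      · exact Or.inr h1.2
    rcases key a ha with rfl | h1
    · exact Or.inl ((key b hb).resolve_left hab.symm)
    · rcases key b hb with rfl | h2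
      · exact Or.inl h1.symm
      · exact Or.inr ⟨h1, h2⟩
  · exact Or.inl (h a b (ha.2.resolve_right fun h => hxc h.1) (hb.2.resolve_right fun h => hxc h.1)
      hab)

theorem simplicial_locComp_self : Simplicial (locComp F x) x := by
  intro a b ha hb hab
  exact ⟨hab, Or.inr ⟨ha.2.elim id fun h => h.2, hb.2.elim id fun h => h.2⟩⟩

theorem within_mono {S T : Set V} (h : S ⊆ T) : within G S ≤ within G T :=
  fun _ _ hab => ⟨hab.1, h hab.2.1, h hab.2.2⟩

theorem lifts_self : Lifts G G := fun _ _ h =>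
  SimpleGraph.Adj.reachable ⟨h, Or.inl rfl, Or.inr (Or.inl rfl)⟩

theorem Lifts.locComp (h : Lifts G F) : Lifts G (locComp F x) := by
  intro p q hpq
  by_cases hF : F.Adj p q
  · refine (h p q hF).mono (within_mono ?_)
    rintro c (rfl | rfl | ⟨h1, h2, h3⟩)
    · exact Or.inl rfl
    · exact Or.inr (Or.inl rfl)
    · exact Or.inr (Or.inr ⟨h1.locComp, le_locComp h2, le_locComp h3⟩)
  · have hx := hpq.2.resolve_left hF
    have hsub : ∀ p q, F.Adj x p → F.Adj x q → detour F p x ⊆ detour (ClawHeavy.locComp F x) p q := by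
      rintro p q hp hq c (rfl | rfl | ⟨h1, h2, h3⟩)
      · exact Or.inl rfl
      · exact Or.inr (Or.inr ⟨simplicial_locComp_self, le_locComp hp, le_locComp hq⟩)
      · by_cases hcq : c = q
        · exact Or.inr (Or.inl hcq)
        · exact Or.inr (Or.inr ⟨h1.locComp, le_locComp h2, hcq, Or.inr ⟨h3.symm, hq⟩⟩)
    have h1 := (h p x hx.1.symm).mono (within_mono (hsub p q hx.1 hx.2))
    have h2 := (h q x hx.2.symm).mono (within_mono (hsub q p hx.2 hx.1))
    have hc : detour (ClawHeavy.locComp F x) q p ⊆ detour (ClawHeavy.locComp F x) p q := by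
      rintro c (rfl | rfl | ⟨h1, h2, h3⟩)
      · exact Or.inr (Or.inl rfl)
      · exact Or.inl rfl
      · exact Or.inr (Or.inr ⟨h1, h3, h2⟩)
    exact h1.trans (h2.mono (within_mono hc)).symm

/-- A Hamilton path with two marked inner vertices `x`, `y`, cut at these vertices; after a
reversal `x` comes first. -/
theorem HamPath.exists_cut (h : HamPath M u v l) (hxu : x ≠ u) (hxv : x ≠ v) (hyu : y ≠ u)
    (hyv : y ≠ v) (hxy : x ≠ y) :
    ∃ u' v' l' A C c d, ((u' = u ∧ v' = v) ∨ (u' = v ∧ v' = u)) ∧ HamPath M u' v' l' ∧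
      Link M u' c A ∧ M.Adj c x ∧ M.Adj y d ∧ Link M d v' C ∧
      ((l' = A ++ x :: y :: C ∧ M.Adj x y) ∨
        ∃ B e f, l' = A ++ x :: (B ++ y :: C) ∧ M.Adj x e ∧ Link M e f B ∧ M.Adj f y) := by
  have main : ∀ x y, x ≠ u → x ≠ v → y ≠ u → y ≠ v → x ≠ y → ∀ A X c, l = A ++ X →
      Link M u c A → M.Adj c x → Link M x v X → y ∈ X →
      ∃ C d, M.Adj y d ∧ Link M d v C ∧ ((l = A ++ x :: y :: C ∧ M.Adj x y) ∨
        ∃ B e f, l = A ++ x :: (B ++ y :: C) ∧ M.Adj x e ∧ Link M e f B ∧ M.Adj f y) := by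
    intro x y hxu hxv hyu hyv hxy A X c hl hA hcx hX hy
    obtain ⟨f, XB, Y, rfl, hXB, hfy, hY⟩ := hX.split hy (Ne.symm hxy)
    cases hY with
    | single => exact absurd rfl hyv
    | @cons _ d _ C hyd hC =>
      refine ⟨C, d, hyd, hC, ?_⟩
      cases hXB with
      | single => exact Or.inl ⟨hl, hfy⟩
      | @cons _ e _ B hxe hB => exact Or.inr ⟨B, e, f, by simpa using hl, hxe, hB, hfy⟩
  obtain ⟨c, A, X, rfl, hA, hcx, hX⟩ := h.1.split (h.2.2 x) hxu
  have hy := h.2.2 y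
  rw [List.mem_append] at hy
  rcases hy with hy | hy
  · obtain ⟨c', A', X', rfl, hA', hcy, hX'⟩ := hA.split hy hyu
    obtain ⟨C, d, hxd, hC, h1⟩ := main y x hyu hyv hxu hxv hxy.symm A' (X' ++ X) c' (by simp) hA' hcy
      (hX'.append hcx hX) (by simp [hX.head_mem])
    refine ⟨v, u, _, C.reverse, A'.reverse, d, c', Or.inr ⟨rfl, rfl⟩, h.reverse, hC.reverse,
      hxd.symm, hcy.symm, hA'.reverse, ?_⟩
    rcases h1 with ⟨h1, h2⟩ | ⟨B, e, f, h1, h2, h3, h4⟩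
    · exact Or.inl ⟨by rw [h1]; simp, h2.symm⟩
    · exact Or.inr ⟨B.reverse, f, e, by rw [h1]; simp, h4.symm, h3.reverse, h2.symm⟩
  · obtain ⟨C, d, hyd, hC, h1⟩ := main x y hxu hxv hyu hyv hxy A X c rfl hA hcx hX hy
    exact ⟨u, v, _, A, C, c, d, Or.inl ⟨rfl, rfl⟩, h, hA, hcx, hyd, hC, h1⟩

/-- `M` is a maximal non-Hamiltonian graph between `F` and its local completion at `x`. -/
structure Saturated (F M : SimpleGraph V) (x : V) : Prop where
  leaf : LeafHeavy F
  le : F ≤ M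
  le_comp : M ≤ locComp F x
  not_ham : ¬ Ham M
  hamPath : ∀ a b, F.Adj x a → F.Adj x b → a ≠ b → ¬ M.Adj a b → ∃ l, HamPath M a b l

namespace Saturated

theorem adj_iff (S : Saturated F M x) : M.Adj x a ↔ F.Adj x a := by
  refine ⟨fun h => ?_, fun h => S.le h⟩
  rcases (S.le_comp h).2 with h | h
  · exact h
  · exact h.2

theorem adj_of_heavy [Finite V] (S : Saturated F M x) (ha : F.Adj x a) (hb : F.Adj x b)
    (h : (heavyGraph F).Adj a b) : M.Adj a b := by
  by_contra hab
  obtain ⟨l, hl⟩ := S.hamPath a b ha hb h.1 hab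
  exact S.not_ham (hl.ham_of_le (h.2.trans (add_le_add (dg_mono S.le a) (dg_mono S.le b))))

theorem adj_or_adj [Finite V] (S : Saturated F M x) (ha : F.Adj x a) (hu : F.Adj x u)
    (hv : F.Adj x v) (huv : u ≠ v) (hau : a ≠ u) (hav : a ≠ v) (h : ¬ M.Adj u v) :
    M.Adj a u ∨ M.Adj a v := by
  rcases S.leaf x a u v hau hav huv ha hu hv with h1 | h1 | h1 | h1 | h1 | h1
  · exact Or.inl (S.le h1)
  · exact Or.inr (S.le h1)
  · exact absurd (S.le h1) h
  · exact Or.inl (S.adj_of_heavy ha hu h1)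
  · exact Or.inr (S.adj_of_heavy ha hv h1)
  · exact absurd (S.adj_of_heavy hu hv h1) h

theorem exists_nonadjacent [Finite V] (hn : 3 ≤ Nat.card V) (S : Saturated F M x)
    (hu : F.Adj x u) (hv : F.Adj x v) (huv : u ≠ v) (h : ¬ M.Adj u v)
    (hyx : y ≠ x) (hyu : M.Adj y u) (hyv : M.Adj y v) :
    ∃ u' f d, (u' = u ∨ u' = v) ∧ M.Adj y f ∧ M.Adj y d ∧ f ≠ d ∧ x ≠ f ∧ x ≠ d ∧ u' ≠ f ∧
      u' ≠ d ∧ ¬ (M ⊔ heavyGraph F).Adj x f ∧ ¬ (M ⊔ heavyGraph F).Adj x d ∧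
      ¬ (M ⊔ heavyGraph F).Adj f d ∧ ((heavyGraph F).Adj x y →
        ¬ (M ⊔ heavyGraph F).Adj u' f ∧ ¬ (M ⊔ heavyGraph F).Adj u' d) := by
  classical
  obtain ⟨l, hl⟩ := S.hamPath u v hu hv huv h
  have hK := not_ham_sup_heavyGraph hn S.le S.not_ham
  have hMK : M ≤ M ⊔ heavyGraph F := le_sup_left
  obtain ⟨u', v', l', A, C, c, d, huv', hl', hA, hcx, hyd, hC, h1⟩ :=
    hl.exists_cut hu.ne hv.ne hyu.ne hyv.ne hyx.symm
  have hu' : F.Adj x u' := by rcases huv' with ⟨rfl, rfl⟩ | ⟨rfl, rfl⟩ <;> assumption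
  have hv' : F.Adj x v' := by rcases huv' with ⟨rfl, rfl⟩ | ⟨rfl, rfl⟩ <;> assumption
  have hyu' : M.Adj y u' := by rcases huv' with ⟨rfl, rfl⟩ | ⟨rfl, rfl⟩ <;> assumption
  have hyv' : M.Adj y v' := by rcases huv' with ⟨rfl, rfl⟩ | ⟨rfl, rfl⟩ <;> assumption
  have huv'' : ¬ M.Adj u' v' ∧ u' ≠ v' := by
    rcases huv' with ⟨rfl, rfl⟩ | ⟨rfl, rfl⟩
    · exact ⟨h, huv⟩
    · exact ⟨fun h' => h h'.symm, huv.symm⟩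
  rcases h1 with ⟨rfl, hxy⟩ | ⟨B, e, f, rfl, hxe, hB, hfy⟩
  · exfalso
    refine S.not_ham (hl'.ham_of_perm (l' := (A ++ [x]) ++ (y :: C).reverse)
      (List.perm_iff_count.2 fun z => by
        simp only [List.count_append, List.count_cons, List.count_reverse, List.count_nil]
        omega) ?_ hyu')
    exact (hA.append hcx (.single x)).append (S.le hv') (Link.cons hyd hC).reverse
  have hnd := hl'.2.1
  have mA : ∀ {z}, z ∈ A → z ≠ x ∧ z ∉ B ∧ z ≠ y ∧ z ∉ C := by
    intro z hz
    rw [List.nodup_append] at hnd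
    refine ⟨?_, fun h => ?_, ?_, fun h => ?_⟩
    · rintro rfl; exact hnd.2.2 z hz z (by simp) rfl
    · exact hnd.2.2 z hz z (by simp [h]) rfl
    · rintro rfl; exact hnd.2.2 z hz z (by simp) rfl
    · exact hnd.2.2 z hz z (by simp [h]) rfl
  have hnd2 := (List.nodup_append.1 hnd).2.1
  rw [List.nodup_cons] at hnd2
  have mx : x ∉ B ∧ x ≠ y ∧ x ∉ C := by
    have := hnd2.1
    simp only [List.mem_append, List.mem_cons, not_or] at this
    tauto
  have mB : ∀ {z}, z ∈ B → z ∉ C := by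
    intro z hz hz'
    exact (List.nodup_append.1 hnd2.2).2.2 z hz z (by simp [hz']) rfl
  have heu : ¬ M.Adj e u' := fun heu => by
    refine S.not_ham (hl'.ham_of_perm (l' := (A ++ [x]) ++ (B ++ y :: C).reverse)
      (List.perm_iff_count.2 fun z => by
        simp only [List.count_append, List.count_cons, List.count_reverse, List.count_nil]
        omega) ?_ heu)
    exact (hA.append hcx (.single x)).append (S.le hv') (hB.append hfy (.cons hyd hC)).reverse
  have hev : M.Adj e v' := by
    refine (S.adj_or_adj (S.adj_iff.1 hxe) hu' hv' huv''.2 ?_ ?_ huv''.1).resolve_left heu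
    · rintro rfl; exact (mA hA.head_mem).2.1 hB.head_mem
    · rintro rfl; exact mB hB.head_mem hC.last_mem
  refine ⟨u', f, d, huv'.imp And.left And.left, hfy.symm, hyd, ?_, ?_, ?_, ?_, ?_, fun h => ?_,
    fun h => ?_, fun h => ?_, fun hxy => ⟨fun h => ?_, fun h => ?_⟩⟩
  · rintro rfl; exact mB hB.last_mem hC.head_mem
  · rintro rfl; exact mx.1 hB.last_mem
  · rintro rfl; exact mx.2.2 hC.head_mem
  · rintro rfl; exact (mA hA.head_mem).2.1 hB.last_mem
  · rintro rfl; exact (mA hA.head_mem).2.2.2 hC.head_mem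
  · refine hK (hl'.ham_of_perm (l' := (((y :: C) ++ B) ++ [x]) ++ A.reverse)
      (List.perm_iff_count.2 fun z => by
        simp only [List.count_append, List.count_cons, List.count_reverse, List.count_nil]
        omega) ?_ (hMK hyu'.symm))
    exact ((((Link.cons hyd hC).append hev.symm hB).mono hMK).append h.symm (.single x)).append
      (hMK hcx.symm) (hA.reverse.mono hMK)
  · refine hK (hl'.ham_of_perm (l' := ((C ++ (B ++ [y])) ++ A) ++ [x])
      (List.perm_iff_count.2 fun z => by
        simp only [List.count_append, List.count_cons, List.count_reverse, List.count_nil]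
        omega) ?_ h)
    exact (((hC.append hev.symm (hB.append hfy (.single y))).append hyu' hA).append hcx
      (.single x)).mono hMK
  · refine hK (hl'.ham_of_perm (l' := ((A ++ (x :: B)) ++ C) ++ [y])
      (List.perm_iff_count.2 fun z => by
        simp only [List.count_append, List.count_cons, List.count_reverse, List.count_nil]
        omega) ?_ (hMK hyu'))
    exact (((hA.append hcx (.cons hxe hB)).mono hMK).append h (hC.mono hMK)).append
      (hMK hyv'.symm) (.single y)
  · refine hK (hl'.ham_of_perm (l' := ((y :: C) ++ B) ++ (A ++ [x]))
      (List.perm_iff_count.2 fun z => by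
        simp only [List.count_append, List.count_cons, List.count_reverse, List.count_nil]
        omega) ?_ (Or.inr hxy))
    exact (((Link.cons hyd hC).append hev.symm hB).mono hMK).append h.symm
      ((hA.append hcx (.single x)).mono hMK)
  · refine hK (hl'.ham_of_perm (l' := ((A ++ (x :: B)) ++ [y]) ++ C.reverse)
      (List.perm_iff_count.2 fun z => by
        simp only [List.count_append, List.count_cons, List.count_reverse, List.count_nil]
        omega) ?_ h.symm)
    exact (((hA.append hcx (.cons hxe hB)).append hfy (.single y)).append hyv'
      hC.reverse).mono hMK

theorem false_of_common [Finite V] (hn : 3 ≤ Nat.card V) (S : Saturated F M x)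
    (hu : F.Adj x u) (hv : F.Adj x v) (huv : u ≠ v) (h : ¬ M.Adj u v)
    (hy : F.Adj x y) (hyu : M.Adj y u) (hyv : M.Adj y v) : False := by
  obtain ⟨u', f, d, -, h1, h2, h3, h4, h5, -, -, h6, h7, h8, -⟩ :=
    S.exists_nonadjacent hn hu hv huv h hy.ne.symm hyu hyv
  have hMK : M ≤ M ⊔ heavyGraph F := le_sup_left
  have hHK : heavyGraph F ≤ M ⊔ heavyGraph F := le_sup_right
  have hFK := S.le.trans hMK
  have hf : F.Adj y f := locComp_adj_of_not_adj (S.le_comp h1) fun h => h6 (hFK h)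
  have hd : F.Adj y d := locComp_adj_of_not_adj (S.le_comp h2) fun h => h7 (hFK h)
  rcases S.leaf y x f d h4 h5 h3 hy.symm hf hd with h | h | h | h | h | h
  exacts [h6 (hFK h), h7 (hFK h), h8 (hFK h), h6 (hHK h), h7 (hHK h), h8 (hHK h)]

theorem false_of_heavy [Finite V] (hn : 3 ≤ Nat.card V) (S : Saturated F M x)
    (hu : F.Adj x u) (hv : F.Adj x v) (huv : u ≠ v) (h : ¬ M.Adj u v)
    (hz : ¬ F.Adj x z) (hxz : (heavyGraph F).Adj x z) (hzu : F.Adj z u) (hzv : F.Adj z v) :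
    False := by
  obtain ⟨u', f, d, h0, h1, h2, h3, h4, h5, h9, h10, h6, h7, h8, h11⟩ :=
    S.exists_nonadjacent hn hu hv huv h hxz.1.symm (S.le hzu) (S.le hzv)
  obtain ⟨h11, h12⟩ := h11 hxz
  have hMK : M ≤ M ⊔ heavyGraph F := le_sup_left
  have hHK : heavyGraph F ≤ M ⊔ heavyGraph F := le_sup_right
  have hFK := S.le.trans hMK
  have hf : F.Adj z f := (locComp_adj_of_not_adj (S.le_comp h1.symm) hz).symm
  have hd : F.Adj z d := (locComp_adj_of_not_adj (S.le_comp h2.symm) hz).symm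
  have hu' : F.Adj z u' := by rcases h0 with rfl | rfl <;> assumption
  rcases S.leaf z u' f d h9 h10 h3 hu' hf hd with h | h | h | h | h | h
  exacts [h11 (hFK h), h12 (hFK h), h8 (hFK h), h11 (hHK h), h12 (hHK h), h8 (hHK h)]

end Saturated

/-- The neighbourhood of `x` is split into two parts which are not joined by edges or heavy
pairs. -/
structure HasParts (F : SimpleGraph V) (x : V) (A B : Set V) : Prop where
  left : A.Nonempty
  right : B.Nonempty
  adj_iff : ∀ a, F.Adj x a ↔ a ∈ A ∨ a ∈ B
  cross : ∀ a ∈ A, ∀ b ∈ B, a ≠ b ∧ ¬ F.Adj a b ∧ ¬ (heavyGraph F).Adj a b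
  cliqueL : ∀ a ∈ A, ∀ b ∈ A, a ≠ b → F.Adj a b ∨ (heavyGraph F).Adj a b
  cliqueR : ∀ a ∈ B, ∀ b ∈ B, a ≠ b → F.Adj a b ∨ (heavyGraph F).Adj a b
  heavy : ∀ z, ¬ F.Adj x z → (heavyGraph F).Adj x z → ∀ a ∈ A, ∀ b ∈ B,
    F.Adj z a → F.Adj z b → False

theorem HasParts.swap {A B : Set V} (h : HasParts F x A B) : HasParts F x B A where
  left := h.right
  right := h.left
  adj_iff a := (h.adj_iff a).trans or_comm
  cross a ha b hb := by
    obtain ⟨h1, h2, h3⟩ := h.cross b hb a ha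
    exact ⟨h1.symm, fun h => h2 h.symm, fun h => h3 h.symm⟩
  cliqueL := h.cliqueR
  cliqueR := h.cliqueL
  heavy z hz hxz a ha b hb hza hzb := h.heavy z hz hxz b hb a ha hzb hza

theorem Saturated.hasParts [Finite V] (hn : 3 ≤ Nat.card V) (S : Saturated F M x)
    (hu : F.Adj x u) (hv : F.Adj x v) (huv : u ≠ v) (h : ¬ M.Adj u v) :
    HasParts F x {a | F.Adj x a ∧ (a = u ∨ M.Adj a u)} {a | F.Adj x a ∧ (a = v ∨ M.Adj a v)} := by
  have cross : ∀ a, F.Adj x a → (a = u ∨ M.Adj a u) → ∀ b, F.Adj x b → (b = v ∨ M.Adj b v) →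
      a ≠ b ∧ ¬ M.Adj a b := by
    intro a ha hau b hb hbv
    have hav : ¬ M.Adj a v := by
      rcases hau with rfl | hau
      · exact h
      · exact fun hav => S.false_of_common hn hu hv huv h ha hau hav
    have hav' : a ≠ v := by
      rintro rfl
      rcases hau with rfl | hau
      · exact huv rfl
      · exact h hau.symm
    rcases hbv with rfl | hbv
    · exact ⟨hav', hav⟩
    · refine ⟨?_, fun hab => S.false_of_common hn ha hv hav' hav hb hab.symm hbv⟩
      rintro rfl
      exact hav hbv
  have cross' : ∀ a, F.Adj x a → (a = u ∨ M.Adj a u) → ∀ b, F.Adj x b → (b = v ∨ M.Adj b v) →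
      a ≠ b ∧ ¬ F.Adj a b ∧ ¬ (heavyGraph F).Adj a b := by
    intro a ha hau b hb hbv
    obtain ⟨h1, h2⟩ := cross a ha hau b hb hbv
    exact ⟨h1, fun h => h2 (S.le h), fun h => h2 (S.adj_of_heavy ha hb h)⟩
  refine ⟨⟨u, hu, Or.inl rfl⟩, ⟨v, hv, Or.inl rfl⟩, fun a => ⟨fun ha => ?_, ?_⟩, ?_, ?_, ?_, ?_⟩
  · by_cases h1 : a = u
    · exact Or.inl ⟨ha, Or.inl h1⟩
    by_cases h2 : a = v
    · exact Or.inr ⟨ha, Or.inl h2⟩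
    rcases S.adj_or_adj ha hu hv huv h1 h2 h with h | h
    · exact Or.inl ⟨ha, Or.inr h⟩
    · exact Or.inr ⟨ha, Or.inr h⟩
  · rintro (h | h) <;> exact h.1
  · rintro a ⟨ha, ha'⟩ b ⟨hb, hb'⟩
    exact cross' a ha ha' b hb hb'
  · rintro a ⟨ha, ha'⟩ b ⟨hb, hb'⟩ hab
    obtain ⟨a1, a2, a3⟩ := cross' a ha ha' v hv (Or.inl rfl)
    obtain ⟨b1, b2, b3⟩ := cross' b hb hb' v hv (Or.inl rfl)
    rcases S.leaf x a b v hab a1 b1 ha hb hv with h | h | h | h | h | h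
    exacts [Or.inl h, absurd h a2, absurd h b2, Or.inr h, absurd h a3, absurd h b3]
  · rintro a ⟨ha, ha'⟩ b ⟨hb, hb'⟩ hab
    obtain ⟨a1, a2, a3⟩ := cross' u hu (Or.inl rfl) a ha ha'
    obtain ⟨b1, b2, b3⟩ := cross' u hu (Or.inl rfl) b hb hb'
    rcases S.leaf x u a b a1 b1 hab hu ha hb with h | h | h | h | h | h
    exacts [absurd h a2, absurd h b2, Or.inl h, absurd h a3, absurd h b3, Or.inr h]
  · rintro z hz hxz a ⟨ha, ha'⟩ b ⟨hb, hb'⟩ hza hzb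
    obtain ⟨h1, h2⟩ := cross a ha ha' b hb hb'
    exact S.false_of_heavy hn ha hb h1 h2 hz hxz hza hzb

theorem adj_of_heavy_of_hasParts [Finite V]
    (hF : ∀ x, Simplicial F x ∨ ∃ A B, HasParts F x A B) (h : (heavyGraph F).Adj u v) :
    F.Adj u v := by
  by_contra huv
  have hcard : (({u, v} ∪ (F.neighborSet u ∪ F.neighborSet v))ᶜ : Set V).ncard <
      (F.neighborSet u ∩ F.neighborSet v).ncard := by
    have h1 := Set.ncard_union_add_ncard_inter (F.neighborSet u) (F.neighborSet v)
    have h2 := Set.ncard_add_ncard_compl ({u, v} ∪ (F.neighborSet u ∪ F.neighborSet v))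
    have h3 : Disjoint ({u, v} : Set V) (F.neighborSet u ∪ F.neighborSet v) := by
      rw [Set.disjoint_left]
      rintro a (rfl | rfl) (ha | ha)
      · exact ha.ne rfl
      · exact huv (SimpleGraph.Adj.symm ha)
      · exact huv ha
      · exact ha.ne rfl
    rw [Set.ncard_union_eq h3, Set.ncard_pair h.1] at h2
    have h4 := h.2
    unfold dg at h4
    omega
  have hS : ∀ x, F.Adj x u → F.Adj x v → ∃ w A B, HasParts F x A B ∧ u ∈ A ∧ v ∈ A ∧ w ∈ B := by
    have main : ∀ x A B, F.Adj x v → HasParts F x A B → u ∈ A →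
        ∃ w A B, HasParts F x A B ∧ u ∈ A ∧ v ∈ A ∧ w ∈ B := by
      intro x A B hv hAB hu
      obtain ⟨w, hw⟩ := hAB.right
      refine ⟨w, A, B, hAB, hu, ((hAB.adj_iff v).1 hv).resolve_right fun hv => ?_, hw⟩
      exact (hAB.cross u hu v hv).2.2 h
    intro x hu hv
    rcases hF x with hx | ⟨A, B, hAB⟩
    · exact absurd (hx u v hu hv h.1) huv
    · rcases (hAB.adj_iff u).1 hu with hu | hu
      · exact main x A B hv hAB hu
      · exact main x B A hv hAB.swap hu
  choose! f hf using hS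
  obtain ⟨x₁, h1, x₂, h2, h12, he⟩ := Set.exists_ne_map_eq_of_ncard_lt_of_maps_to hcard
    (f := f) (by
      rintro x ⟨hxu, hxv⟩
      obtain ⟨A, B, hAB, hu, hv, hw⟩ := hf x (SimpleGraph.Adj.symm hxu) (SimpleGraph.Adj.symm hxv)
      have k1 := hAB.cross u hu _ hw
      have k2 := hAB.cross v hv _ hw
      rintro ((hfu | hfv) | (hfu | hfv))
      · exact k1.1 hfu.symm
      · exact k2.1 (Eq.symm hfv)
      · exact k1.2.1 hfu
      · exact k2.2.1 hfv)
  obtain ⟨A, B, hAB, hu, hv, hw⟩ := hf x₁ (SimpleGraph.Adj.symm h1.1) (SimpleGraph.Adj.symm h1.2)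
  obtain ⟨A', B', hAB', hu', hv', hw'⟩ :=
    hf x₂ (SimpleGraph.Adj.symm h2.1) (SimpleGraph.Adj.symm h2.2)
  rw [← he] at hw'
  have hx2w : F.Adj x₂ (f x₁) := (hAB'.adj_iff _).2 (Or.inr hw')
  have hx2u : F.Adj x₂ u := (hAB'.adj_iff _).2 (Or.inl hu')
  have hadj : F.Adj x₁ x₂ ∨ (heavyGraph F).Adj x₁ x₂ := by
    rcases hF u with hs | ⟨P, Q, hPQ⟩
    · exact Or.inl (hs _ _ h1.1 h2.1 h12)
    · rcases (hPQ.adj_iff x₁).1 h1.1 with k1 | k1 <;> rcases (hPQ.adj_iff x₂).1 h2.1 with k2 | k2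
      · exact hPQ.cliqueL _ k1 _ k2 h12
      · exact (hPQ.heavy v huv h _ k1 _ k2 h1.2 h2.2).elim
      · exact (hPQ.heavy v huv h _ k2 _ k1 h2.2 h1.2).elim
      · exact hPQ.cliqueR _ k1 _ k2 h12
  by_cases hx : F.Adj x₁ x₂
  · rcases (hAB.adj_iff x₂).1 hx with k | k
    · exact (hAB.cross _ k _ hw).2.1 hx2w
    · exact (hAB.cross _ hu _ k).2.1 hx2u.symm
  · exact hAB.heavy x₂ hx (hadj.resolve_left hx) u hu _ hw hx2u hx2w

/-- The closure of a non-Hamiltonian graph all of whose claws have heavy leaves. -/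
theorem exists_closure [Finite V] (hn : 3 ≤ Nat.card V) (hG : LeafHeavy G) (hH : ¬ Ham G) :
    ∃ F, G ≤ F ∧ ¬ Ham F ∧ Lifts G F ∧ (∀ a b, (heavyGraph F).Adj a b → F.Adj a b) ∧
      ∀ x, ∃ A B : Set V, (∀ a, F.Adj x a ↔ a ∈ A ∨ a ∈ B) ∧
        (∀ a ∈ A, ∀ b ∈ B, a ≠ b ∧ ¬ F.Adj a b) ∧ (∀ a ∈ A, ∀ b ∈ A, a ≠ b → F.Adj a b) ∧
        (∀ a ∈ B, ∀ b ∈ B, a ≠ b → F.Adj a b) := by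
  obtain ⟨F, hGF, hF⟩ := (Set.toFinite
    {F : SimpleGraph V | G ≤ F ∧ LeafHeavy F ∧ ¬ Ham F ∧ Lifts G F}).exists_le_maximal
    (a := G) ⟨le_rfl, hG, hH, lifts_self⟩
  obtain ⟨-, hleaf, hnh, hlift⟩ := hF.1
  have hparts : ∀ x, Simplicial F x ∨ ∃ A B, HasParts F x A B := by
    intro x
    by_cases hx : Ham (locComp F x)
    · right
      obtain ⟨M, h1, h2, h3, h4⟩ := exists_saturated hn (le_locComp (F := F) (x := x)) hnh
      have S : Saturated F M x := ⟨hleaf, h1, h2, h3, fun a b ha hb hab =>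
        h4 a b ⟨hab, Or.inr ⟨ha, hb⟩⟩⟩
      by_contra hcon
      refine h3 (hx.mono fun u v huv => ?_)
      by_contra h
      have := huv.2.resolve_left fun h' => h (h1 h')
      exact hcon ⟨_, _, S.hasParts hn this.1 this.2 huv.1 h⟩
    · left
      have := hF.2 ⟨hGF.trans le_locComp, hleaf.locComp, hx, hlift.locComp⟩ le_locComp
      exact fun a b ha hb hab => this ⟨hab, Or.inr ⟨ha, hb⟩⟩
  have hheavy : ∀ a b, (heavyGraph F).Adj a b → F.Adj a b :=
    fun a b => adj_of_heavy_of_hasParts hparts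
  refine ⟨F, hGF, hnh, hlift, hheavy, fun x => ?_⟩
  rcases hparts x with hx | ⟨A, B, h⟩
  · exact ⟨F.neighborSet x, ∅, by simp, by simp, fun a ha b hb hab => hx a b ha hb hab, by simp⟩
  · exact ⟨A, B, h.adj_iff, fun a ha b hb => ⟨(h.cross a ha b hb).1, (h.cross a ha b hb).2.1⟩,
      fun a ha b hb hab => (h.cliqueL a ha b hb hab).elim id (hheavy a b),
      fun a ha b hb hab => (h.cliqueR a ha b hb hab).elim id (hheavy a b)⟩

end

/-- The line graph of the edges `ends p`: labels are adjacent when their edges share an end. -/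
def shareGraph {V W : Type*} (ends : V → Sym2 W) : SimpleGraph V where
  Adj p q := p ≠ q ∧ ∃ y, y ∈ ends p ∧ y ∈ ends q
  symm := ⟨fun _ _ h => ⟨h.1.symm, h.2.imp fun _ h => h.symm⟩⟩
  loopless := ⟨fun _ h => h.1 rfl⟩

/-- The edge `c` is a pendant edge attached at `y`. -/
def Pendant {V W : Type*} (ends : V → Sym2 W) (c : V) (y : W) : Prop :=
  ∃ z, ends c = s(y, z) ∧ ∀ q, z ∈ ends q → q = c

/-- A triangle-free graph `H` whose edges are labelled by the vertices of `G`, so that the line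
graph of `H` plays the role of a closure of `G`. -/
structure Rep {V : Type*} (G : SimpleGraph V) (W : Type*) where
  H : SimpleGraph W
  ends : V → Sym2 W
  lab : W → W → V
  ends_mem : ∀ p, ends p ∈ H.edgeSet
  ends_inj : Function.Injective ends
  ends_lab : ∀ x y, H.Adj x y → ends (lab x y) = s(x, y)
  tri : ∀ x y z, H.Adj x y → H.Adj y z → H.Adj z x → False
  share_of_adj : ∀ p q, G.Adj p q → ∃ y, y ∈ ends p ∧ y ∈ ends q
  share_of_heavy : ∀ p q, p ≠ q → Nat.card V ≤ dg G p + dg G q → ∃ y, y ∈ ends p ∧ y ∈ ends q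
  reach : ∀ p q y, p ≠ q → y ∈ ends p → y ∈ ends q →
    (within G {c | c = p ∨ c = q ∨ Pendant ends c y}).Reachable p q
  conn : ∀ (u : V) (S : Set V), (∃ p, p ∈ S ∧ p ≠ u) → (∃ q, q ∉ S ∧ q ≠ u) →
    ∃ p q, p ∈ S ∧ q ∉ S ∧ p ≠ u ∧ q ≠ u ∧ ∃ y, y ∈ ends p ∧ y ∈ ends q
  not_ham : ¬ Ham (shareGraph ends)

section

variable {V : Type*} {G F : SimpleGraph V} {p q x y : V}

theorem exists_crossing (hG : ∀ v : V, (G.induce ({v}ᶜ : Set V)).Connected) (u : V) (S : Set V)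
    (hp : ∃ p, p ∈ S ∧ p ≠ u) (hq : ∃ q, q ∉ S ∧ q ≠ u) :
    ∃ p q, p ∈ S ∧ q ∉ S ∧ p ≠ u ∧ q ≠ u ∧ G.Adj p q := by
  obtain ⟨p, hp, hpu⟩ := hp
  obtain ⟨q, hq, hqu⟩ := hq
  obtain ⟨w⟩ := (hG u).preconnected ⟨p, hpu⟩ ⟨q, hqu⟩
  obtain ⟨d, -, h1, h2⟩ := w.exists_boundary_dart (Subtype.val ⁻¹' S) hp hq
  exact ⟨d.fst, d.snd, h1, h2, d.fst.2, d.snd.2, d.adj⟩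

/-- The neighbourhood of `p` consists of two disjoint cliques not joined by edges. -/
structure IsSplit (F : SimpleGraph V) (p : V) (A B : Set V) : Prop where
  adj_iff : ∀ a, F.Adj p a ↔ a ∈ A ∨ a ∈ B
  cross : ∀ a ∈ A, ∀ b ∈ B, a ≠ b ∧ ¬ F.Adj a b
  cliqueL : ∀ a ∈ A, ∀ b ∈ A, a ≠ b → F.Adj a b
  cliqueR : ∀ a ∈ B, ∀ b ∈ B, a ≠ b → F.Adj a b

theorem IsSplit.swap {A B : Set V} (h : IsSplit F p A B) : IsSplit F p B A where
  adj_iff a := (h.adj_iff a).trans or_comm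
  cross a ha b hb := ⟨(h.cross b hb a ha).1.symm, fun h' => (h.cross b hb a ha).2 h'.symm⟩
  cliqueL := h.cliqueR
  cliqueR := h.cliqueL

theorem IsSplit.insert_eq {A B A' B' : Set V} (h : IsSplit F p A B) (h' : IsSplit F q A' B')
    (hq : q ∈ A) (hp : p ∈ A') : insert q A' = insert p A := by
  have key : ∀ {p q : V} {A B A' B' : Set V}, IsSplit F p A B → IsSplit F q A' B' → q ∈ A →
      p ∈ A' → insert q A' ⊆ insert p A := by
    intro p q A B A' B' h h' hq hp r hr
    by_cases hrp : r = p
    · exact Or.inl hrp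
    · right
      rcases hr with rfl | hr
      · exact hq
      · have h1 : F.Adj p r := h'.cliqueL _ hp _ hr (Ne.symm hrp)
        rcases (h.adj_iff r).1 h1 with h2 | h2
        · exact h2
        · exact absurd ((h'.adj_iff r).2 (Or.inl hr)) (h.cross _ hq _ h2).2
  exact (key h h' hq hp).antisymm (key h' h hp hq)

theorem exists_rep [Finite V] (hn : 3 ≤ Nat.card V)
    (hG : ∀ v : V, (G.induce ({v}ᶜ : Set V)).Connected) (hleaf : LeafHeavy G) (hH : ¬ Ham G) :
    Nonempty (Rep G (Set V)) := by
  classical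
  obtain ⟨F, hGF, hF, hlift, hheavy, hsplit⟩ := exists_closure hn hleaf hH
  have hsplit' : ∀ x, ∃ A B, IsSplit F x A B := fun x => by
    obtain ⟨A, B, h1, h2, h3, h4⟩ := hsplit x
    exact ⟨A, B, h1, h2, h3, h4⟩
  choose A B hAB using hsplit'
  have hcross := exists_crossing hG
  have hiso : ∀ p, ∃ q, F.Adj p q := by
    intro p
    have h1 : 1 < Nat.card V := by omega
    have := Finite.one_lt_card_iff_nontrivial.1 h1
    obtain ⟨u, hu⟩ := exists_ne p
    have h2 : ∃ q, q ∉ ({p} : Set V) ∧ q ≠ u := by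
      by_contra! hcon
      have h3 : (Set.univ : Set V) ⊆ {p, u} := fun q _ => by
        by_cases hq : q = p
        · exact Or.inl hq
        · exact Or.inr (hcon q hq)
      have h4 := Set.ncard_le_ncard h3 (Set.toFinite _)
      rw [Set.ncard_univ, Set.ncard_pair hu.symm] at h4
      omega
    obtain ⟨a, b, ha, -, -, -, hab⟩ := hcross u {p} ⟨p, rfl, hu.symm⟩ h2
    rw [Set.mem_singleton_iff] at ha
    exact ⟨b, hGF (ha ▸ hab)⟩
  set ends : V → Sym2 (Set V) := fun p => s(insert p (A p), insert p (B p)) with hends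
  have mem_ends : ∀ {x p}, x ∈ ends p ↔ x = insert p (A p) ∨ x = insert p (B p) := by
    intro x p
    rw [hends]
    exact Sym2.mem_iff
  have sp : ∀ {x p}, x ∈ ends p → ∃ P Q, IsSplit F p P Q ∧ x = insert p P := by
    intro x p hx
    rcases mem_ends.1 hx with rfl | rfl
    · exact ⟨_, _, hAB p, rfl⟩
    · exact ⟨_, _, (hAB p).swap, rfl⟩
  have self_mem : ∀ {x p}, x ∈ ends p → p ∈ x := by
    intro x p hx
    rcases mem_ends.1 hx with rfl | rfl <;> simp
  have mem_of_mem : ∀ {x p q}, x ∈ ends p → q ∈ x → x ∈ ends q := by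
    intro x p q hx hq
    obtain ⟨P, Q, hPQ, rfl⟩ := sp hx
    rcases hq with rfl | hq
    · exact hx
    · have hqp : F.Adj q p := ((hPQ.adj_iff q).2 (Or.inl hq)).symm
      rcases ((hAB q).adj_iff p).1 hqp with h | h
      · exact mem_ends.2 (Or.inl (hPQ.insert_eq (hAB q) hq h).symm)
      · exact mem_ends.2 (Or.inr (hPQ.insert_eq (hAB q).swap hq h).symm)
  have adj_of_mem : ∀ {x p q}, x ∈ ends p → x ∈ ends q → p ≠ q → F.Adj p q := by
    intro x p q hp hq hpq
    have hqx := self_mem hq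
    obtain ⟨P, Q, hPQ, rfl⟩ := sp hp
    exact (hPQ.adj_iff q).2 (Or.inl (hqx.resolve_left hpq.symm))
  have mem_of_adj : ∀ {p q}, F.Adj p q → ∃ x, x ∈ ends p ∧ x ∈ ends q := by
    intro p q hpq
    have : ∃ x, x ∈ ends p ∧ q ∈ x := by
      rcases ((hAB p).adj_iff q).1 hpq with h | h
      · exact ⟨_, mem_ends.2 (Or.inl rfl), Or.inr h⟩
      · exact ⟨_, mem_ends.2 (Or.inr rfl), Or.inr h⟩
    obtain ⟨x, h1, h2⟩ := this
    exact ⟨x, h1, mem_of_mem h1 h2⟩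
  have ne : ∀ p, insert p (A p) ≠ insert p (B p) := by
    intro p h
    obtain ⟨q, hq⟩ := hiso p
    have hqA : q ∈ insert p (A p) ∧ q ∈ insert p (B p) := by
      rcases ((hAB p).adj_iff q).1 hq with h' | h'
      · exact ⟨Or.inr h', h ▸ Or.inr h'⟩
      · exact ⟨h ▸ Or.inr h', Or.inr h'⟩
    exact ((hAB p).cross q (hqA.1.resolve_left hq.ne.symm) q (hqA.2.resolve_left hq.ne.symm)).1 rfl
  have inj : Function.Injective ends := by
    intro p q h
    by_contra hpq
    have h1 : q ∈ insert p (A p) := self_mem (h ▸ mem_ends.2 (Or.inl rfl))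
    have h2 : q ∈ insert p (B p) := self_mem (h ▸ mem_ends.2 (Or.inr rfl))
    exact ((hAB p).cross q (h1.resolve_left (Ne.symm hpq)) q (h2.resolve_left (Ne.symm hpq))).1 rfl
  set H : SimpleGraph (Set V) := SimpleGraph.fromEdgeSet (Set.range ends) with hH'
  have H_adj : ∀ {x y}, H.Adj x y ↔ (∃ p, ends p = s(x, y)) ∧ x ≠ y := by
    intro x y
    rw [hH', SimpleGraph.fromEdgeSet_adj]
    rfl
  have : Nonempty V := ⟨(Nat.card_pos_iff.1 (by omega)).1.some⟩
  have share_eq : shareGraph ends = F := by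
    ext p q
    exact ⟨fun ⟨h1, x, h2, h3⟩ => adj_of_mem h2 h3 h1, fun h => ⟨h.ne, mem_of_adj h⟩⟩
  have pend : ∀ {p q c y}, p ≠ q → y ∈ ends p → y ∈ ends q → Simplicial F c → F.Adj c p →
      F.Adj c q → Pendant ends c y := by
    intro p q c y hpq hp hq hc hcp hcq
    have : ∃ z w, ends c = s(z, w) ∧ ∀ q, w ∈ ends q → q = c := by
      by_cases h : A c = ∅
      · refine ⟨insert c (B c), insert c (A c), Sym2.eq_swap, fun q hq => ?_⟩
        have := self_mem hq
        rw [h] at this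
        simpa using this
      · refine ⟨insert c (A c), insert c (B c), rfl, fun q hq => ?_⟩
        rcases self_mem hq with h' | h'
        · exact h'
        · obtain ⟨a, ha⟩ := Set.nonempty_iff_ne_empty.2 h
          obtain ⟨k1, k2⟩ := (hAB c).cross a ha q h'
          exact absurd (hc a q (((hAB c).adj_iff a).2 (Or.inl ha))
            (((hAB c).adj_iff q).2 (Or.inr h')) k1) k2
    obtain ⟨z, w, hzw, hw⟩ := this
    have hz : ∀ r, F.Adj c r → z ∈ ends r := by
      intro r hr
      obtain ⟨x, h1, h2⟩ := mem_of_adj hr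
      rw [hzw, Sym2.mem_iff] at h1
      rcases h1 with rfl | rfl
      · exact h2
      · exact absurd (hw r h2) hr.ne.symm
    have : z = y := by
      by_contra hzy
      refine hpq (inj ?_)
      rw [(Sym2.mem_and_mem_iff hzy).1 ⟨hz p hcp, hp⟩, (Sym2.mem_and_mem_iff hzy).1 ⟨hz q hcq, hq⟩]
    subst this
    exact ⟨w, hzw, hw⟩
  refine ⟨{ H := H, ends := ends, lab := fun x y => Classical.epsilon fun p => ends p = s(x, y),
            ends_mem := ?_, ends_inj := inj, ends_lab := ?_, tri := ?_, share_of_adj := ?_,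
            share_of_heavy := ?_, reach := ?_, conn := ?_, not_ham := ?_ }⟩
  · intro p
    rw [hends]
    exact H_adj.2 ⟨⟨p, rfl⟩, ne p⟩
  · intro x y hxy
    exact Classical.epsilon_spec (H_adj.1 hxy).1
  · intro x y z hxy hyz hzx
    obtain ⟨⟨p, hp⟩, nxy⟩ := H_adj.1 hxy
    obtain ⟨⟨q, hq⟩, nyz⟩ := H_adj.1 hyz
    obtain ⟨⟨r, hr⟩, nzx⟩ := H_adj.1 hzx
    have hpq : p ≠ q := by
      rintro rfl
      have h1 : x ∈ ends p := by rw [hp]; simp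
      rw [hq, Sym2.mem_iff] at h1
      exact h1.elim nxy nzx.symm
    have hpr : p ≠ r := by
      rintro rfl
      have h1 : y ∈ ends p := by rw [hp]; simp
      rw [hr, Sym2.mem_iff] at h1
      exact h1.elim nyz nxy.symm
    have hqr : q ≠ r := by
      rintro rfl
      have h1 : y ∈ ends q := by rw [hq]; simp
      rw [hr, Sym2.mem_iff] at h1
      exact h1.elim nyz nxy.symm
    have apq : F.Adj p q := adj_of_mem (x := y) (by rw [hp]; simp) (by rw [hq]; simp) hpq
    have apr : F.Adj p r := adj_of_mem (x := x) (by rw [hp]; simp) (by rw [hr]; simp) hpr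
    have aqr : F.Adj q r := adj_of_mem (x := z) (by rw [hq]; simp) (by rw [hr]; simp) hqr
    obtain ⟨X, h1, h2⟩ := mem_of_adj apq
    have h3 : r ∈ X := by
      obtain ⟨P, Q, hPQ, rfl⟩ := sp h1
      have hqP := (self_mem h2).resolve_left hpq.symm
      rcases (hPQ.adj_iff r).1 apr with h | h
      · exact Or.inr h
      · exact absurd aqr (hPQ.cross q hqP r h).2
    have h4 := mem_of_mem h1 h3
    rw [hp, Sym2.mem_iff] at h1
    rw [hq, Sym2.mem_iff] at h2
    rw [hr, Sym2.mem_iff] at h4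
    rcases h1 with rfl | rfl
    · exact h2.elim nxy nzx.symm
    · exact h4.elim nyz nxy.symm
  · exact fun p q h => mem_of_adj (hGF h)
  · exact fun p q hpq h => mem_of_adj (hheavy p q (heavyGraph_mono_of_le hGF ⟨hpq, h⟩))
  · intro p q y hpq hp hq
    refine (hlift p q (adj_of_mem hp hq hpq)).mono (within_mono ?_)
    rintro c (rfl | rfl | ⟨h1, h2, h3⟩)
    · exact Or.inl rfl
    · exact Or.inr (Or.inl rfl)
    · exact Or.inr (Or.inr (pend hpq hp hq h1 h2 h3))
  · intro u S hp hq
    obtain ⟨p, q, h1, h2, h3, h4, h5⟩ := hcross u S hp hq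
    exact ⟨p, q, h1, h2, h3, h4, mem_of_adj (hGF h5)⟩
  · rwa [share_eq]

end

namespace Rep

variable {V W : Type*} {G : SimpleGraph V} (R : Rep G W) {p q c : V} {w x y z : W}

theorem adj_of_ends (h : R.ends p = s(x, y)) : R.H.Adj x y := by
  have := R.ends_mem p
  rwa [h] at this

theorem ends_eq_of_mem (h : x ∈ R.ends p) : ∃ y, R.ends p = s(x, y) ∧ R.H.Adj x y := by
  obtain ⟨y, hy⟩ := h
  exact ⟨y, hy, R.adj_of_ends hy⟩

theorem eq_lab (h : R.ends p = s(x, y)) : p = R.lab x y :=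
  R.ends_inj (h.trans (R.ends_lab x y (R.adj_of_ends h)).symm)

theorem lab_comm (h : R.H.Adj x y) : R.lab x y = R.lab y x :=
  R.eq_lab ((R.ends_lab x y h).trans Sym2.eq_swap)

theorem mem_lab (h : R.H.Adj x y) : z ∈ R.ends (R.lab x y) ↔ z = x ∨ z = y := by
  rw [R.ends_lab x y h, Sym2.mem_iff]

theorem lab_inj (h : R.H.Adj x y) (h' : R.H.Adj w z) :
    R.lab x y = R.lab w z ↔ (x = w ∧ y = z) ∨ (x = z ∧ y = w) := by
  rw [← R.ends_inj.eq_iff, R.ends_lab _ _ h, R.ends_lab _ _ h', Sym2.eq_iff]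

theorem eq_of_two_mem (hxy : x ≠ y) (hp : x ∈ R.ends p) (hp' : y ∈ R.ends p)
    (hq : x ∈ R.ends q) (hq' : y ∈ R.ends q) : p = q :=
  R.ends_inj (((Sym2.mem_and_mem_iff hxy).1 ⟨hp, hp'⟩).trans
    ((Sym2.mem_and_mem_iff hxy).1 ⟨hq, hq'⟩).symm)

/-- Three pairwise intersecting edges of a triangle-free graph have a common end. -/
theorem mem_of_share (hpq : p ≠ q) (hp : y ∈ R.ends p)
    (hq : y ∈ R.ends q) (h1 : ∃ z, z ∈ R.ends c ∧ z ∈ R.ends p)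
    (h2 : ∃ z, z ∈ R.ends c ∧ z ∈ R.ends q) : y ∈ R.ends c := by
  by_contra hy
  obtain ⟨x, ep, hx⟩ := R.ends_eq_of_mem hp
  obtain ⟨z, eq, hz⟩ := R.ends_eq_of_mem hq
  obtain ⟨a, ha, ha'⟩ := h1
  obtain ⟨b, hb, hb'⟩ := h2
  rw [ep, Sym2.mem_iff] at ha'
  rw [eq, Sym2.mem_iff] at hb'
  rcases ha' with rfl | rfl
  · exact hy ha
  rcases hb' with rfl | rfl
  · exact hy hb
  by_cases hab : a = b
  · subst hab
    exact hpq (R.ends_inj (ep.trans eq.symm))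
  · exact R.tri _ _ _ hx (R.adj_of_ends ((Sym2.mem_and_mem_iff hab).1 ⟨ha, hb⟩)) hz.symm

/-- Nonadjacent heavy pairs have a common neighbour that is a pendant edge. -/
theorem exists_pendant_of_heavy [Finite V] (hpq : p ≠ q) (hp : y ∈ R.ends p) (hq : y ∈ R.ends q)
    (hadj : ¬ G.Adj p q) (hd : Nat.card V ≤ dg G p + dg G q) :
    ∃ c, G.Adj p c ∧ G.Adj q c ∧ Pendant R.ends c y := by
  by_contra! hcon
  have hcard : (({p, q} ∪ (G.neighborSet p ∪ G.neighborSet q))ᶜ : Set V).ncard <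
      (G.neighborSet p ∩ G.neighborSet q).ncard := by
    have h1 := Set.ncard_union_add_ncard_inter (G.neighborSet p) (G.neighborSet q)
    have h2 := Set.ncard_add_ncard_compl ({p, q} ∪ (G.neighborSet p ∪ G.neighborSet q))
    have h3 : Disjoint ({p, q} : Set V) (G.neighborSet p ∪ G.neighborSet q) := by
      rw [Set.disjoint_left]
      rintro a (rfl | rfl) (ha | ha)
      · exact ha.ne rfl
      · exact hadj (SimpleGraph.Adj.symm ha)
      · exact hadj ha
      · exact ha.ne rfl
    rw [Set.ncard_union_eq h3, Set.ncard_pair hpq] at h2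
    unfold dg at hd
    omega
  obtain ⟨x, ep, hx⟩ := R.ends_eq_of_mem hp
  obtain ⟨z, eq, hz⟩ := R.ends_eq_of_mem hq
  have hS : ∀ c, G.Adj p c → G.Adj q c → ∃ f w, f ≠ c ∧ R.ends c = s(y, w) ∧ w ∈ R.ends f ∧
      y ∉ R.ends f := by
    intro c hpc hqc
    have hy : y ∈ R.ends c := R.mem_of_share hpq hp hq
      (R.share_of_adj _ _ hpc.symm) (R.share_of_adj _ _ hqc.symm)
    obtain ⟨w, ec, hw⟩ := R.ends_eq_of_mem hy
    have := hcon c hpc hqc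
    unfold Pendant at this
    push Not at this
    obtain ⟨f, hf, hfc⟩ := this w ec
    refine ⟨f, w, hfc, ec, hf, fun hyf => hfc ?_⟩
    exact R.eq_of_two_mem hw.ne hyf hf hy (by rw [ec]; simp)
  have : Nonempty W := ⟨y⟩
  choose! f wf hf using hS
  obtain ⟨c₁, h1, c₂, h2, h12, he⟩ := Set.exists_ne_map_eq_of_ncard_lt_of_maps_to hcard
    (f := f) (by
      rintro c ⟨hpc, hqc⟩
      obtain ⟨h1, h2, h3, h4⟩ := hf c hpc hqc
      have key : ∀ r, y ∈ R.ends r → G.Adj r c → ¬ ∃ z, z ∈ R.ends r ∧ z ∈ R.ends (f c) := by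
        rintro r hr hrc ⟨a, ha, ha'⟩
        obtain ⟨b, er, hb⟩ := R.ends_eq_of_mem hr
        rw [er, Sym2.mem_iff] at ha
        rcases ha with rfl | rfl
        · exact h4 ha'
        · by_cases haw : a = wf c
          · subst haw
            exact hrc.ne (R.ends_inj (er.trans h2.symm))
          · exact R.tri _ _ _ hb (R.adj_of_ends ((Sym2.mem_and_mem_iff haw).1 ⟨ha', h3⟩))
              (R.adj_of_ends h2).symm
      rintro ((h | h) | (h | h))
      · exact h4 (h ▸ hp)
      · exact h4 (Set.mem_singleton_iff.1 h ▸ hq)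
      · exact key p hp hpc (R.share_of_adj _ _ h)
      · exact key q hq hqc (R.share_of_adj _ _ h))
  obtain ⟨a1, a2, a3, a4⟩ := hf c₁ h1.1 h1.2
  obtain ⟨b1, b2, b3, b4⟩ := hf c₂ h2.1 h2.2
  rw [← he] at b3
  have hne : wf c₁ ≠ wf c₂ := by
    intro e
    rw [e] at a2
    exact h12 (R.ends_inj (a2.trans b2.symm))
  exact R.tri _ _ _ (R.adj_of_ends a2) (R.adj_of_ends ((Sym2.mem_and_mem_iff hne).1 ⟨a3, b3⟩))
    (R.adj_of_ends b2).symm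

end Rep

/-- `a` and `b` are distinct, nonadjacent and have degree sum less than the order. -/
structure Far {V : Type*} (G : SimpleGraph V) (a b : V) : Prop where
  ne : a ≠ b
  not_adj : ¬ G.Adj a b
  lt : dg G a + dg G b < Nat.card V

theorem Far.symm {V : Type*} {G : SimpleGraph V} {a b : V} (h : Far G a b) : Far G b a :=
  ⟨h.ne.symm, fun h' => h.not_adj h'.symm, by have := h.lt; omega⟩

namespace Rep

variable {V W : Type*} {G : SimpleGraph V} (R : Rep G W) {p q c e f : V} {w x y z : W}

/-- `x` is an end of at least two edges. -/
def Inner (x : W) : Prop := ∃ p q, p ≠ q ∧ x ∈ R.ends p ∧ x ∈ R.ends q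

theorem inner_of_adj (hx : R.H.Adj x y) (hz : R.H.Adj y z) (hxz : x ≠ z) : R.Inner y := by
  refine ⟨R.lab x y, R.lab y z, ?_, (R.mem_lab hx).2 (Or.inr rfl), (R.mem_lab hz).2 (Or.inl rfl)⟩
  rw [Ne, R.lab_inj hx hz]
  rintro (⟨rfl, rfl⟩ | ⟨rfl, -⟩)
  · exact hx.ne rfl
  · exact hxz rfl

theorem pendant_mem (h : Pendant R.ends c y) : y ∈ R.ends c := by
  obtain ⟨z, hz, -⟩ := h
  rw [hz]
  simp

theorem eq_of_pendant (h : Pendant R.ends c y) (hx : R.Inner x) (hxc : x ∈ R.ends c) : x = y := by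
  obtain ⟨z, hz, hz'⟩ := h
  rw [hz, Sym2.mem_iff] at hxc
  refine hxc.resolve_right ?_
  rintro rfl
  obtain ⟨p, q, hpq, hp, hq⟩ := hx
  exact hpq ((hz' p hp).trans (hz' q hq).symm)

/-- All the inner ends of the edge `e` lie in `T`, and there is at least one. -/
def InnerIn (e : V) (T : Set W) : Prop :=
  (∃ y, y ∈ R.ends e ∧ R.Inner y) ∧ ∀ y, R.Inner y → y ∈ R.ends e → y ∈ T

theorem InnerIn.mono {R : Rep G W} {T T' : Set W} (h : R.InnerIn e T) (hT : T ⊆ T') :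
    R.InnerIn e T' :=
  ⟨h.1, fun y hy hye => hT (h.2 y hy hye)⟩

theorem innerIn_lab (h : R.H.Adj x y) (hi : R.Inner x ∨ R.Inner y) :
    R.InnerIn (R.lab x y) {x, y} := by
  refine ⟨?_, fun w _ hwe => (R.mem_lab h).1 hwe⟩
  rcases hi with hi | hi
  · exact ⟨x, (R.mem_lab h).2 (Or.inl rfl), hi⟩
  · exact ⟨y, (R.mem_lab h).2 (Or.inr rfl), hi⟩

theorem innerIn_pendant (h : Pendant R.ends c y) (hi : R.Inner y) : R.InnerIn c {y} :=
  ⟨⟨y, R.pendant_mem h, hi⟩, fun _ hw hwc => R.eq_of_pendant h hw hwc⟩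

theorem InnerIn.far {R : Rep G W} {T T' : Set W} (he : R.InnerIn e T) (hf : R.InnerIn f T')
    (h : ∀ x ∈ T, x ∉ T') : Far G e f := by
  have hne : e ≠ f := by
    rintro rfl
    obtain ⟨⟨y, hy, hi⟩, h1⟩ := he
    exact h y (h1 y hi hy) (hf.2 y hi hy)
  have key : ¬ ∃ y, y ∈ R.ends e ∧ y ∈ R.ends f := by
    rintro ⟨y, h1, h2⟩
    have hi : R.Inner y := ⟨e, f, hne, h1, h2⟩
    exact h y (he.2 y hi h1) (hf.2 y hi h2)
  refine ⟨hne, fun h => key (R.share_of_adj _ _ h), ?_⟩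
  by_contra! h
  exact key (R.share_of_heavy _ _ hne h)

/-- `s 0 = p, …, s k = q` is an induced path of `G` through pendant edges at `y`, in which heavy
pairs have distance at most two. -/
structure IsSeg (y : W) (p q : V) (k : ℕ) (s : ℕ → V) : Prop where
  zero : s 0 = p
  last : s k = q
  pos : 1 ≤ k
  pendant : ∀ i, 0 < i → i < k → Pendant R.ends (s i) y
  ne : ∀ i j, i < j → j ≤ k → s i ≠ s j
  adj : ∀ i j, i < j → j ≤ k → (G.Adj (s i) (s j) ↔ j = i + 1)
  heavy : ∀ i j, i < j → j ≤ k → Nat.card V ≤ dg G (s i) + dg G (s j) → j ≤ i + 2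

theorem exists_isSeg [Finite V] (hpq : p ≠ q) (hp : y ∈ R.ends p) (hq : y ∈ R.ends q) :
    ∃ k s, R.IsSeg y p q k s := by
  let S : Set V := {c | c = p ∨ c = q ∨ Pendant R.ends c y}
  obtain ⟨w, hw⟩ : ∃ w : (within G S).Walk p q, w.length = (within G S).dist p q :=
    (R.reach p q y hpq hp hq).exists_walk_length_eq_dist
  have h0 : w.getVert 0 = p := w.getVert_zero
  have hk : w.getVert w.length = q := w.getVert_length
  have hpos : 1 ≤ w.length := by
    rcases Nat.eq_zero_or_pos w.length with h | h
    · rw [h, h0] at hk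
      exact absurd hk hpq
    · exact h
  have short : ∀ i j, i ≤ j → j ≤ w.length →
      ∀ r : (within G S).Walk (w.getVert i) (w.getVert j), j ≤ i + r.length := by
    intro i j hij hj r
    have h1 := SimpleGraph.dist_le ((w.take i).append (r.append (w.drop j)))
    rw [Walk.length_append, Walk.length_append, Walk.take_length, Walk.drop_length, ← hw,
      min_eq_left (hij.trans hj)] at h1
    omega
  have hmem : ∀ i, i ≤ w.length → w.getVert i ∈ S := by
    intro i hi
    rcases Nat.lt_or_ge i w.length with h | h
    · exact (w.adj_getVert_succ h).2.1
    · rw [le_antisymm hi h, hk]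
      exact Or.inr (Or.inl rfl)
  have hy : ∀ i, i ≤ w.length → y ∈ R.ends (w.getVert i) := by
    intro i hi
    rcases hmem i hi with h | h | h
    · rwa [h]
    · rwa [h]
    · exact R.pendant_mem h
  have hne : ∀ i j, i < j → j ≤ w.length → w.getVert i ≠ w.getVert j := by
    intro i j hij hj he
    have h1 := short i j hij.le hj (Walk.nil.copy rfl he)
    rw [Walk.length_copy, Walk.length_nil] at h1
    omega
  have hadj : ∀ i j, i < j → j ≤ w.length → G.Adj (w.getVert i) (w.getVert j) → j = i + 1 := by
    intro i j hij hj h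
    have h1 : (within G S).Adj (w.getVert i) (w.getVert j) :=
      ⟨h, hmem i (by omega), hmem j hj⟩
    have := short i j hij.le hj h1.toWalk
    rw [Adj.length_toWalk] at this
    omega
  refine ⟨w.length, w.getVert, h0, hk, hpos, ?_, hne, fun i j hij hj => ⟨hadj i j hij hj, ?_⟩, ?_⟩
  · intro i hi hik
    rcases hmem i hik.le with h | h | h
    · exact absurd (h0.trans h.symm) (hne 0 i hi hik.le)
    · exact absurd (h.trans hk.symm) (hne i _ hik le_rfl)
    · exact h
  · rintro rfl
    exact (w.adj_getVert_succ (by omega)).1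
  · intro i j hij hj h
    by_cases ha : G.Adj (w.getVert i) (w.getVert j)
    · have := hadj i j hij hj ha
      omega
    · obtain ⟨c, h1, h2, h3⟩ := R.exists_pendant_of_heavy (hne i j hij hj) (hy i (by omega))
        (hy j hj) ha h
      have hc : c ∈ S := Or.inr (Or.inr h3)
      have e1 : (within G S).Adj (w.getVert i) c := ⟨h1, hmem i (by omega), hc⟩
      have e2 : (within G S).Adj c (w.getVert j) := ⟨h2.symm, hc, hmem j hj⟩
      exact short i j hij.le hj (.cons e1 e2.toWalk)

/-- A segment with a heavy pair among its pendant edges. -/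
def LongSeg (y : W) (p q : V) : Prop :=
  ∃ k s i, R.IsSeg y p q k s ∧ 0 < i ∧ i + 2 < k ∧
    Nat.card V ≤ dg G (s i) + dg G (s (i + 2))

/-- Two pendant edges at `x` form a heavy pair. -/
def PendantHeavy (x : W) : Prop :=
  ∃ p q, p ≠ q ∧ Pendant R.ends p x ∧ Pendant R.ends q x ∧ Nat.card V ≤ dg G p + dg G q

/-- Two edges at `x` form a heavy pair. -/
def StarHeavy (x : W) : Prop :=
  ∃ p q, p ≠ q ∧ x ∈ R.ends p ∧ x ∈ R.ends q ∧ Nat.card V ≤ dg G p + dg G q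

/-- The edge `xy`, or a pendant edge at `y`, is heavy by itself or together with `yz`. -/
def EndHeavy (x y z : W) : Prop :=
  R.H.Adj x y ∧ R.H.Adj y z ∧ x ≠ z ∧ ∃ c, (c = R.lab x y ∨ Pendant R.ends c y) ∧
    (Nat.card V ≤ dg G c + dg G c ∨ Nat.card V ≤ dg G c + dg G (R.lab y z))

theorem LongSeg.pendantHeavy {R : Rep G W} (h : R.LongSeg y p q) : R.PendantHeavy y := by
  obtain ⟨k, s, i, hs, h1, h2, h3⟩ := h
  exact ⟨s i, s (i + 2), hs.ne _ _ (by omega) (by omega), hs.pendant _ h1 (by omega),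
    hs.pendant _ (by omega) h2, h3⟩

theorem PendantHeavy.exists_pendant {R : Rep G W} (h : R.PendantHeavy x) :
    ∃ z, R.H.Adj x z ∧ ∀ w, R.H.Adj z w → w = x := by
  obtain ⟨p, -, -, ⟨z, hz, hz'⟩, -, -⟩ := h
  refine ⟨z, R.adj_of_ends hz, fun w hw => ?_⟩
  have h1 := hz' _ ((R.mem_lab hw).2 (Or.inl rfl))
  rw [R.eq_lab hz, R.lab_inj hw (R.adj_of_ends hz)] at h1
  rcases h1 with ⟨rfl, rfl⟩ | ⟨-, h⟩
  · exact absurd hw (R.H.irrefl)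
  · exact h

theorem PendantHeavy.unique {R : Rep G W} (h : R.PendantHeavy x) (h' : R.PendantHeavy y) :
    x = y := by
  by_contra hxy
  obtain ⟨p, q, hpq, hp, hq, hd⟩ := h
  obtain ⟨p', q', hpq', hp', hq', hd'⟩ := h'
  have hx : R.Inner x := ⟨p, q, hpq, R.pendant_mem hp, R.pendant_mem hq⟩
  have hy : R.Inner y := ⟨p', q', hpq', R.pendant_mem hp', R.pendant_mem hq'⟩
  have key : ∀ {a b}, Pendant R.ends a x → Pendant R.ends b y → Far G a b := fun ha hb =>
    (R.innerIn_pendant ha hx).far (R.innerIn_pendant hb hy) (by simpa using hxy)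
  have h1 := (key hp hp').lt
  have h2 := (key hq hq').lt
  omega

theorem StarHeavy.adj {R : Rep G W} (h : R.StarHeavy x) (h' : R.StarHeavy y) (hxy : x ≠ y) :
    R.H.Adj x y := by
  by_contra hadj
  have key : ∀ {a b c d}, a ≠ b → x ∈ R.ends a → x ∈ R.ends b →
      Nat.card V ≤ dg G a + dg G b → dg G b ≤ dg G a → c ≠ d → y ∈ R.ends c → y ∈ R.ends d →
      Nat.card V ≤ dg G c + dg G d → dg G d ≤ dg G c → False := by
    intro a b c d hab ha hb h1 h2 hcd hc hd h3 h4
    have no : ∀ {e}, x ∈ R.ends e → y ∈ R.ends e → False := fun hx hy =>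
      hadj (R.adj_of_ends ((Sym2.mem_and_mem_iff hxy).1 ⟨hx, hy⟩))
    have hac : a ≠ c := by rintro rfl; exact no ha hc
    obtain ⟨z, hza, hzc⟩ := R.share_of_heavy a c hac (by omega)
    obtain ⟨z', ea, az⟩ := R.ends_eq_of_mem hza
    have hzx : z ≠ x := by rintro rfl; exact no hzc hc
    have hzy : z ≠ y := by rintro rfl; exact no ha hza
    have ea' : R.ends a = s(x, z) := (Sym2.mem_and_mem_iff hzx.symm).1 ⟨ha, hza⟩
    have ec' : R.ends c = s(y, z) := (Sym2.mem_and_mem_iff hzy.symm).1 ⟨hc, hzc⟩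
    rcases Nat.lt_or_ge (dg G a + dg G d) (Nat.card V) with h | h
    · have hbc : b ≠ c := by rintro rfl; exact no hb hc
      obtain ⟨t, htb, htc⟩ := R.share_of_heavy b c hbc (by omega)
      rw [ec', Sym2.mem_iff] at htc
      rcases htc with rfl | rfl
      · exact no hb htb
      · exact hab (R.eq_of_two_mem hzx.symm ha hza hb htb)
    · have had : a ≠ d := by rintro rfl; exact no ha hd
      obtain ⟨t, hta, htd⟩ := R.share_of_heavy a d had h
      rw [ea', Sym2.mem_iff] at hta
      rcases hta with rfl | rfl
      · exact no htd hd
      · exact hcd (R.eq_of_two_mem hzy.symm hc hzc hd htd)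
  obtain ⟨p, q, hpq, hp, hq, hd⟩ := h
  obtain ⟨p', q', hpq', hp', hq', hd'⟩ := h'
  rcases le_total (dg G p) (dg G q) with h1 | h1 <;>
    rcases le_total (dg G p') (dg G q') with h2 | h2
  · exact key hpq.symm hq hp (by omega) h1 hpq'.symm hq' hp' (by omega) h2
  · exact key hpq.symm hq hp (by omega) h1 hpq' hp' hq' (by omega) h2
  · exact key hpq hp hq (by omega) h1 hpq'.symm hq' hp' (by omega) h2
  · exact key hpq hp hq (by omega) h1 hpq' hp' hq' (by omega) h2

theorem EndHeavy.conflict {R : Rep G W} {x' y' z' : W} (h : R.EndHeavy x y z)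
    (h' : R.EndHeavy x' y' z') (h1 : x ≠ x') (h2 : x ≠ y') (h3 : x ≠ z') (h4 : y ≠ x')
    (h5 : y ≠ y') (h6 : y ≠ z') (h7 : z ≠ x') (h8 : z ≠ y') : False := by
  have key : ∀ {x y z : W}, R.EndHeavy x y z → ∃ c e, R.InnerIn c {x, y} ∧
      R.InnerIn e {x, y, z} ∧ Nat.card V ≤ dg G c + dg G e := by
    rintro x y z ⟨hx, hz, hxz, c, hc, hd⟩
    have hy := R.inner_of_adj hx hz hxz
    have hc' : R.InnerIn c {x, y} := by
      rcases hc with rfl | hc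
      · exact R.innerIn_lab hx (Or.inr hy)
      · exact (R.innerIn_pendant hc hy).mono (by simp)
    rcases hd with hd | hd
    · exact ⟨c, c, hc', hc'.mono (by intro w; simp; tauto), hd⟩
    · exact ⟨c, _, hc', (R.innerIn_lab hz (Or.inl hy)).mono (by intro w; simp; tauto), hd⟩
  obtain ⟨c, e, hc, he, hd⟩ := key h
  obtain ⟨c', e', hc', he', hd'⟩ := key h'
  have k1 := (hc.far he' (by
    rintro w (rfl | rfl) <;>
      simp only [Set.mem_insert_iff, Set.mem_singleton_iff, not_or] <;> tauto)).lt
  have k2 := (he.far hc' (by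
    rintro w (rfl | rfl | rfl) <;>
      simp only [Set.mem_insert_iff, Set.mem_singleton_iff, not_or] <;> tauto)).lt
  omega

end Rep

/-- An induced path `q 0, …, q M` of `G` made of three segments `[1, P]`, `[P, Q]`, `[Q, M - 1]`
and two further vertices, in which heavy pairs are confined to the segments. -/
structure IsSeq {V : Type*} (G : SimpleGraph V) (q : ℕ → V) (P Q M : ℕ) : Prop where
  lt₁ : 1 < P
  lt₂ : P < Q
  lt₃ : Q + 1 < M
  ne : ∀ i j, i < j → j ≤ M → q i ≠ q j
  adj : ∀ i j, i < j → j ≤ M → (G.Adj (q i) (q j) ↔ j = i + 1)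
  heavy : ∀ i j, i < j → j ≤ M → Nat.card V ≤ dg G (q i) + dg G (q j) →
    j = i + 1 ∨ (i = 0 ∧ j = M) ∨
      (j ≤ i + 2 ∧ ((1 ≤ i ∧ j ≤ P) ∨ (P ≤ i ∧ j ≤ Q) ∨ (Q ≤ i ∧ j + 1 ≤ M)))

namespace IsSeq

variable {V : Type*} {G : SimpleGraph V} {q : ℕ → V} {P Q M : ℕ}

theorem window (h : IsSeq G q P Q M) (s : ℕ) (hs : s + 5 ≤ M) :
    IsInducedP6 G fun i : Fin 6 => q (s + i.val) := by
  refine ⟨fun i j hij => ?_, fun i j => ?_⟩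
  · by_contra hne
    have hi := i.isLt
    have hj := j.isLt
    rcases Nat.lt_or_gt_of_ne (Fin.val_ne_of_ne hne) with h' | h'
    · exact h.ne (s + i) (s + j) (by omega) (by omega) hij
    · exact h.ne (s + j) (s + i) (by omega) (by omega) hij.symm
  · have hi := i.isLt
    have hj := j.isLt
    rcases Nat.lt_trichotomy i.val j.val with h' | h' | h'
    · rw [h.adj (s + i) (s + j) (by omega) (by omega)]
      omega
    · simp only [h', SimpleGraph.irrefl, false_iff]
      omega
    · rw [SimpleGraph.adj_comm, h.adj (s + j) (s + i) (by omega) (by omega)]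
      omega

/-- Every induced `P₆` has a heavy pair prescribed by `γ`. -/
def _root_.ClawHeavy.PathHeavy {V : Type*} (G : SimpleGraph V) (γ : Set (Sym2 (Fin 6))) : Prop :=
  ∀ v : Fin 6 → V, IsInducedP6 G v →
    ∃ i j : Fin 6, s(i, j) ∈ γ ∧ Nat.card V ≤ dg G (v i) + dg G (v j)

theorem exists_heavy_of_gamma1 (h : IsSeq G q P Q M) (hγ : PathHeavy G gamma1)
    (h0 : dg G (q 0) + dg G (q M) < Nat.card V) :
    ∃ j, P < j ∧ j ≤ Q ∧ Nat.card V ≤ dg G (q P) + dg G (q j) := by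
  have l1 := h.lt₁
  have l2 := h.lt₂
  have l3 := h.lt₃
  have key : ∀ a b, a < 3 → 3 ≤ b → b < 6 →
      Nat.card V ≤ dg G (q (P - 2 + a)) + dg G (q (P - 2 + b)) →
      ∃ j, P < j ∧ j ≤ Q ∧ Nat.card V ≤ dg G (q P) + dg G (q j) := by
    intro a b ha hb hb' hd
    have h1 := h.heavy _ _ (by omega) (by omega) hd
    have h2 : P - 2 + a = P := by
      rcases h1 with h1 | ⟨h1, h2⟩ | h1
      · omega
      · rw [h1, h2] at hd
        omega
      · omega
    rw [h2] at hd h1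
    exact ⟨_, by omega, by omega, hd⟩
  obtain ⟨i, j, hij, hd⟩ := hγ _ (h.window (P - 2) (by omega))
  simp only [gamma1, Set.mem_insert_iff, Set.mem_singleton_iff, Sym2.eq_iff] at hij
  have hij' : (i.val < 3 ∧ 3 ≤ j.val) ∨ (j.val < 3 ∧ 3 ≤ i.val) := by
    simp only [Fin.ext_iff] at hij
    simp at hij
    omega
  rcases hij' with ⟨h1, h2⟩ | ⟨h1, h2⟩
  · exact key _ _ h1 h2 j.isLt hd
  · exact key _ _ h1 h2 i.isLt (by omega)

theorem exists_heavy_of_gamma3 (h : IsSeq G q P Q M) (hγ : PathHeavy G gamma3) :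
    ∃ i, ((1 < i ∧ i + 2 < P) ∨ (P < i ∧ i + 2 < Q) ∨ (Q < i ∧ i + 2 < M - 1)) ∧
      Nat.card V ≤ dg G (q i) + dg G (q (i + 2)) := by
  have l1 := h.lt₁
  have l2 := h.lt₂
  have l3 := h.lt₃
  by_contra! hcon
  have hH : ∀ i, i + 2 ≤ M → Nat.card V ≤ dg G (q i) + dg G (q (i + 2)) →
      (i = 1 ∨ i = P ∨ i = Q ∨ i + 2 = P ∨ i + 2 = Q ∨ i + 3 = M) ∧
      ((1 ≤ i ∧ i + 2 ≤ P) ∨ (P ≤ i ∧ i + 2 ≤ Q) ∨ (Q ≤ i ∧ i + 3 ≤ M)) := by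
    intro i hi hd
    have h1 := h.heavy i (i + 2) (by omega) hi hd
    have h2 := hcon i
    refine ⟨?_, by omega⟩
    by_contra hc
    have := h2 (by omega)
    omega
  have hw : ∀ s, s + 5 ≤ M → Nat.card V ≤ dg G (q s) + dg G (q (s + 2)) ∨
      Nat.card V ≤ dg G (q (s + 3)) + dg G (q (s + 5)) := by
    intro s hs
    obtain ⟨i, j, hij, hd⟩ := hγ _ (h.window s hs)
    have far : ∀ a b, a + 3 ≤ b → b ≤ a + 4 → s + b ≤ M →
        ¬ Nat.card V ≤ dg G (q (s + a)) + dg G (q (s + b)) := by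
      intro a b hab hab' hb hd
      have := h.heavy _ _ (by omega) hb hd
      omega
    have f1 := far 0 3
    have f2 := far 0 4
    have f3 := far 1 4
    have f4 := far 1 5
    have f5 := far 2 5
    simp only [gamma3, Set.mem_insert_iff, Set.mem_singleton_iff, Sym2.eq_iff] at hij
    have hs2 : s + 0 = s := rfl
    rcases hij with (⟨rfl, rfl⟩ | ⟨rfl, rfl⟩) | (⟨rfl, rfl⟩ | ⟨rfl, rfl⟩) |
      (⟨rfl, rfl⟩ | ⟨rfl, rfl⟩) | (⟨rfl, rfl⟩ | ⟨rfl, rfl⟩) | (⟨rfl, rfl⟩ | ⟨rfl, rfl⟩) |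
      (⟨rfl, rfl⟩ | ⟨rfl, rfl⟩) | (⟨rfl, rfl⟩ | ⟨rfl, rfl⟩) <;>
      simp at hd <;> simp at f1 f2 f3 f4 f5 <;> omega
  have nh0 : ¬ Nat.card V ≤ dg G (q 0) + dg G (q 2) := by
    intro hd
    have := hH 0 (by omega) hd
    omega
  have w0 := (hw 0 (by omega)).resolve_left nh0
  have h3 := hH 3 (by omega) w0
  have hM : 7 ≤ M := by
    by_contra hM
    have hM' : M = 6 := by omega
    have w1 := hw 1 (by omega)
    rcases w1 with w1 | w1
    · have := hH 1 (by omega) w1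
      omega
    · have := hH 4 (by omega) w1
      omega
  rcases hw 1 (by omega) with w1 | w1
  · have h1 := hH 1 (by omega) w1
    rcases hw 2 (by omega) with w2 | w2
    · have h2 := hH 2 (by omega) w2
      omega
    · have e1 : ¬ Nat.card V ≤ dg G (q 1) + dg G (q 5) := by
        intro hd
        have := h.heavy _ _ (by omega) (by omega) hd
        omega
      have e2 : ¬ Nat.card V ≤ dg G (q 3) + dg G (q 7) := by
        intro hd
        have := h.heavy _ _ (by omega) (by omega) hd
        omega
      simp at w1 w2
      omega
  · have h4 := hH 4 (by omega) w1
    rcases hw 2 (by omega) with w2 | w2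
    · have h2 := hH 2 (by omega) w2
      omega
    · have h5 := hH 5 (by omega) w2
      omega

theorem end_heavy_of_gamma2 (h : IsSeq G q P Q M) (hγ : PathHeavy G gamma2)
    (h0 : dg G (q 0) + dg G (q M) < Nat.card V) :
    (Nat.card V ≤ dg G (q 0) + dg G (q 0) ∨ Nat.card V ≤ dg G (q 0) + dg G (q 1)) ∨
      (Nat.card V ≤ dg G (q M) + dg G (q M) ∨ Nat.card V ≤ dg G (q M) + dg G (q (M - 1))) := by
  have l1 := h.lt₁
  have l2 := h.lt₂
  have l3 := h.lt₃
  have far : ∀ a b, a + 3 ≤ b → b ≤ M → dg G (q a) + dg G (q b) < Nat.card V := by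
    intro a b hab hb
    by_contra! hd
    rcases h.heavy a b (by omega) hb hd with h1 | ⟨h1, h2⟩ | h1
    · omega
    · rw [h1, h2] at hd
      omega
    · omega
  have hw : ∀ s, s + 5 ≤ M →
      (Nat.card V ≤ dg G (q s) + dg G (q s) ∨ Nat.card V ≤ dg G (q s) + dg G (q (s + 1))) ∨
      (Nat.card V ≤ dg G (q (s + 5)) + dg G (q (s + 5)) ∨
        Nat.card V ≤ dg G (q (s + 5)) + dg G (q (s + 4))) := by
    intro s hs
    obtain ⟨i, j, hij, hd⟩ := hγ _ (h.window s hs)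
    have f1 := far (s + 0) (s + 3) (by omega) (by omega)
    have f2 := far (s + 0) (s + 4) (by omega) (by omega)
    have f3 := far (s + 0) (s + 5) (by omega) (by omega)
    have f4 := far (s + 1) (s + 4) (by omega) (by omega)
    have f5 := far (s + 1) (s + 5) (by omega) (by omega)
    have f6 := far (s + 2) (s + 5) (by omega) (by omega)
    simp only [gamma2, Set.mem_insert_iff, Set.mem_singleton_iff, Sym2.eq_iff] at hij
    rcases hij with (⟨rfl, rfl⟩ | ⟨rfl, rfl⟩) | (⟨rfl, rfl⟩ | ⟨rfl, rfl⟩) |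
      (⟨rfl, rfl⟩ | ⟨rfl, rfl⟩) | (⟨rfl, rfl⟩ | ⟨rfl, rfl⟩) | (⟨rfl, rfl⟩ | ⟨rfl, rfl⟩) |
      (⟨rfl, rfl⟩ | ⟨rfl, rfl⟩) | (⟨rfl, rfl⟩ | ⟨rfl, rfl⟩) | (⟨rfl, rfl⟩ | ⟨rfl, rfl⟩) |
      (⟨rfl, rfl⟩ | ⟨rfl, rfl⟩) | (⟨rfl, rfl⟩ | ⟨rfl, rfl⟩) <;>
      simp at hd <;> simp at f1 f2 f3 <;> omega
  have main : ∀ s, s + 5 ≤ M →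
      (Nat.card V ≤ dg G (q 0) + dg G (q 0) ∨ Nat.card V ≤ dg G (q 0) + dg G (q 1)) ∨
      (Nat.card V ≤ dg G (q (s + 5)) + dg G (q (s + 5)) ∨
        Nat.card V ≤ dg G (q (s + 5)) + dg G (q (s + 4))) := by
    intro s
    induction s with
    | zero => exact hw 0
    | succ s ih =>
      intro hs
      rcases ih (by omega) with h1 | h1
      · exact Or.inl h1
      · refine Or.inr ((hw (s + 1) hs).resolve_left fun h2 => ?_)
        have f1 := far (s + 1) (s + 5) (by omega) (by omega)
        have f2 := far (s + 1) (s + 4) (by omega) (by omega)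
        have f3 := far (s + 1 + 1) (s + 5) (by omega) (by omega)
        omega
  have := main (M - 5) (by omega)
  rwa [show M - 5 + 5 = M by omega, show M - 5 + 4 = M - 1 by omega] at this

end IsSeq

namespace Rep

variable {V W : Type*} {G : SimpleGraph V} {R : Rep G W} {p q c e f : V} {w x y z : W}

theorem IsSeg.exists_isSeq {c' p₀ p₁ p₂ p₃ : V} {k₁ k₂ k₃ : ℕ} {s₁ s₂ s₃ : ℕ → V}
    (h₁ : R.IsSeg x p₀ p₁ k₁ s₁) (h₂ : R.IsSeg y p₁ p₂ k₂ s₂) (h₃ : R.IsSeg z p₂ p₃ k₃ s₃)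
    (hc : G.Adj c p₀) (hc' : G.Adj p₃ c') (hne : c ≠ c') (hadj : ¬ G.Adj c c')
    (c₁ : ∀ i, 0 < i → i ≤ k₁ → Far G c (s₁ i)) (c₂ : ∀ i, 0 < i → i ≤ k₂ → Far G c (s₂ i))
    (c₃ : ∀ i, 0 < i → i ≤ k₃ → Far G c (s₃ i)) (d₁ : ∀ i, i < k₁ → Far G (s₁ i) c')
    (d₂ : ∀ i, i < k₂ → Far G (s₂ i) c') (d₃ : ∀ i, i < k₃ → Far G (s₃ i) c')
    (f₁₂ : ∀ i j, i < k₁ → 0 < j → j ≤ k₂ → Far G (s₁ i) (s₂ j))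
    (f₂₃ : ∀ i j, i < k₂ → 0 < j → j ≤ k₃ → Far G (s₂ i) (s₃ j))
    (f₁₃ : ∀ i j, i < k₁ → 0 < j → j ≤ k₃ → Far G (s₁ i) (s₃ j)) :
    ∃ q : ℕ → V, q 0 = c ∧ (∀ i, i ≤ k₁ → q (1 + i) = s₁ i) ∧
      (∀ i, i ≤ k₂ → q (1 + k₁ + i) = s₂ i) ∧ (∀ i, i ≤ k₃ → q (1 + k₁ + k₂ + i) = s₃ i) ∧
      q (2 + k₁ + k₂ + k₃) = c' ∧ IsSeq G q (1 + k₁) (1 + k₁ + k₂) (2 + k₁ + k₂ + k₃) := by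
  have l₁ := h₁.pos
  have l₂ := h₂.pos
  have l₃ := h₃.pos
  let q : ℕ → V := fun n => if n = 0 then c else if n ≤ 1 + k₁ then s₁ (n - 1) else
    if n ≤ 1 + k₁ + k₂ then s₂ (n - 1 - k₁) else
    if n ≤ 1 + k₁ + k₂ + k₃ then s₃ (n - 1 - k₁ - k₂) else c'
  have q0 : q 0 = c := rfl
  have q1 : ∀ i, i ≤ k₁ → q (1 + i) = s₁ i := by
    intro i hi
    simp only [q]
    rw [if_neg (by omega), if_pos (by omega), show 1 + i - 1 = i by omega]
  have q2 : ∀ i, i ≤ k₂ → q (1 + k₁ + i) = s₂ i := by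
    intro i hi
    rcases Nat.eq_zero_or_pos i with rfl | hi0
    · rw [Nat.add_zero, q1 _ le_rfl, h₁.last, h₂.zero]
    · simp only [q]
      rw [if_neg (by omega), if_neg (by omega), if_pos (by omega),
        show 1 + k₁ + i - 1 - k₁ = i by omega]
  have q3 : ∀ i, i ≤ k₃ → q (1 + k₁ + k₂ + i) = s₃ i := by
    intro i hi
    rcases Nat.eq_zero_or_pos i with rfl | hi0
    · rw [Nat.add_zero, q2 _ le_rfl, h₂.last, h₃.zero]
    · simp only [q]
      rw [if_neg (by omega), if_neg (by omega), if_neg (by omega), if_pos (by omega),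
        show 1 + k₁ + k₂ + i - 1 - k₁ - k₂ = i by omega]
  have q4 : q (2 + k₁ + k₂ + k₃) = c' := by
    simp only [q]
    rw [if_neg (by omega), if_neg (by omega), if_neg (by omega), if_neg (by omega)]
  have good : ∀ i j, i < j → j ≤ 2 + k₁ + k₂ + k₃ → q i ≠ q j ∧ (G.Adj (q i) (q j) ↔ j = i + 1) ∧
      (Nat.card V ≤ dg G (q i) + dg G (q j) → j = i + 1 ∨ (i = 0 ∧ j = 2 + k₁ + k₂ + k₃) ∨
        (j ≤ i + 2 ∧ ((1 ≤ i ∧ j ≤ 1 + k₁) ∨ (1 + k₁ ≤ i ∧ j ≤ 1 + k₁ + k₂) ∨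
          (1 + k₁ + k₂ ≤ i ∧ j + 1 ≤ 2 + k₁ + k₂ + k₃)))) := by
    intro i j hij hj
    have far : ∀ {A : Prop}, Far G (q i) (q j) → j ≠ i + 1 → q i ≠ q j ∧
        (G.Adj (q i) (q j) ↔ j = i + 1) ∧ (Nat.card V ≤ dg G (q i) + dg G (q j) → A) :=
      fun h hne => ⟨h.ne, iff_of_false h.not_adj hne, fun hd => absurd h.lt (Nat.not_lt.2 hd)⟩
    have ci : i = 0 ∨ (∃ a, i = 1 + a ∧ a < k₁) ∨ (∃ a, i = 1 + k₁ + a ∧ a < k₂) ∨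
        (∃ a, i = 1 + k₁ + k₂ + a ∧ a < k₃) ∨ i = 1 + k₁ + k₂ + k₃ := by
      rcases Nat.eq_zero_or_pos i with h | h
      · exact Or.inl h
      rcases Nat.lt_or_ge i (1 + k₁) with h1 | h1
      · exact Or.inr (Or.inl ⟨i - 1, by omega, by omega⟩)
      rcases Nat.lt_or_ge i (1 + k₁ + k₂) with h2 | h2
      · exact Or.inr (Or.inr (Or.inl ⟨i - 1 - k₁, by omega, by omega⟩))
      rcases Nat.lt_or_ge i (1 + k₁ + k₂ + k₃) with h3 | h3
      · exact Or.inr (Or.inr (Or.inr (Or.inl ⟨i - 1 - k₁ - k₂, by omega, by omega⟩)))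
      · exact Or.inr (Or.inr (Or.inr (Or.inr (by omega))))
    have cj : j = 1 ∨ (∃ a, j = 1 + a ∧ 0 < a ∧ a ≤ k₁) ∨ (∃ a, j = 1 + k₁ + a ∧ 0 < a ∧ a ≤ k₂) ∨
        (∃ a, j = 1 + k₁ + k₂ + a ∧ 0 < a ∧ a ≤ k₃) ∨ j = 2 + k₁ + k₂ + k₃ := by
      rcases Nat.lt_or_ge 1 j with h | h
      · refine Or.inr ?_
        rcases Nat.lt_or_ge (1 + k₁) j with h1 | h1
        · refine Or.inr ?_
          rcases Nat.lt_or_ge (1 + k₁ + k₂) j with h2 | h2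
          · refine Or.inr ?_
            rcases Nat.lt_or_ge (1 + k₁ + k₂ + k₃) j with h3 | h3
            · exact Or.inr (by omega)
            · exact Or.inl ⟨j - 1 - k₁ - k₂, by omega, by omega, by omega⟩
          · exact Or.inl ⟨j - 1 - k₁, by omega, by omega, by omega⟩
        · exact Or.inl ⟨j - 1, by omega, by omega, by omega⟩
      · exact Or.inl (by omega)
    rcases ci with rfl | ⟨a, rfl, ha⟩ | ⟨a, rfl, ha⟩ | ⟨a, rfl, ha⟩ | rfl
    · rcases cj with rfl | ⟨b, rfl, hb, hb'⟩ | ⟨b, rfl, hb, hb'⟩ | ⟨b, rfl, hb, hb'⟩ | rfl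
      · have : q 1 = p₀ := by rw [← h₁.zero, ← q1 0 (by omega)]
        rw [q0, this]
        exact ⟨hc.ne, iff_of_true hc rfl, fun _ => Or.inl rfl⟩
      · exact far (by rw [q0, q1 b hb']; exact c₁ b hb hb') (by omega)
      · exact far (by rw [q0, q2 b hb']; exact c₂ b hb hb') (by omega)
      · exact far (by rw [q0, q3 b hb']; exact c₃ b hb hb') (by omega)
      · rw [q0, q4]
        exact ⟨hne, iff_of_false hadj (by omega), fun _ => Or.inr (Or.inl ⟨rfl, rfl⟩)⟩
    · rcases cj with rfl | ⟨b, rfl, hb, hb'⟩ | ⟨b, rfl, hb, hb'⟩ | ⟨b, rfl, hb, hb'⟩ | rfl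
      · omega
      · rw [q1 a ha.le, q1 b hb']
        refine ⟨h₁.ne a b (by omega) hb', ?_, fun hd => ?_⟩
        · rw [h₁.adj a b (by omega) hb']
          omega
        · have := h₁.heavy a b (by omega) hb' hd
          omega
      · exact far (by rw [q1 a ha.le, q2 b hb']; exact f₁₂ a b ha hb hb') (by omega)
      · exact far (by rw [q1 a ha.le, q3 b hb']; exact f₁₃ a b ha hb hb') (by omega)
      · exact far (by rw [q1 a ha.le, q4]; exact d₁ a ha) (by omega)
    · rcases cj with rfl | ⟨b, rfl, hb, hb'⟩ | ⟨b, rfl, hb, hb'⟩ | ⟨b, rfl, hb, hb'⟩ | rfl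
      · omega
      · omega
      · rw [q2 a ha.le, q2 b hb']
        refine ⟨h₂.ne a b (by omega) hb', ?_, fun hd => ?_⟩
        · rw [h₂.adj a b (by omega) hb']
          omega
        · have := h₂.heavy a b (by omega) hb' hd
          omega
      · exact far (by rw [q2 a ha.le, q3 b hb']; exact f₂₃ a b ha hb hb') (by omega)
      · exact far (by rw [q2 a ha.le, q4]; exact d₂ a ha) (by omega)
    · rcases cj with rfl | ⟨b, rfl, hb, hb'⟩ | ⟨b, rfl, hb, hb'⟩ | ⟨b, rfl, hb, hb'⟩ | rfl
      · omega
      · omega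
      · omega
      · rw [q3 a ha.le, q3 b hb']
        refine ⟨h₃.ne a b (by omega) hb', ?_, fun hd => ?_⟩
        · rw [h₃.adj a b (by omega) hb']
          omega
        · have := h₃.heavy a b (by omega) hb' hd
          omega
      · exact far (by rw [q3 a ha.le, q4]; exact d₃ a ha) (by omega)
    · have hj' : j = 2 + k₁ + k₂ + k₃ := by omega
      subst hj'
      rw [q3 _ le_rfl, q4, h₃.last]
      exact ⟨hc'.ne, iff_of_true hc' (by omega), fun _ => Or.inl (by omega)⟩
  exact ⟨q, q0, q1, q2, q3, q4, by omega, by omega, by omega, fun i j hij hj => (good i j hij hj).1,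
    fun i j hij hj => (good i j hij hj).2.1, fun i j hij hj => (good i j hij hj).2.2⟩

theorem IsSeg.longSeg_of_gamma3 {p₀ p₁ p₂ p₃ : V} {k₁ k₂ k₃ : ℕ} {s₁ s₂ s₃ q : ℕ → V}
    (h₁ : R.IsSeg x p₀ p₁ k₁ s₁) (h₂ : R.IsSeg y p₁ p₂ k₂ s₂) (h₃ : R.IsSeg z p₂ p₃ k₃ s₃)
    (q₁ : ∀ i, i ≤ k₁ → q (1 + i) = s₁ i) (q₂ : ∀ i, i ≤ k₂ → q (1 + k₁ + i) = s₂ i)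
    (q₃ : ∀ i, i ≤ k₃ → q (1 + k₁ + k₂ + i) = s₃ i)
    (hq : IsSeq G q (1 + k₁) (1 + k₁ + k₂) (2 + k₁ + k₂ + k₃)) (hγ : PathHeavy G gamma3) :
    R.LongSeg x p₀ p₁ ∨ R.LongSeg y p₁ p₂ ∨ R.LongSeg z p₂ p₃ := by
  obtain ⟨i, hi, hd⟩ := hq.exists_heavy_of_gamma3 hγ
  rcases hi with ⟨h1, h2⟩ | ⟨h1, h2⟩ | ⟨h1, h2⟩
  · obtain ⟨a, rfl⟩ := Nat.exists_eq_add_of_lt h1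
    refine Or.inl ⟨k₁, s₁, a + 1, h₁, by omega, by omega, ?_⟩
    rwa [← q₁ _ (by omega), ← q₁ _ (by omega)]
  · obtain ⟨a, rfl⟩ := Nat.exists_eq_add_of_lt h1
    refine Or.inr (Or.inl ⟨k₂, s₂, a + 1, h₂, by omega, by omega, ?_⟩)
    rwa [← q₂ _ (by omega), ← q₂ _ (by omega)]
  · obtain ⟨a, rfl⟩ := Nat.exists_eq_add_of_lt h1
    refine Or.inr (Or.inr ⟨k₃, s₃, a + 1, h₃, by omega, by omega, ?_⟩)
    rwa [← q₃ _ (by omega), ← q₃ _ (by omega)]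

theorem IsSeg.innerIn_right {p : V} {k : ℕ} {s : ℕ → V} (h : R.IsSeg y p (R.lab y z) k s)
    (hz : R.H.Adj y z) (hy : R.Inner y) {i : ℕ} (hi : 0 < i) (hik : i ≤ k) :
    R.InnerIn (s i) {y, z} := by
  rcases Nat.lt_or_ge i k with h1 | h1
  · exact (R.innerIn_pendant (h.pendant i hi h1) hy).mono (by simp)
  · rw [le_antisymm hik h1, h.last]
    exact R.innerIn_lab hz (Or.inl hy)

theorem IsSeg.innerIn_left {p : V} {k : ℕ} {s : ℕ → V} (h : R.IsSeg y (R.lab x y) p k s)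
    (hx : R.H.Adj x y) (hy : R.Inner y) {i : ℕ} (hik : i < k) : R.InnerIn (s i) {x, y} := by
  rcases Nat.eq_zero_or_pos i with rfl | hi
  · rw [h.zero]
    exact R.innerIn_lab hx (Or.inr hy)
  · exact (R.innerIn_pendant (h.pendant i hi hik) hy).mono (by simp)

theorem exists_isSeg_lab [Finite V] (hx : R.H.Adj x y) (hz : R.H.Adj y z) (hxz : x ≠ z) :
    ∃ k s, R.IsSeg y (R.lab x y) (R.lab y z) k s := by
  refine R.exists_isSeg ?_ ((R.mem_lab hx).2 (Or.inr rfl)) ((R.mem_lab hz).2 (Or.inl rfl))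
  rw [Ne, R.lab_inj hx hz]
  rintro (⟨rfl, rfl⟩ | ⟨rfl, -⟩)
  · exact hx.ne rfl
  · exact hxz rfl

theorem exists_adj_lab [Finite V] (hx : R.H.Adj x y) (hz : R.H.Adj y z) (hxz : x ≠ z) :
    ∃ c, (c = R.lab x y ∨ Pendant R.ends c y) ∧ G.Adj c (R.lab y z) := by
  obtain ⟨k, s, hs⟩ := exists_isSeg_lab hx hz hxz
  have hk := hs.pos
  refine ⟨s (k - 1), ?_, ?_⟩
  · rcases Nat.eq_zero_or_pos (k - 1) with h | h
    · exact Or.inl (h ▸ hs.zero)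
    · exact Or.inr (hs.pendant _ h (by omega))
  · rw [← hs.last, hs.adj _ _ (by omega) le_rfl]
    omega

theorem exists_isSeq_of_path [Finite V] {x₁ x₂ x₃ x₄ x₅ x₆ x₇ : W}
    (hp : [x₁, x₂, x₃, x₄, x₅, x₆, x₇].IsChain R.H.Adj)
    (hn : [x₁, x₂, x₃, x₄, x₅, x₆, x₇].Nodup) :
    ∃ (c c' : V) (k₁ k₂ k₃ : ℕ) (s₁ s₂ s₃ q : ℕ → V),
      (c = R.lab x₁ x₂ ∨ Pendant R.ends c x₂) ∧ (c' = R.lab x₇ x₆ ∨ Pendant R.ends c' x₆) ∧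
      dg G c + dg G c' < Nat.card V ∧ R.IsSeg x₃ (R.lab x₂ x₃) (R.lab x₃ x₄) k₁ s₁ ∧
      R.IsSeg x₄ (R.lab x₃ x₄) (R.lab x₄ x₅) k₂ s₂ ∧
      R.IsSeg x₅ (R.lab x₄ x₅) (R.lab x₅ x₆) k₃ s₃ ∧ q 0 = c ∧ (∀ i, i ≤ k₁ → q (1 + i) = s₁ i) ∧
      (∀ i, i ≤ k₂ → q (1 + k₁ + i) = s₂ i) ∧ (∀ i, i ≤ k₃ → q (1 + k₁ + k₂ + i) = s₃ i) ∧
      q (2 + k₁ + k₂ + k₃) = c' ∧ IsSeq G q (1 + k₁) (1 + k₁ + k₂) (2 + k₁ + k₂ + k₃) := by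
  simp only [List.isChain_cons_cons, List.isChain_singleton, and_true] at hp
  obtain ⟨a₁, a₂, a₃, a₄, a₅, a₆⟩ := hp
  simp only [List.nodup_cons, List.mem_cons, List.not_mem_nil, or_false, not_or] at hn
  obtain ⟨⟨n12, n13, n14, n15, n16, n17⟩, ⟨n23, n24, n25, n26, n27⟩, ⟨n34, n35, n36, n37⟩,
    ⟨n45, n46, n47⟩, ⟨n56, n57⟩, n67, -⟩ := hn
  obtain ⟨c, hc, hcp⟩ := exists_adj_lab a₁ a₂ n13
  obtain ⟨c', hc', hcp'⟩ := exists_adj_lab a₆.symm a₅.symm (Ne.symm n57)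
  rw [R.lab_comm a₅.symm] at hcp'
  obtain ⟨k₁, s₁, h₁⟩ := exists_isSeg_lab a₂ a₃ n24
  obtain ⟨k₂, s₂, h₂⟩ := exists_isSeg_lab a₃ a₄ n35
  obtain ⟨k₃, s₃, h₃⟩ := exists_isSeg_lab a₄ a₅ n46
  have i₂ := R.inner_of_adj a₁ a₂ n13
  have i₃ := R.inner_of_adj a₂ a₃ n24
  have i₄ := R.inner_of_adj a₃ a₄ n35
  have i₅ := R.inner_of_adj a₄ a₅ n46
  have i₆ := R.inner_of_adj a₅ a₆ n57
  have ic : R.InnerIn c {x₁, x₂} := by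
    rcases hc with rfl | hc
    · exact R.innerIn_lab a₁ (Or.inr i₂)
    · exact (R.innerIn_pendant hc i₂).mono (by simp)
  have ic' : R.InnerIn c' {x₆, x₇} := by
    rcases hc' with rfl | hc'
    · exact (R.innerIn_lab a₆.symm (Or.inr i₆)).mono (by intro w; simp; tauto)
    · exact (R.innerIn_pendant hc' i₆).mono (by simp)
  have fcc : Far G c c' := ic.far ic' (by rintro w (rfl | rfl) <;> simp [*])
  obtain ⟨q, e0, e1, e2, e3, e4, hq⟩ := h₁.exists_isSeq h₂ h₃ hcp hcp'.symm fcc.ne fcc.not_adj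
    (fun i hi hk => ic.far (h₁.innerIn_right a₃ i₃ hi hk) (by rintro w (rfl | rfl) <;> simp [*]))
    (fun i _ hk => by
      rcases Nat.lt_or_ge i k₂ with h | h
      · exact ic.far (h₂.innerIn_left a₃ i₄ h) (by rintro w (rfl | rfl) <;> simp [*])
      · rw [le_antisymm hk h]
        exact ic.far (h₂.innerIn_right a₄ i₄ h₂.pos le_rfl)
          (by rintro w (rfl | rfl) <;> simp [*]))
    (fun i hi hk => ic.far (h₃.innerIn_right a₅ i₅ hi hk) (by rintro w (rfl | rfl) <;> simp [*]))
    (fun i hk => (h₁.innerIn_left a₂ i₃ hk).far ic' (by rintro w (rfl | rfl) <;> simp [*]))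
    (fun i hk => (h₂.innerIn_left a₃ i₄ hk).far ic' (by rintro w (rfl | rfl) <;> simp [*]))
    (fun i hk => (h₃.innerIn_left a₄ i₅ hk).far ic' (by rintro w (rfl | rfl) <;> simp [*]))
    (fun i j hi hj hk => (h₁.innerIn_left a₂ i₃ hi).far (h₂.innerIn_right a₄ i₄ hj hk)
      (by rintro w (rfl | rfl) <;> simp [*]))
    (fun i j hi hj hk => (h₂.innerIn_left a₃ i₄ hi).far (h₃.innerIn_right a₅ i₅ hj hk)
      (by rintro w (rfl | rfl) <;> simp [*]))
    (fun i j hi hj hk => (h₁.innerIn_left a₂ i₃ hi).far (h₃.innerIn_right a₅ i₅ hj hk)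
      (by rintro w (rfl | rfl) <;> simp [*]))
  exact ⟨c, c', k₁, k₂, k₃, s₁, s₂, s₃, q, hc, hc', fcc.lt, h₁, h₂, h₃, e0, e1, e2, e3, e4, hq⟩

section Path

variable [Finite V] {x₁ x₂ x₃ x₄ x₅ x₆ x₇ : W}
  (hp : [x₁, x₂, x₃, x₄, x₅, x₆, x₇].IsChain R.H.Adj)
  (hn : [x₁, x₂, x₃, x₄, x₅, x₆, x₇].Nodup)

include hp hn

theorem starHeavy_of_path (hγ : PathHeavy G gamma1) : R.StarHeavy x₄ := by
  obtain ⟨c, c', k₁, k₂, k₃, s₁, s₂, s₃, q, -, -, hlt, h₁, h₂, h₃, rfl, e1, e2, e3, rfl, hq⟩ :=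
    exists_isSeq_of_path hp hn
  obtain ⟨j, hj, hj', hd⟩ := hq.exists_heavy_of_gamma1 hγ hlt
  simp only [List.isChain_cons_cons, List.isChain_singleton, and_true] at hp
  obtain ⟨a, rfl⟩ := Nat.exists_eq_add_of_lt hj
  rw [show 1 + k₁ = 1 + k₁ + 0 from rfl, e2 0 (by omega),
    show 1 + k₁ + 0 + a + 1 = 1 + k₁ + (a + 1) by omega, e2 _ (by omega)] at hd
  have key : ∀ i, i ≤ k₂ → x₄ ∈ R.ends (s₂ i) := by
    intro i hi
    rcases Nat.eq_zero_or_pos i with rfl | h0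
    · rw [h₂.zero]
      exact (R.mem_lab hp.2.2.1).2 (Or.inr rfl)
    rcases Nat.lt_or_ge i k₂ with h1 | h1
    · exact R.pendant_mem (h₂.pendant i h0 h1)
    · rw [le_antisymm hi h1, h₂.last]
      exact (R.mem_lab hp.2.2.2.1).2 (Or.inl rfl)
  exact ⟨_, _, h₂.ne 0 (a + 1) (by omega) (by omega), key _ (by omega), key _ (by omega), hd⟩

theorem endHeavy_of_path (hγ : PathHeavy G gamma2) :
    R.EndHeavy x₁ x₂ x₃ ∨ R.EndHeavy x₇ x₆ x₅ := by
  obtain ⟨c, c', k₁, k₂, k₃, s₁, s₂, s₃, q, hc, hc', hlt, h₁, h₂, h₃, e0, e1, e2, e3, e4, hq⟩ :=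
    exists_isSeq_of_path hp hn
  have hd := hq.end_heavy_of_gamma2 hγ (by rwa [e0, e4])
  simp only [List.isChain_cons_cons, List.isChain_singleton, and_true] at hp
  obtain ⟨a₁, a₂, a₃, a₄, a₅, a₆⟩ := hp
  have n13 : x₁ ≠ x₃ := by rintro rfl; simp at hn
  have n57 : x₅ ≠ x₇ := by rintro rfl; simp at hn
  rw [e0, e4, show 1 = 1 + 0 from rfl, e1 0 (by omega), h₁.zero,
    show 2 + k₁ + k₂ + k₃ - (1 + 0) = 1 + k₁ + k₂ + k₃ by omega, e3 k₃ le_rfl, h₃.last] at hd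
  rcases hd with hd | hd
  · exact Or.inl ⟨a₁, a₂, n13, c, hc, hd⟩
  · exact Or.inr ⟨a₆.symm, a₅.symm, n57.symm, c', hc', by rwa [R.lab_comm a₅.symm]⟩

theorem longSeg_of_path (hγ : PathHeavy G gamma3) :
    R.LongSeg x₃ (R.lab x₂ x₃) (R.lab x₃ x₄) ∨ R.LongSeg x₄ (R.lab x₃ x₄) (R.lab x₄ x₅) ∨
      R.LongSeg x₅ (R.lab x₄ x₅) (R.lab x₅ x₆) := by
  obtain ⟨c, c', k₁, k₂, k₃, s₁, s₂, s₃, q, -, -, hlt, h₁, h₂, h₃, -, e1, e2, e3, -, hq⟩ :=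
    exists_isSeq_of_path hp hn
  exact h₁.longSeg_of_gamma3 h₂ h₃ e1 e2 e3 hq hγ

theorem pendantHeavy_of_path (hγ : PathHeavy G gamma3) :
    R.PendantHeavy x₃ ∨ R.PendantHeavy x₄ ∨ R.PendantHeavy x₅ :=
  (longSeg_of_path hp hn hγ).imp LongSeg.pendantHeavy
    (Or.imp LongSeg.pendantHeavy LongSeg.pendantHeavy)

end Path

theorem LongSeg.false_of_fourCycle [Finite V] {u v w w' : W} (hγ : PathHeavy G gamma3)
    (h : R.LongSeg u (R.lab u w) (R.lab u w')) (a₁ : R.H.Adj u w) (a₂ : R.H.Adj w v)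
    (a₃ : R.H.Adj v w') (a₄ : R.H.Adj w' u) (huv : u ≠ v) (hww : w ≠ w') : False := by
  have hu := h.pendantHeavy
  obtain ⟨n, t, m, ht, hm, hmn, -⟩ := h
  have n1 : 1 < n := by omega
  have farT : ∀ i j, i + 3 ≤ j → j ≤ n → Far G (t i) (t j) := by
    intro i j hij hj
    refine ⟨ht.ne i j (by omega) hj, ?_, ?_⟩
    · rw [ht.adj i j (by omega) hj]
      omega
    · by_contra! hd
      have := ht.heavy i j (by omega) hj hd
      omega
  obtain ⟨k₁, s₁, h₁⟩ := exists_isSeg_lab a₁ a₂ huv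
  obtain ⟨k₂, s₂, h₂⟩ := exists_isSeg_lab a₂ a₃ hww
  obtain ⟨k₃, s₃, h₃⟩ := exists_isSeg_lab a₃ a₄ huv.symm
  have iu := R.inner_of_adj a₄ a₁ hww.symm
  have iw := R.inner_of_adj a₁ a₂ huv
  have iv := R.inner_of_adj a₂ a₃ hww
  have iw' := R.inner_of_adj a₃ a₄ huv.symm
  have l₁ := h₁.pos
  have l₂ := h₂.pos
  have l₃ := h₃.pos
  have e0 : s₁ 0 = t 0 := h₁.zero.trans ht.zero.symm
  have e1 : s₃ k₃ = t n := by rw [h₃.last, ht.last, R.lab_comm a₄]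
  have ic := R.innerIn_pendant (ht.pendant 1 one_pos n1) iu
  have ic' := R.innerIn_pendant (ht.pendant (n - 1) (by omega) (by omega)) iu
  have b₁ := a₁.ne
  have b₂ := a₂.ne
  have b₃ := a₃.ne
  have b₄ := a₄.ne
  obtain ⟨q, -, q1, q2, q3, -, hq⟩ := h₁.exists_isSeq h₂ h₃ (c := t 1) (c' := t (n - 1))
    (by rw [← ht.zero, G.adj_comm, ht.adj 0 1 (by omega) (by omega)])
    (by
      rw [← h₃.last, e1, G.adj_comm, ht.adj _ _ (by omega) le_rfl]
      omega)
    (ht.ne _ _ (by omega) (by omega))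
    (by
      rw [ht.adj _ _ (by omega) (by omega)]
      omega)
    (fun i hi hk => ic.far (h₁.innerIn_right a₂ iw hi hk) (by rintro x rfl; simp [*]))
    (fun i _ hk => by
      rcases Nat.lt_or_ge i k₂ with h | h
      · exact ic.far (h₂.innerIn_left a₂ iv h) (by rintro x rfl; simp [*])
      · rw [le_antisymm hk h]
        exact ic.far (h₂.innerIn_right a₃ iv h₂.pos le_rfl)
          (by rintro x rfl; simp [*, b₄.symm]))
    (fun i _ hk => by
      rcases Nat.lt_or_ge i k₃ with h | h
      · exact ic.far (h₃.innerIn_left a₃ iw' h) (by rintro x rfl; simp [*, b₄.symm])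
      · rw [le_antisymm hk h, e1]
        exact farT _ _ (by omega) le_rfl)
    (fun i hk => by
      rcases Nat.eq_zero_or_pos i with rfl | h
      · rw [e0]
        exact farT _ _ (by omega) (by omega)
      · exact (h₁.innerIn_right a₂ iw h hk.le).far ic'
          (by rintro x (rfl | rfl) <;> simp [*, b₁.symm, huv.symm]))
    (fun i hk => (h₂.innerIn_left a₂ iv hk).far ic'
      (by rintro x (rfl | rfl) <;> simp [*, b₁.symm, huv.symm]))
    (fun i hk => (h₃.innerIn_left a₃ iw' hk).far ic'
      (by rintro x (rfl | rfl) <;> simp [*, huv.symm]))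
    (fun i j hi hj hk => (h₁.innerIn_left a₁ iw hi).far (h₂.innerIn_right a₃ iv hj hk)
      (by rintro x (rfl | rfl) <;> simp [*, b₄.symm]))
    (fun i j hi hj hk => (h₂.innerIn_left a₂ iv hi).far (h₃.innerIn_right a₄ iw' hj hk)
      (by rintro x (rfl | rfl) <;> simp [*, b₁.symm, huv.symm]))
    (fun i j hi hj hk => by
      rcases Nat.eq_zero_or_pos i with rfl | h
      · rcases Nat.lt_or_ge j k₃ with h' | h'
        · exact (h₁.innerIn_left a₁ iw hi).far (R.innerIn_pendant (h₃.pendant j hj h') iw')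
            (by rintro x (rfl | rfl) <;> simp [*, b₄.symm])
        · rw [le_antisymm hk h', e0, e1]
          exact farT _ _ (by omega) le_rfl
      · exact (R.innerIn_pendant (h₁.pendant i h hi) iw).far (h₃.innerIn_right a₄ iw' hj hk)
          (by rintro x rfl; simp [*, b₁.symm]))
  rcases h₁.longSeg_of_gamma3 h₂ h₃ q1 q2 q3 hq hγ with h | h | h
  · exact b₁ (hu.unique h.pendantHeavy)
  · exact huv (hu.unique h.pendantHeavy)
  · exact b₄ (h.pendantHeavy.unique hu)

end Rep

namespace Rep

variable {V W : Type*} {G : SimpleGraph V} {R : Rep G W}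

/-- `f` embeds the graph on `Fin n` with edge list `E` as a subgraph of `R.H`. -/
structure Copy (R : Rep G W) {n : ℕ} (E : List (Fin n × Fin n)) (f : Fin n → W) : Prop where
  inj : Function.Injective f
  adj : ∀ e ∈ E, R.H.Adj (f e.1) (f e.2)

/-- `l` is a path of the graph on `Fin n` with edge list `E`. -/
abbrev IsPat {n : ℕ} (E : List (Fin n × Fin n)) (l : List (Fin n)) : Prop :=
  l.Nodup ∧ l.IsChain fun a b => (a, b) ∈ E ∨ (b, a) ∈ E

namespace Copy

theorem of_list {l : List W} (hl : l.Nodup) {E : List (Fin l.length × Fin l.length)}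
    (hE : ∀ e ∈ E, R.H.Adj (l.get e.1) (l.get e.2)) : R.Copy E l.get :=
  ⟨List.nodup_iff_injective_get.1 hl, hE⟩

variable {n : ℕ} {E : List (Fin n × Fin n)} {f : Fin n → W}

theorem nodup (h : R.Copy E f) {l : List (Fin n)} (hl : IsPat E l) : (l.map f).Nodup :=
  hl.1.map h.inj

theorem adj_of (h : R.Copy E f) {a b : Fin n} (hab : (a, b) ∈ E ∨ (b, a) ∈ E) :
    R.H.Adj (f a) (f b) :=
  hab.elim (fun h' => h.adj _ h') fun h' => (h.adj _ h').symm

theorem isChain (h : R.Copy E f) {l : List (Fin n)} (hl : IsPat E l) :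
    (l.map f).IsChain R.H.Adj :=
  (List.isChain_map f).2 (hl.2.imp fun _ _ => h.adj_of)

variable [Finite V]

theorem starHeavy (h : R.Copy E f) (hγ : PathHeavy G gamma1) {a b c d e i j : Fin n}
    (hl : IsPat E [a, b, c, d, e, i, j]) : R.StarHeavy (f d) :=
  starHeavy_of_path (h.isChain hl) (h.nodup hl) hγ

theorem endHeavy (h : R.Copy E f) (hγ : PathHeavy G gamma2) {a b c d e i j : Fin n}
    (hl : IsPat E [a, b, c, d, e, i, j]) :
    R.EndHeavy (f a) (f b) (f c) ∨ R.EndHeavy (f j) (f i) (f e) :=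
  endHeavy_of_path (h.isChain hl) (h.nodup hl) hγ

theorem longSeg (h : R.Copy E f) (hγ : PathHeavy G gamma3) {a b c d e i j : Fin n}
    (hl : IsPat E [a, b, c, d, e, i, j]) :
    R.LongSeg (f c) (R.lab (f b) (f c)) (R.lab (f c) (f d)) ∨
      R.LongSeg (f d) (R.lab (f c) (f d)) (R.lab (f d) (f e)) ∨
      R.LongSeg (f e) (R.lab (f d) (f e)) (R.lab (f e) (f i)) :=
  longSeg_of_path (h.isChain hl) (h.nodup hl) hγ

theorem pendantHeavy (h : R.Copy E f) (hγ : PathHeavy G gamma3) {a b c d e i j : Fin n}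
    (hl : IsPat E [a, b, c, d, e, i, j]) :
    R.PendantHeavy (f c) ∨ R.PendantHeavy (f d) ∨ R.PendantHeavy (f e) :=
  pendantHeavy_of_path (h.isChain hl) (h.nodup hl) hγ

omit [Finite V] in
theorem conflict (h : R.Copy E f) {a b c a' b' c' : Fin n} (h₁ : R.EndHeavy (f a) (f b) (f c))
    (h₂ : R.EndHeavy (f a') (f b') (f c'))
    (hd : a ≠ a' ∧ a ≠ b' ∧ a ≠ c' ∧ b ≠ a' ∧ b ≠ b' ∧ b ≠ c' ∧ c ≠ a' ∧ c ≠ b') : False :=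
  h₁.conflict h₂ (h.inj.ne hd.1) (h.inj.ne hd.2.1) (h.inj.ne hd.2.2.1) (h.inj.ne hd.2.2.2.1)
    (h.inj.ne hd.2.2.2.2.1) (h.inj.ne hd.2.2.2.2.2.1) (h.inj.ne hd.2.2.2.2.2.2.1)
    (h.inj.ne hd.2.2.2.2.2.2.2)

omit [Finite V] in
theorem star_conflict (h : R.Copy E f) {a b c : Fin n} (h₁ : R.StarHeavy (f a))
    (h₂ : R.StarHeavy (f c)) (hl : IsPat E [a, b, c]) : False := by
  have hc := h.isChain hl
  have hn := h.nodup hl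
  simp only [List.map_cons, List.map_nil, List.isChain_cons_cons, List.isChain_singleton,
    and_true] at hc
  have hac : f a ≠ f c := by
    intro hac
    simp [hac] at hn
  exact R.tri _ _ _ hc.1 hc.2 (h₁.adj h₂ hac).symm

omit [Finite V] in
theorem eq_of_pendantHeavy (h : R.Copy E f) {a b : Fin n} (h₁ : R.PendantHeavy (f a))
    (h₂ : R.PendantHeavy (f b)) : a = b :=
  h.inj (h₁.unique h₂)

omit [Finite V] in
theorem comp (h : R.Copy E f) {m : ℕ} {E' : List (Fin m × Fin m)} (g : Fin m → Fin n)
    (hg : Function.Injective g)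
    (hE : ∀ e ∈ E', (g e.1, g e.2) ∈ E ∨ (g e.2, g e.1) ∈ E) : R.Copy E' (f ∘ g) :=
  ⟨h.inj.comp hg, fun e he => h.adj_of (hE e he)⟩

end Copy

variable [Finite V]

/-- A `6`-cycle with a further vertex adjacent to it. -/
theorem sixCycle_pendantHeavy (hγ : PathHeavy G gamma3) {f : Fin 7 → W}
    (h : R.Copy [(0, 1), (1, 2), (2, 3), (3, 4), (4, 5), (5, 0), (6, 0)] f) :
    R.PendantHeavy (f 3) := by
  have h₁ := h.pendantHeavy hγ (a := 6) (b := 0) (c := 1) (d := 2) (e := 3) (i := 4) (j := 5)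
    (by decide)
  have h₂ := h.pendantHeavy hγ (a := 6) (b := 0) (c := 5) (d := 4) (e := 3) (i := 2) (j := 1)
    (by decide)
  rcases h₁ with h₁ | h₁ | h₁
  · rcases h₂ with h₂ | h₂ | h₂
    · exact absurd (h.eq_of_pendantHeavy h₁ h₂) (by decide)
    · exact absurd (h.eq_of_pendantHeavy h₁ h₂) (by decide)
    · exact h₂
  · rcases h₂ with h₂ | h₂ | h₂
    · exact absurd (h.eq_of_pendantHeavy h₁ h₂) (by decide)
    · exact absurd (h.eq_of_pendantHeavy h₁ h₂) (by decide)
    · exact h₂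
  · exact h₁

theorem sixCycle_false (hγ : PathHeavy G gamma1 ∨ PathHeavy G gamma3) {f : Fin 7 → W}
    (h : R.Copy [(0, 1), (1, 2), (2, 3), (3, 4), (4, 5), (5, 0), (6, 0)] f) : False := by
  rcases hγ with hγ | hγ
  · have h₁ := h.starHeavy hγ (a := 6) (b := 0) (c := 1) (d := 2) (e := 3) (i := 4) (j := 5)
      (by decide)
    have h₂ := h.starHeavy hγ (a := 6) (b := 0) (c := 5) (d := 4) (e := 3) (i := 2) (j := 1)
      (by decide)
    exact h.star_conflict h₁ h₂ (b := 3) (by decide)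
  · have h₁ := sixCycle_pendantHeavy hγ h
    obtain ⟨z, hz, hz'⟩ := h₁.exists_pendant
    have off : ∀ a b c : Fin 7, IsPat [(0, 1), (1, 2), (2, 3), (3, 4), (4, 5), (5, 0), (6, 0)]
        [a, b, c] → z ≠ f b := by
      rintro a b c hp rfl
      have hc := h.isChain hp
      simp only [List.map_cons, List.map_nil, List.isChain_cons_cons, List.isChain_singleton,
        and_true] at hc
      have hac : a ≠ c := by
        have := hp.1
        simp only [List.nodup_cons, List.mem_cons] at this
        tauto
      exact hac (h.inj ((hz' _ hc.1.symm).trans (hz' _ hc.2).symm))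
    have hn : [f 3, f 4, f 5, f 0, f 1, f 2, z].Nodup := by
      have h1 : ([3, 4, 5, 0, 1, 2] : List (Fin 7)).Nodup := by decide
      have h2 := h1.map h.inj
      have e0 := off 5 0 1 (by decide)
      have e1 := off 0 1 2 (by decide)
      have e2 := off 1 2 3 (by decide)
      have e3 := off 2 3 4 (by decide)
      have e4 := off 3 4 5 (by decide)
      have e5 := off 4 5 0 (by decide)
      have : [f 3, f 4, f 5, f 0, f 1, f 2, z] = [f 3, f 4, f 5, f 0, f 1, f 2] ++ [z] := rfl
      rw [this, List.nodup_append]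
      refine ⟨h2, List.nodup_singleton z, ?_⟩
      simp [e0.symm, e1.symm, e2.symm, e3.symm, e4.symm, e5.symm]
    have h' : R.Copy [(0, 1), (1, 2), (2, 3), (3, 4), (4, 5), (5, 0), (6, 0)]
        [f 3, f 4, f 5, f 0, f 1, f 2, z].get := by
      refine .of_list hn ?_
      simp only [List.mem_cons, List.not_mem_nil, or_false]
      rintro e (rfl | rfl | rfl | rfl | rfl | rfl | rfl)
      · exact h.adj_of (a := 3) (b := 4) (by decide)
      · exact h.adj_of (a := 4) (b := 5) (by decide)
      · exact h.adj_of (a := 5) (b := 0) (by decide)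
      · exact h.adj_of (a := 0) (b := 1) (by decide)
      · exact h.adj_of (a := 1) (b := 2) (by decide)
      · exact h.adj_of (a := 2) (b := 3) (by decide)
      · exact hz.symm
    exact absurd (h.eq_of_pendantHeavy (a := 0) (b := 3)
      (show R.PendantHeavy (f 0) from sixCycle_pendantHeavy hγ h') h₁) (by decide)

theorem threeShort_false
    (hγ : PathHeavy G gamma1 ∨ PathHeavy G gamma2 ∨ PathHeavy G gamma3) {f : Fin 8 → W}
    (h : R.Copy [(0, 2), (0, 3), (0, 4), (1, 2), (1, 3), (1, 4), (2, 5), (3, 6), (4, 7)] f) :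
    False := by
  rcases hγ with hγ | hγ | hγ
  · have h₁ := h.starHeavy hγ (a := 5) (b := 2) (c := 0) (d := 3) (e := 1) (i := 4) (j := 7)
      (by decide)
    have h₂ := h.starHeavy hγ (a := 6) (b := 3) (c := 0) (d := 2) (e := 1) (i := 4) (j := 7)
      (by decide)
    exact h.star_conflict h₁ h₂ (b := 0) (by decide)
  · have h₁ := h.endHeavy hγ (a := 5) (b := 2) (c := 0) (d := 4) (e := 1) (i := 3) (j := 6)
      (by decide)
    have h₂ := h.endHeavy hγ (a := 6) (b := 3) (c := 0) (d := 2) (e := 1) (i := 4) (j := 7)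
      (by decide)
    have h₃ := h.endHeavy hγ (a := 7) (b := 4) (c := 0) (d := 3) (e := 1) (i := 2) (j := 5)
      (by decide)
    rcases h₁ with h₁ | h₁ <;> rcases h₂ with h₂ | h₂ <;> rcases h₃ with h₃ | h₃ <;>
      first
      | exact h.conflict h₁ h₂ (by decide)
      | exact h.conflict h₁ h₃ (by decide)
  · have four : ∀ a b : Fin 8, 2 ≤ a.val → a.val ≤ 4 → 2 ≤ b.val → b.val ≤ 4 → a ≠ b →
        ∀ x y : Fin 8, x.val + y.val = 1 →
        ¬ R.LongSeg (f x) (R.lab (f x) (f a)) (R.lab (f x) (f b)) := by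
      have hE : ∀ x a : Fin 8, x.val ≤ 1 → 2 ≤ a.val → a.val ≤ 4 →
          (x, a) ∈ [((0 : Fin 8), (2 : Fin 8)), (0, 3), (0, 4), (1, 2), (1, 3), (1, 4), (2, 5),
            (3, 6), (4, 7)] := by decide
      intro a b ha ha' hb hb' hab x y hxy hs
      have hx : x.val ≤ 1 := by omega
      have hy : y.val ≤ 1 := by omega
      have hne : x ≠ y := by rintro rfl; omega
      exact hs.false_of_fourCycle hγ (h.adj _ (hE x a hx ha ha')) (h.adj _ (hE y a hy ha ha')).symm
        (h.adj _ (hE y b hy hb hb')) (h.adj _ (hE x b hx hb hb')).symm (h.inj.ne hne)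
        (h.inj.ne hab)
    have h₁ := h.longSeg hγ (a := 5) (b := 2) (c := 0) (d := 3) (e := 1) (i := 4) (j := 7)
      (by decide)
    have h₂ := h.longSeg hγ (a := 6) (b := 3) (c := 0) (d := 2) (e := 1) (i := 4) (j := 7)
      (by decide)
    have k₁ : R.PendantHeavy (f 3) := by
      rcases h₁ with h₁ | h₁ | h₁
      · rw [R.lab_comm (h.adj_of (a := 2) (b := 0) (by decide))] at h₁
        exact absurd h₁ (four 2 3 (by decide) (by decide) (by decide) (by decide) (by decide) 0 1
          (by decide))
      · exact h₁.pendantHeavy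
      · rw [R.lab_comm (h.adj_of (a := 3) (b := 1) (by decide))] at h₁
        exact absurd h₁ (four 3 4 (by decide) (by decide) (by decide) (by decide) (by decide) 1 0
          (by decide))
    have k₂ : R.PendantHeavy (f 2) := by
      rcases h₂ with h₂ | h₂ | h₂
      · rw [R.lab_comm (h.adj_of (a := 3) (b := 0) (by decide))] at h₂
        exact absurd h₂ (four 3 2 (by decide) (by decide) (by decide) (by decide) (by decide) 0 1
          (by decide))
      · exact h₂.pendantHeavy
      · rw [R.lab_comm (h.adj_of (a := 2) (b := 1) (by decide))] at h₂
        exact absurd h₂ (four 2 4 (by decide) (by decide) (by decide) (by decide) (by decide) 1 0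
          (by decide))
    exact absurd (h.eq_of_pendantHeavy k₁ k₂) (by decide)

theorem twoShort_pathThree_false
    (hγ : PathHeavy G gamma1 ∨ PathHeavy G gamma2 ∨ PathHeavy G gamma3) {f : Fin 8 → W}
    (h : R.Copy [(0, 2), (2, 1), (0, 4), (4, 1), (2, 3), (4, 5), (0, 6), (6, 7), (7, 1)] f) :
    False := by
  rcases hγ with hγ | hγ | hγ
  · have h₁ := h.starHeavy hγ (a := 3) (b := 2) (c := 0) (d := 4) (e := 1) (i := 7) (j := 6)
      (by decide)
    have h₂ := h.starHeavy hγ (a := 5) (b := 4) (c := 0) (d := 2) (e := 1) (i := 7) (j := 6)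
      (by decide)
    exact h.star_conflict h₁ h₂ (b := 0) (by decide)
  · have key : ∀ f : Fin 8 → W,
        R.Copy [(0, 2), (2, 1), (0, 4), (4, 1), (2, 3), (4, 5), (0, 6), (6, 7), (7, 1)] f →
        ∃ i, (i = 0 ∨ i = 1) ∧ R.EndHeavy (f 3) (f 2) (f i) := by
      intro f h
      by_contra! hno
      have n₀ := hno 0 (by decide)
      have n₁ := hno 1 (by decide)
      have h₁ := (h.endHeavy hγ (a := 3) (b := 2) (c := 1) (d := 4) (e := 0) (i := 6) (j := 7)
        (by decide)).resolve_left n₁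
      have h₂ := (h.endHeavy hγ (a := 3) (b := 2) (c := 0) (d := 6) (e := 7) (i := 1) (j := 4)
        (by decide)).resolve_left n₀
      rcases h.endHeavy hγ (a := 2) (b := 0) (c := 6) (d := 7) (e := 1) (i := 4) (j := 5)
        (by decide) with h₃ | h₃
      · exact h.conflict h₃ h₂ (by decide)
      · exact h.conflict h₃ h₁ (by decide)
    obtain ⟨i, hi, h₁⟩ := key f h
    obtain ⟨j, hj, h₂⟩ := key _ (h.comp ![0, 1, 4, 5, 2, 3, 6, 7] (by decide) (by decide))
    change R.EndHeavy (f 5) (f 4) _ at h₂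
    rcases hi with rfl | rfl <;> rcases hj with rfl | rfl
    · exact h.conflict (c' := 0) h₁ h₂ (by decide)
    · exact h.conflict (c' := 1) h₁ h₂ (by decide)
    · exact h.conflict (c' := 0) h₁ h₂ (by decide)
    · exact h.conflict (c' := 1) h₁ h₂ (by decide)
  · have h₁ := h.pendantHeavy hγ (a := 3) (b := 2) (c := 0) (d := 4) (e := 1) (i := 7) (j := 6)
      (by decide)
    have h₂ := h.pendantHeavy hγ (a := 5) (b := 4) (c := 0) (d := 2) (e := 1) (i := 7) (j := 6)
      (by decide)
    have h₃ := h.pendantHeavy hγ (a := 3) (b := 2) (c := 0) (d := 6) (e := 7) (i := 1) (j := 4)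
      (by decide)
    have h₄ := h.pendantHeavy hγ (a := 2) (b := 0) (c := 6) (d := 7) (e := 1) (i := 4) (j := 5)
      (by decide)
    rcases h₁ with h₁ | h₁ | h₁ <;> rcases h₂ with h₂ | h₂ | h₂ <;>
      rcases h₃ with h₃ | h₃ | h₃ <;> rcases h₄ with h₄ | h₄ | h₄ <;>
      first
      | exact absurd (h.eq_of_pendantHeavy h₁ h₂) (by decide)
      | exact absurd (h.eq_of_pendantHeavy h₁ h₃) (by decide)
      | exact absurd (h.eq_of_pendantHeavy h₁ h₄) (by decide)

/-- A `6`-cycle through the common neighbour of `u` and `v` on one side. -/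
theorem exists_endHeavy_of_pathFour (hγ : PathHeavy G gamma2) {f : Fin 7 → W}
    (h : R.Copy [(0, 2), (2, 1), (2, 3), (0, 4), (4, 5), (5, 6), (6, 1)] f) :
    R.EndHeavy (f 3) (f 2) (f 0) ∨ R.EndHeavy (f 3) (f 2) (f 1) := by
  by_contra! hno
  have h₁ := (h.endHeavy hγ (a := 3) (b := 2) (c := 0) (d := 4) (e := 5) (i := 6) (j := 1)
    (by decide)).resolve_left hno.1
  have h₂ := (h.endHeavy hγ (a := 3) (b := 2) (c := 1) (d := 6) (e := 5) (i := 4) (j := 0)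
    (by decide)).resolve_left hno.2
  exact h.conflict h₁ h₂ (by decide)

theorem twoShort_pathFour_false
    (hγ : PathHeavy G gamma1 ∨ PathHeavy G gamma2 ∨ PathHeavy G gamma3) {f : Fin 9 → W}
    (h : R.Copy [(0, 2), (2, 1), (0, 4), (4, 1), (2, 3), (4, 5), (0, 6), (6, 7), (7, 8),
      (8, 1)] f) : False := by
  by_cases h2 : PathHeavy G gamma2
  · have h₁ := exists_endHeavy_of_pathFour h2
      (h.comp ![0, 1, 2, 3, 6, 7, 8] (by decide) (by decide))
    have h₂ := exists_endHeavy_of_pathFour h2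
      (h.comp ![0, 1, 4, 5, 6, 7, 8] (by decide) (by decide))
    change R.EndHeavy (f 3) (f 2) (f 0) ∨ R.EndHeavy (f 3) (f 2) (f 1) at h₁
    change R.EndHeavy (f 5) (f 4) (f 0) ∨ R.EndHeavy (f 5) (f 4) (f 1) at h₂
    rcases h₁ with h₁ | h₁ <;> rcases h₂ with h₂ | h₂ <;> exact h.conflict h₁ h₂ (by decide)
  · exact sixCycle_false (by tauto) (h.comp ![2, 0, 6, 7, 8, 1, 3] (by decide) (by decide))

theorem threePathThree_false
    (hγ : PathHeavy G gamma1 ∨ PathHeavy G gamma2 ∨ PathHeavy G gamma3) {f : Fin 8 → W}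
    (h : R.Copy [(0, 2), (2, 3), (3, 1), (0, 4), (4, 5), (5, 1), (0, 6), (6, 7), (7, 1)] f) :
    False := by
  by_cases h2 : PathHeavy G gamma2
  · have h₁ := h.endHeavy h2 (a := 2) (b := 0) (c := 4) (d := 5) (e := 1) (i := 7) (j := 6)
      (by decide)
    have h₂ := h.endHeavy h2 (a := 2) (b := 0) (c := 6) (d := 7) (e := 1) (i := 5) (j := 4)
      (by decide)
    have h₃ := h.endHeavy h2 (a := 3) (b := 1) (c := 5) (d := 4) (e := 0) (i := 6) (j := 7)
      (by decide)
    have h₄ := h.endHeavy h2 (a := 3) (b := 1) (c := 7) (d := 6) (e := 0) (i := 4) (j := 5)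
      (by decide)
    rcases h₁ with h₁ | h₁ <;> rcases h₂ with h₂ | h₂ <;> rcases h₃ with h₃ | h₃ <;>
      rcases h₄ with h₄ | h₄ <;>
      first
      | exact h.conflict h₁ h₂ (by decide)
      | exact h.conflict h₁ h₃ (by decide)
      | exact h.conflict h₁ h₄ (by decide)
      | exact h.conflict h₂ h₃ (by decide)
      | exact h.conflict h₂ h₄ (by decide)
      | exact h.conflict h₃ h₄ (by decide)
  · exact sixCycle_false (by tauto) (h.comp ![0, 4, 5, 1, 3, 2, 6] (by decide) (by decide))

theorem short_twoPathThree_false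
    (hγ : PathHeavy G gamma1 ∨ PathHeavy G gamma2 ∨ PathHeavy G gamma3) {f : Fin 8 → W}
    (h : R.Copy [(0, 2), (2, 1), (2, 3), (0, 4), (4, 5), (5, 1), (0, 6), (6, 7), (7, 1)] f) :
    False := by
  by_cases h2 : PathHeavy G gamma2
  · have h₁ := h.endHeavy h2 (a := 5) (b := 4) (c := 0) (d := 2) (e := 1) (i := 7) (j := 6)
      (by decide)
    have h₂ := h.endHeavy h2 (a := 3) (b := 2) (c := 0) (d := 4) (e := 5) (i := 1) (j := 7)
      (by decide)
    have h₃ := h.endHeavy h2 (a := 3) (b := 2) (c := 1) (d := 5) (e := 4) (i := 0) (j := 6)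
      (by decide)
    rcases h₁ with h₁ | h₁ <;> rcases h₂ with h₂ | h₂ <;> rcases h₃ with h₃ | h₃ <;>
      first
      | exact h.conflict h₁ h₂ (by decide)
      | exact h.conflict h₁ h₃ (by decide)
      | exact h.conflict h₂ h₃ (by decide)
  · exact sixCycle_false (by tauto) (h.comp ![0, 4, 5, 1, 7, 6, 2] (by decide) (by decide))

end Rep

namespace Rep

variable {V W : Type*} {G : SimpleGraph V} {R : Rep G W} [Finite V]

theorem longCycle_false
    (hγ : PathHeavy G gamma1 ∨ PathHeavy G gamma2 ∨ PathHeavy G gamma3) {n : ℕ} (hn : 7 ≤ n)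
    (c : ℕ → W) (hadj : ∀ i, R.H.Adj (c i) (c (i + 1)))
    (hne : ∀ i j, i < j → j < i + n → c i ≠ c j) : False := by
  have chain : ∀ i, [c i, c (i + 1), c (i + 2), c (i + 3), c (i + 4), c (i + 5),
      c (i + 6)].IsChain R.H.Adj := fun i => by simp [hadj]
  have nodup : ∀ i, [c i, c (i + 1), c (i + 2), c (i + 3), c (i + 4), c (i + 5),
      c (i + 6)].Nodup := fun i => by
    simp only [List.nodup_cons, List.mem_cons, List.not_mem_nil, or_false, not_or,
      List.nodup_nil, not_false_eq_true, and_true]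
    refine ⟨⟨?_, ?_, ?_, ?_, ?_, ?_⟩, ⟨?_, ?_, ?_, ?_, ?_⟩, ⟨?_, ?_, ?_, ?_⟩, ⟨?_, ?_, ?_⟩,
      ⟨?_, ?_⟩, ?_⟩ <;> exact hne _ _ (by omega) (by omega)
  rcases hγ with hγ | hγ | hγ
  · have h₁ := starHeavy_of_path (chain 0) (nodup 0) hγ
    have h₂ := starHeavy_of_path (chain 2) (nodup 2) hγ
    exact R.tri _ _ _ (hadj (0 + 3)) (hadj (0 + 4))
      (h₁.adj h₂ (hne _ _ (by omega) (by omega))).symm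
  · let heavy : ℕ → Prop := fun i =>
      R.EndHeavy (c i) (c (i + 1)) (c (i + 2)) ∨ R.EndHeavy (c (i + 2)) (c (i + 1)) (c i)
    have window : ∀ i, heavy i ∨ heavy (i + 4) := fun i =>
      (endHeavy_of_path (chain i) (nodup i) hγ).imp Or.inl Or.inr
    have conflict : ∀ i, heavy i → ¬ heavy (i + 3) := by
      intro i h₁ h₂
      rcases h₁ with h₁ | h₁ <;> rcases h₂ with h₂ | h₂ <;>
        apply h₁.conflict h₂ <;>
        exact hne _ _ (by omega) (by omega)
    have back : ∀ i, heavy (i + 1) → heavy i := fun i h =>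
      (window i).resolve_right fun h' => conflict (i + 1) h h'
    rcases window 4 with h | h
    · exact conflict 1 (back _ (back _ (back _ h))) h
    · exact conflict 5 (back _ (back _ (back _ h))) h
  · have h₁ := pendantHeavy_of_path (chain 0) (nodup 0) hγ
    have h₂ := pendantHeavy_of_path (chain 3) (nodup 3) hγ
    rcases h₁ with h₁ | h₁ | h₁ <;> rcases h₂ with h₂ | h₂ | h₂ <;>
      exact hne _ _ (by omega) (by omega) (h₁.unique h₂)

theorem longCycle_list_false
    (hγ : PathHeavy G gamma1 ∨ PathHeavy G gamma2 ∨ PathHeavy G gamma3) {a b : W} {l : List W}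
    (hl : 5 ≤ l.length) (hn : (a :: (l ++ [b])).Nodup)
    (hc : (a :: (l ++ [b])).IsChain R.H.Adj) (hab : R.H.Adj b a) : False := by
  set m := a :: (l ++ [b]) with hm
  have hlen : m.length = l.length + 2 := by simp [hm]
  have hpos : 0 < m.length := by omega
  refine longCycle_false (R := R) hγ (n := m.length) (by omega)
    (fun i => m[i % m.length]'(Nat.mod_lt _ hpos)) (fun i => ?_) fun i j hij hj h => ?_
  · have hlt := Nat.mod_lt i hpos
    by_cases h : i % m.length + 1 < m.length
    · have : (i + 1) % m.length = i % m.length + 1 := by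
        rw [Nat.add_mod, Nat.mod_eq_of_lt (a := 1) (by omega), Nat.mod_eq_of_lt h]
      simp only [this]
      exact List.isChain_iff_getElem.1 hc _ h
    · have h1 : (i + 1) % m.length = 0 := by
        rw [Nat.add_mod, Nat.mod_eq_of_lt (a := 1) (by omega),
          show i % m.length + 1 = m.length by omega, Nat.mod_self]
      have h2 : i % m.length = l.length + 1 := by omega
      simp only [h1, h2]
      simpa [hm] using hab
  · have := (List.Nodup.getElem_inj_iff hn).1 h
    have h3 : m.length ∣ j - i := (Nat.modEq_iff_dvd' hij.le).1 this
    exact absurd (Nat.le_of_dvd (by omega) h3) (by omega)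

/-- The edges of the walk with vertex list `l`. -/
def listEdges : List W → List (Sym2 W)
  | a :: b :: l => s(a, b) :: listEdges (b :: l)
  | _ => []

/-- Three branches with interiors `l₀`, `l₁`, `l₂` between `u` and `v`. The first is disjoint from
the other two, which are edge-disjoint. A branch with a single interior vertex carries a further
neighbour of that vertex. -/
structure Theta (R : Rep G W) (u v : W) (l₀ l₁ l₂ : List W) (t₀ t₁ t₂ : W) : Prop where
  chain₀ : (u :: (l₀ ++ [v])).IsChain R.H.Adj
  chain₁ : (u :: (l₁ ++ [v])).IsChain R.H.Adj
  chain₂ : (u :: (l₂ ++ [v])).IsChain R.H.Adj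
  nodup₀ : (u :: (l₀ ++ [v])).Nodup
  nodup₁ : (u :: (l₁ ++ [v])).Nodup
  nodup₂ : (u :: (l₂ ++ [v])).Nodup
  ne_nil₀ : l₀ ≠ []
  ne_nil₁ : l₁ ≠ []
  ne_nil₂ : l₂ ≠ []
  disj₁ : ∀ x ∈ l₀, x ∉ l₁
  disj₂ : ∀ x ∈ l₀, x ∉ l₂
  edge : ∀ e ∈ listEdges (u :: (l₁ ++ [v])), e ∉ listEdges (u :: (l₂ ++ [v]))
  pend₀ : l₀.length = 1 →
    (∀ w ∈ l₀, R.H.Adj w t₀) ∧ t₀ ≠ u ∧ t₀ ≠ v ∧ t₀ ∉ l₁ ∧ t₀ ∉ l₂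
  pend₁ : l₁.length = 1 →
    (∀ w ∈ l₁, R.H.Adj w t₁) ∧ t₁ ≠ u ∧ t₁ ≠ v ∧ t₁ ∉ l₀ ∧ t₁ ∉ l₂
  pend₂ : l₂.length = 1 →
    (∀ w ∈ l₂, R.H.Adj w t₂) ∧ t₂ ≠ u ∧ t₂ ≠ v ∧ t₂ ∉ l₀ ∧ t₂ ∉ l₁
  pend_ne₀₁ : l₀.length = 1 → l₁.length = 1 → t₀ ≠ t₁
  pend_ne₀₂ : l₀.length = 1 → l₂.length = 1 → t₀ ≠ t₂
  pend_ne₁₂ : l₁.length = 1 → l₂.length = 1 → t₁ ≠ t₂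
  short₁ : l₁.length = 1 → ∀ w ∈ l₁, w ∉ l₂
  short₂ : l₂.length = 1 → ∀ w ∈ l₂, w ∉ l₁

variable {u v t₀ t₁ t₂ : W} {l₀ l₁ l₂ : List W}

omit [Finite V] in
theorem Theta.symm (h : R.Theta u v l₀ l₁ l₂ t₀ t₁ t₂) : R.Theta u v l₀ l₂ l₁ t₀ t₂ t₁ where
  chain₀ := h.chain₀
  chain₁ := h.chain₂
  chain₂ := h.chain₁
  nodup₀ := h.nodup₀
  nodup₁ := h.nodup₂
  nodup₂ := h.nodup₁
  ne_nil₀ := h.ne_nil₀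
  ne_nil₁ := h.ne_nil₂
  ne_nil₂ := h.ne_nil₁
  disj₁ := h.disj₂
  disj₂ := h.disj₁
  edge := fun e h₂ h₁ => h.edge e h₁ h₂
  pend₀ := fun h' => by have := h.pend₀ h'; tauto
  pend₁ := h.pend₂
  pend₂ := h.pend₁
  pend_ne₀₁ := h.pend_ne₀₂
  pend_ne₀₂ := h.pend_ne₀₁
  pend_ne₁₂ := fun a b => (h.pend_ne₁₂ b a).symm
  short₁ := h.short₂
  short₂ := h.short₁

theorem length_add_length_le
    (hγ : PathHeavy G gamma1 ∨ PathHeavy G gamma2 ∨ PathHeavy G gamma3)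
    (hc₀ : (u :: (l₀ ++ [v])).IsChain R.H.Adj) (hc₁ : (u :: (l₁ ++ [v])).IsChain R.H.Adj)
    (hn₀ : (u :: (l₀ ++ [v])).Nodup) (hn₁ : (u :: (l₁ ++ [v])).Nodup) (h₁ : l₁ ≠ [])
    (hd : ∀ x ∈ l₀, x ∉ l₁) : l₀.length + l₁.length ≤ 4 := by
  obtain ⟨w, q, rfl⟩ := List.exists_cons_of_ne_nil h₁
  by_contra! hlt
  have hlist : u :: (l₀ ++ v :: q.reverse ++ [w]) = (u :: (l₀ ++ [v])) ++ (w :: q).reverse := by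
    simp
  refine longCycle_list_false (R := R) hγ (a := u) (b := w) (l := l₀ ++ v :: q.reverse) ?_ ?_ ?_ ?_
  · simp at hlt ⊢; omega
  · rw [hlist, List.nodup_append]
    refine ⟨hn₀, ?_, ?_⟩
    · rw [List.nodup_reverse]
      exact (List.nodup_append.1 (List.nodup_cons.1 hn₁).2).1
    · simp at hn₁ hd ⊢
      grind
  · rw [hlist, List.isChain_append]
    refine ⟨hc₀, ?_, ?_⟩
    · rw [List.isChain_reverse]
      have := (List.isChain_cons.1 hc₁).2
      rw [List.isChain_append] at this
      exact this.1.imp fun _ _ h => h.symm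
    · rw [← List.cons_append, List.isChain_append] at hc₁
      intro x hx y hy
      have := hc₁.2.2 y (by simpa [List.getLast?_cons] using hy) v (by simp)
      rw [← List.cons_append, List.getLast?_append] at hx
      simp at hx
      exact hx ▸ this.symm
  · exact ((List.isChain_cons.1 hc₁).1 w (by simp)).symm

theorem Theta.short_pathFour_pathFour
    (hγ : PathHeavy G gamma1 ∨ PathHeavy G gamma2 ∨ PathHeavy G gamma3) {a d e f i j k : W}
    (h : R.Theta u v [a] [d, e, f] [i, j, k] t₀ t₁ t₂) : False := by
  obtain ⟨c₀, c₁, c₂, n₀, n₁, n₂, -, -, -, d₁, d₂, he, q₀, -⟩ := h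
  simp [listEdges] at c₀ c₁ c₂ n₀ n₁ n₂ d₁ d₂ he q₀
  have ek : e ≠ k := by
    rintro rfl
    exact R.tri _ _ _ c₁.2.2.1 c₁.2.2.2 c₂.2.2.2.symm
  have dj : d ≠ j := by
    rintro rfl
    exact R.tri _ _ _ c₂.1 c₂.2.1 c₁.1.symm
  have fj : f ≠ j := by
    rintro rfl
    exact R.tri _ _ _ c₂.2.2.1 c₂.2.2.2 c₁.2.2.2.symm
  have ei : e ≠ i := by
    rintro rfl
    exact R.tri _ _ _ c₁.1 c₁.2.1 c₂.1.symm
  by_cases h2 : PathHeavy G gamma2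
  · obtain ⟨c, hc, h₁⟩ : ∃ c, (c = u ∨ c = v) ∧ R.EndHeavy t₀ a c := by
      have hn : [u, v, a, t₀, d, e, f].Nodup := by simp; grind [SimpleGraph.Adj.ne]
      have := exists_endHeavy_of_pathFour (R := R) h2 (f := [u, v, a, t₀, d, e, f].get)
        (.of_list hn (by simp; grind [SimpleGraph.Adj.symm]))
      exact this.elim (fun h => ⟨u, .inl rfl, h⟩) fun h => ⟨v, .inr rfl, h⟩
    have path : ∀ x₁ x₂ x₃ x₄ x₅ x₆ x₇, [x₁, x₂, x₃, x₄, x₅, x₆, x₇].IsChain R.H.Adj →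
        [x₁, x₂, x₃, x₄, x₅, x₆, x₇].Nodup → R.EndHeavy x₁ x₂ x₃ ∨ R.EndHeavy x₇ x₆ x₅ :=
      fun _ _ _ _ _ _ _ hp hn => endHeavy_of_path hp hn h2
    by_cases hej : e = j
    · subst hej
      have h₂ : R.EndHeavy f v a := by
        refine (path i e d u a v f (by simp; grind [SimpleGraph.Adj.symm])
          (by simp; grind)).resolve_left fun h₂ => ?_
        apply h₁.conflict h₂ <;> grind [SimpleGraph.Adj.ne]
      have h₃ : R.EndHeavy d u a := by
        refine (path k e f v a u d (by simp; grind [SimpleGraph.Adj.symm])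
          (by simp; grind)).resolve_left fun h₂ => ?_
        apply h₁.conflict h₂ <;> grind [SimpleGraph.Adj.ne]
      apply h₂.conflict h₃ <;> grind
    · by_cases hdk : d = k
      · by_cases hif : i = f
        · subst hdk hif
          rcases path e d u a v i j (by simp; grind [SimpleGraph.Adj.symm])
            (by simp; grind) with h₂ | h₂ <;>
            apply h₁.conflict h₂ <;> grind [SimpleGraph.Adj.ne]
        · rcases path j i u a v f e (by simp; grind [SimpleGraph.Adj.symm])
            (by simp; grind) with h₂ | h₂ <;>
            apply h₁.conflict h₂ <;> grind [SimpleGraph.Adj.ne]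
      · rcases path e d u a v k j (by simp; grind [SimpleGraph.Adj.symm])
          (by simp; grind) with h₂ | h₂ <;>
          apply h₁.conflict h₂ <;> grind [SimpleGraph.Adj.ne]
  · have hn : [a, u, d, e, f, v, t₀].Nodup := by simp; grind [SimpleGraph.Adj.ne]
    have hγ' : PathHeavy G gamma1 ∨ PathHeavy G gamma3 :=
      hγ.imp_right fun h => h.resolve_left h2
    exact sixCycle_false (R := R) hγ' (f := [a, u, d, e, f, v, t₀].get)
      (.of_list hn (by simp; grind [SimpleGraph.Adj.symm]))

theorem Theta.false
    (hγ : PathHeavy G gamma1 ∨ PathHeavy G gamma2 ∨ PathHeavy G gamma3)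
    (h : R.Theta u v l₀ l₁ l₂ t₀ t₁ t₂) : False := by
  wlog hle : l₁.length ≤ l₂.length generalizing l₁ l₂ t₁ t₂
  · exact this h.symm (by omega)
  have b₁ := length_add_length_le hγ h.chain₀ h.chain₁ h.nodup₀ h.nodup₁ h.ne_nil₁ h.disj₁
  have b₂ := length_add_length_le hγ h.chain₀ h.chain₂ h.nodup₀ h.nodup₂ h.ne_nil₂ h.disj₂
  have p₀ := List.length_pos_of_ne_nil h.ne_nil₀
  have p₁ := List.length_pos_of_ne_nil h.ne_nil₁
  have p₂ := List.length_pos_of_ne_nil h.ne_nil₂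
  have cases : ∀ l : List W, 0 < l.length → l.length ≤ 3 →
      (∃ a, l = [a]) ∨ (∃ a b, l = [a, b]) ∨ ∃ a b c, l = [a, b, c] := by
    intro l h1 h2
    match l with
    | [a] => exact .inl ⟨a, rfl⟩
    | [a, b] => exact .inr (.inl ⟨a, b, rfl⟩)
    | [a, b, c] => exact .inr (.inr ⟨a, b, c, rfl⟩)
    | [] => simp at h1
    | _ :: _ :: _ :: _ :: _ => simp at h2; omega
  have b₃ : (∀ x ∈ l₁, x ∉ l₂) → l₁.length + l₂.length ≤ 4 :=
    length_add_length_le hγ h.chain₁ h.chain₂ h.nodup₁ h.nodup₂ h.ne_nil₂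
  obtain ⟨c₀, c₁, c₂, n₀, n₁, n₂, -, -, -, d₁, d₂, he, q₀, q₁, q₂, pn₀₁, pn₀₂, pn₁₂, s₁, s₂⟩ :=
    id h
  rcases cases l₀ p₀ (by omega) with ⟨a, rfl⟩ | ⟨a, b, rfl⟩ | ⟨a, b, c, rfl⟩ <;>
    rcases cases l₁ p₁ (by omega) with ⟨d, rfl⟩ | ⟨d, e, rfl⟩ | ⟨d, e, f, rfl⟩ <;>
    rcases cases l₂ p₂ (by omega) with ⟨i, rfl⟩ | ⟨i, j, rfl⟩ | ⟨i, j, k, rfl⟩ <;>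
    simp only [List.length_cons, List.length_nil, Nat.reduceAdd, Nat.reduceLeDiff] at b₁ b₂ hle <;>
    simp [listEdges] at c₀ c₁ c₂ n₀ n₁ n₂ d₁ d₂ he q₀ q₁ q₂ pn₀₁ pn₀₂ pn₁₂ s₁ s₂
  · have hn : [u, v, a, d, i, t₀, t₁, t₂].Nodup := by simp; grind [SimpleGraph.Adj.ne]
    exact threeShort_false (R := R) hγ (f := [u, v, a, d, i, t₀, t₁, t₂].get)
      (.of_list hn (by simp; grind [SimpleGraph.Adj.symm]))
  · have hn : [u, v, a, t₀, d, t₁, i, j].Nodup := by simp; grind [SimpleGraph.Adj.ne]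
    exact twoShort_pathThree_false (R := R) hγ (f := [u, v, a, t₀, d, t₁, i, j].get)
      (.of_list hn (by simp; grind [SimpleGraph.Adj.symm]))
  · have hn : [u, v, a, t₀, d, t₁, i, j, k].Nodup := by simp; grind [SimpleGraph.Adj.ne]
    exact twoShort_pathFour_false (R := R) hγ (f := [u, v, a, t₀, d, t₁, i, j, k].get)
      (.of_list hn (by simp; grind [SimpleGraph.Adj.symm]))
  · have : d ≠ j := by
      rintro rfl
      exact R.tri _ _ _ c₂.1 c₂.2.1 c₁.1.symm
    have : e ≠ i := by
      rintro rfl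
      exact R.tri _ _ _ c₁.1 c₁.2.1 c₂.1.symm
    have hn : [u, v, a, t₀, d, e, i, j].Nodup := by simp; grind [SimpleGraph.Adj.ne]
    exact short_twoPathThree_false (R := R) hγ (f := [u, v, a, t₀, d, e, i, j].get)
      (.of_list hn (by simp; grind [SimpleGraph.Adj.symm]))
  · have : d ≠ j := by
      rintro rfl
      exact R.tri _ _ _ c₂.1 c₂.2.1 c₁.1.symm
    have : d ≠ k := by
      rintro rfl
      exact R.tri _ _ _ c₁.2.1 c₁.2.2 c₂.2.2.2.symm
    have : e ≠ i := by
      rintro rfl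
      exact R.tri _ _ _ c₁.1 c₁.2.1 c₂.1.symm
    have : e ≠ j := by
      rintro rfl
      exact R.tri _ _ _ c₂.2.2.1 c₂.2.2.2 c₁.2.2.symm
    have := b₃ (by simp; grind)
    simp at this
  · exact h.short_pathFour_pathFour hγ
  · have hn : [u, v, d, t₁, i, t₂, a, b].Nodup := by simp; grind [SimpleGraph.Adj.ne]
    exact twoShort_pathThree_false (R := R) hγ (f := [u, v, d, t₁, i, t₂, a, b].get)
      (.of_list hn (by simp; grind [SimpleGraph.Adj.symm]))
  · have hn : [u, v, d, t₁, a, b, i, j].Nodup := by simp; grind [SimpleGraph.Adj.ne]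
    exact short_twoPathThree_false (R := R) hγ (f := [u, v, d, t₁, a, b, i, j].get)
      (.of_list hn (by simp; grind [SimpleGraph.Adj.symm]))
  · have : d ≠ j := by
      rintro rfl
      exact R.tri _ _ _ c₂.1 c₂.2.1 c₁.1.symm
    have : e ≠ i := by
      rintro rfl
      exact R.tri _ _ _ c₁.1 c₁.2.1 c₂.1.symm
    have hn : [u, v, a, b, d, e, i, j].Nodup := by simp; grind [SimpleGraph.Adj.ne]
    exact threePathThree_false (R := R) hγ (f := [u, v, a, b, d, e, i, j].get)
      (.of_list hn (by simp; grind [SimpleGraph.Adj.symm]))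
  · have hn : [u, v, d, t₁, i, t₂, a, b, c].Nodup := by simp; grind [SimpleGraph.Adj.ne]
    exact twoShort_pathFour_false (R := R) hγ (f := [u, v, d, t₁, i, t₂, a, b, c].get)
      (.of_list hn (by simp; grind [SimpleGraph.Adj.symm]))

end Rep

theorem link_of_isChain {V : Type*} {G : SimpleGraph V} :
    ∀ {l : List V} {a b : V}, l.IsChain G.Adj → l.head? = some a → l.getLast? = some b →
      Link G a b l
  | [], _, _, _, h, _ => by simp at h
  | [x], a, b, _, h, h' => by
    simp at h h'
    subst h h'
    exact .single _
  | x :: y :: l, a, b, hc, h, h' => by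
    simp only [List.head?_cons, Option.some.injEq] at h
    subst h
    rw [List.isChain_cons_cons] at hc
    exact .cons hc.1 (link_of_isChain hc.2 rfl (by simpa using h'))

namespace Rep

variable {V W : Type*} {G : SimpleGraph V} {R : Rep G W}

theorem exists_list_of_trail {a b : W} (p : R.H.Walk a b) (hp : p.edges.Nodup) (S : Finset V)
    (hS : ∀ q ∈ S, R.ends q ∉ p.edges ∧ ∃ y ∈ p.support.dropLast, y ∈ R.ends q) :
    ∃ l : List V, l.Nodup ∧ (∀ q, q ∈ l ↔ q ∈ S ∨ R.ends q ∈ p.edges) ∧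
      l.IsChain (shareGraph R.ends).Adj ∧ (∀ q ∈ l.head?, a ∈ R.ends q) ∧
      ∀ q ∈ l.getLast?, b ∈ R.ends q := by
  classical
  induction p generalizing S with
  | nil =>
    refine ⟨[], List.nodup_nil, fun q => ?_, List.isChain_nil, by simp, by simp⟩
    simp only [List.not_mem_nil, Walk.edges_nil, or_false, false_iff]
    intro hq
    simpa using (hS q hq).2
  | @cons a c b hac p ih =>
    rw [Walk.edges_cons, List.nodup_cons] at hp
    obtain ⟨l, hl, hmem, hch, hhd, hlast⟩ := ih hp.2 (S.filter fun q => a ∉ R.ends q) (by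
      intro q hq
      rw [Finset.mem_filter] at hq
      obtain ⟨h1, y, hy, hyq⟩ := hS q hq.1
      rw [Walk.edges_cons, List.mem_cons, not_or] at h1
      refine ⟨h1.2, y, ?_, hyq⟩
      rw [Walk.support_cons, List.dropLast_cons_of_ne_nil p.support_ne_nil, List.mem_cons] at hy
      rcases hy with rfl | hy
      · exact absurd hyq hq.2
      · exact hy)
    set m := (S.filter fun q => a ∈ R.ends q).toList with hm
    have hlab : R.ends (R.lab a c) = s(a, c) := R.ends_lab _ _ hac
    have hmm : ∀ q, q ∈ m ↔ q ∈ S ∧ a ∈ R.ends q := by simp [hm]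
    have hlm : R.lab a c ∉ m := fun h =>
      (hS _ ((hmm _).1 h).1).1 (by rw [hlab]; simp)
    have hll : R.lab a c ∉ l := by
      intro h
      rcases (hmem _).1 h with h | h
      · rw [Finset.mem_filter] at h
        exact h.2 (by rw [hlab]; simp)
      · rw [hlab] at h
        exact hp.1 h
    have hdisj : ∀ q ∈ m, q ∉ l := by
      intro q hq hql
      rw [hmm] at hq
      rcases (hmem _).1 hql with h | h
      · rw [Finset.mem_filter] at h
        exact h.2 hq.2
      · exact (hS q hq.1).1 (by simp [h])
    have hml : m.Nodup := Finset.nodup_toList _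
    refine ⟨m ++ R.lab a c :: l, ?_, fun q => ?_, ?_, ?_, ?_⟩
    · rw [List.nodup_append]
      refine ⟨hml, List.nodup_cons.2 ⟨hll, hl⟩, ?_⟩
      grind
    · rw [List.mem_append, List.mem_cons, hmem, hmm, Finset.mem_filter, Walk.edges_cons,
        List.mem_cons]
      have : R.ends q = s(a, c) ↔ q = R.lab a c := by rw [← hlab, R.ends_inj.eq_iff]
      rw [this]
      tauto
    · rw [List.isChain_append]
      refine ⟨?_, ?_, ?_⟩
      · refine List.Pairwise.isChain ?_
        refine hml.imp_of_mem fun h1 h2 hne => ⟨hne, a, ((hmm _).1 h1).2, ((hmm _).1 h2).2⟩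
      · rw [List.isChain_cons]
        refine ⟨fun q hq => ⟨?_, c, by rw [hlab]; simp, hhd q hq⟩, hch⟩
        rintro rfl
        exact hll (List.mem_of_mem_head? hq)
      · intro q hq r hr
        have hqm := List.mem_of_getLast? hq
        simp only [List.head?_cons, Option.mem_def, Option.some.injEq] at hr
        subst hr
        exact ⟨fun h => hlm (h ▸ hqm), a, ((hmm _).1 hqm).2, by rw [hlab]; simp⟩
    · intro q hq
      rw [List.head?_append] at hq
      rcases h : m.head? with _ | r
      · rw [h] at hq
        simp at hq
        subst hq
        rw [hlab]; simp
      · rw [h] at hq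
        simp at hq
        subst hq
        exact ((hmm _).1 (List.mem_of_mem_head? h)).2
    · intro q hq
      rw [List.getLast?_append, List.getLast?_cons] at hq
      simp only [Option.some_or, Option.mem_def, Option.some.injEq] at hq
      rcases h : l.getLast? with _ | r
      · rw [h] at hq
        simp at hq
        have hnil : l = [] := by simpa using h
        have : p.edges = [] := by
          rw [List.eq_nil_iff_forall_not_mem]
          intro e he
          have hE := p.edges_subset_edgeSet he
          induction e with
          | _ x y =>
            have := (hmem (R.lab x y)).2 (.inr (by rw [R.ends_lab _ _ hE]; exact he))
            rw [hnil] at this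
            simp at this
        have hcb : c = b := by
          cases p with
          | nil => rfl
          | cons _ _ => simp at this
        subst hq
        rw [hlab, ← hcb]; simp
      · rw [h] at hq
        simp at hq
        subst hq
        exact hlast _ h

/-- The elements with an end on the walk `p`. -/
def dom (R : Rep G W) {a b : W} (p : R.H.Walk a b) : Set V :=
  {q | ∃ y ∈ p.support, y ∈ R.ends q}

theorem exists_not_mem_dom [Finite V] (hn : 3 ≤ Nat.card V) {x : W} (T : R.H.Walk x x)
    (hT : T.IsTrail) : ∃ q, q ∉ R.dom T := by
  classical
  by_contra! hall
  have := Fintype.ofFinite V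
  obtain ⟨l, hl, hmem, hch, hhd, hlast⟩ : ∃ l : List V, l.Nodup ∧ (∀ q, q ∈ l) ∧
      l.IsChain (shareGraph R.ends).Adj ∧ (∀ q ∈ l.head?, x ∈ R.ends q) ∧
      ∀ q ∈ l.getLast?, x ∈ R.ends q := by
    by_cases hnil : T.Nil
    · have hx : ∀ q, x ∈ R.ends q := by
        intro q
        obtain ⟨y, hy, hyq⟩ := hall q
        rw [Walk.nil_iff_support_eq.1 hnil] at hy
        simp at hy
        exact hy ▸ hyq
      refine ⟨Finset.univ.toList, Finset.nodup_toList _, by simp, List.Pairwise.isChain ?_,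
        fun q _ => hx q, fun q _ => hx q⟩
      exact (Finset.nodup_toList _).imp fun hne => ⟨hne, x, hx _, hx _⟩
    · obtain ⟨l, h1, h2, h3⟩ := exists_list_of_trail T hT.edges_nodup
        (Finset.univ.filter fun q => R.ends q ∉ T.edges) (by
          intro q hq
          obtain ⟨y, hy, hyq⟩ := hall q
          refine ⟨(Finset.mem_filter.1 hq).2, y, ?_, hyq⟩
          rw [← T.dropLast_support_concat, List.mem_append] at hy
          rcases hy with hy | hy
          · exact hy
          · simp at hy
            subst hy
            cases T with
            | nil => exact absurd Walk.Nil.nil hnil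
            | cons h p => simp [List.dropLast_cons_of_ne_nil p.support_ne_nil])
      refine ⟨l, h1, fun q => (h2 q).2 ?_, h3⟩
      by_cases hq : R.ends q ∈ T.edges
      · exact .inr hq
      · exact .inl (by simp [hq])
  have hlen : Nat.card V ≤ l.length := by
    rw [Nat.card_eq_fintype_card, ← Finset.card_univ]
    calc _ ≤ l.toFinset.card := Finset.card_le_card fun q _ => by simp [hmem]
      _ ≤ _ := l.toFinset_card_le
  obtain ⟨q, q', m, rfl⟩ : ∃ q q' m, l = q :: q' :: m := by
    match l with
    | q :: q' :: m => exact ⟨q, q', m, rfl⟩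
    | [] => simp only [List.length_nil] at hlen; omega
    | [_] => simp only [List.length_cons, List.length_nil] at hlen; omega
  obtain ⟨r, hr⟩ : ∃ r, (q :: q' :: m).getLast? = some r :=
    ⟨_, List.getLast?_eq_some_getLast (by simp)⟩
  refine R.not_ham ⟨q, r, _, ⟨link_of_isChain hch rfl hr, hl, hmem⟩, ?_, x, hlast r hr,
    hhd q rfl⟩
  rintro rfl
  rw [List.getLast?_cons_cons] at hr
  exact (List.nodup_cons.1 hl).1 (List.mem_of_getLast? hr)

end Rep

namespace Rep

variable {V W : Type*} {G : SimpleGraph V} {R : Rep G W}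

theorem exists_trail_union {x y : W} (C : R.H.Walk x x) (D : R.H.Walk y y) (hC : C.IsTrail)
    (hD : D.IsTrail) (hy : y ∈ C.support) (h : ∀ e ∈ C.edges, e ∉ D.edges) :
    ∃ E : R.H.Walk y y, E.IsTrail ∧ ∀ z, z ∈ E.support ↔ z ∈ C.support ∨ z ∈ D.support := by
  classical
  refine ⟨(C.rotate y hy).append D, ⟨?_⟩, fun z => ?_⟩
  · rw [Walk.edges_append, List.nodup_append']
    refine ⟨(Walk.isTrail_rotate hy |>.2 hC).edges_nodup, hD.edges_nodup, fun e he => h e ?_⟩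
    exact (Walk.rotate_edges C y hy).mem_iff.1 he
  · rw [Walk.mem_support_append_iff, Walk.mem_support_rotate_iff]

theorem dom_mono {a b c d : W} {p : R.H.Walk a b} {q : R.H.Walk c d}
    (h : ∀ y ∈ p.support, y ∈ q.support) : R.dom p ⊆ R.dom q :=
  fun _ ⟨y, hy, hz⟩ => ⟨y, h y hy, hz⟩

/-- A closed trail meeting as many edges as possible. -/
structure IsMax {x : W} (T : R.H.Walk x x) : Prop where
  isTrail : T.IsTrail
  le : ∀ (y : W) (C : R.H.Walk y y), C.IsTrail → (R.dom C).ncard ≤ (R.dom T).ncard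

theorem exists_isMax [Finite V] [Nonempty W] : ∃ (x : W) (T : R.H.Walk x x), IsMax T := by
  classical
  have hb : ∃ n, ∀ (y : W) (C : R.H.Walk y y), C.IsTrail → (R.dom C).ncard ≤ n :=
    ⟨_, fun y C _ => Set.ncard_le_card _⟩
  obtain ⟨y₀⟩ := ‹Nonempty W›
  have hs : ∀ y (C : R.H.Walk y y), C.IsTrail → (R.dom C).ncard ≤ Nat.find hb := Nat.find_spec hb
  by_contra! hno
  have hlt : ∀ y (C : R.H.Walk y y), C.IsTrail → (R.dom C).ncard < Nat.find hb := by
    intro y C hC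
    refine lt_of_le_of_ne (hs y C hC) fun he => hno y C ⟨hC, fun y' C' hC' => ?_⟩
    rw [he]
    exact hs y' C' hC'
  have hpos := hlt y₀ .nil (by simp)
  exact Nat.find_min hb (m := Nat.find hb - 1) (by omega)
    fun y C hC => Nat.le_sub_one_of_lt (hlt y C hC)

theorem IsMax.dom_subset [Finite V] {x y : W} {T : R.H.Walk x x} (hT : IsMax T)
    {C : R.H.Walk y y} (hC : C.IsTrail) (h : R.dom T ⊆ R.dom C) : R.dom C ⊆ R.dom T :=
  (Set.eq_of_subset_of_ncard_le h (hT.le y C hC)).ge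

theorem IsMax.false_of_support [Finite V] {x y a b : W} {T : R.H.Walk x x} (hT : IsMax T)
    {C : R.H.Walk y y} (hC : C.IsTrail) (h : ∀ z ∈ T.support, z ∈ C.support) (ha : a ∈ C.support)
    (hab : R.H.Adj a b) (ha' : a ∉ T.support) (hb' : b ∉ T.support) : False := by
  obtain ⟨z, hz, hzl⟩ := hT.dom_subset hC (dom_mono h)
    (show R.lab a b ∈ R.dom C from ⟨a, ha, by simp [R.mem_lab hab]⟩)
  rw [R.mem_lab hab] at hzl
  rcases hzl with rfl | rfl
  · exact ha' hz
  · exact hb' hz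

theorem IsMax.not_subsingleton [Finite V] (hn : 3 ≤ Nat.card V) {x : W} {T : R.H.Walk x x}
    (hT : IsMax T) : ¬ (R.dom T).Subsingleton := by
  intro hs
  have h1 : 1 < Nat.card V := by omega
  have : Fintype V := Fintype.ofFinite V
  rw [Nat.card_eq_fintype_card] at hn
  obtain ⟨p, q, r, hpq, hpr, hqr⟩ := Fintype.two_lt_card_iff.1 (show 2 < Fintype.card V by omega)
  obtain ⟨a, b, ha, hb, -, -, y, hya, hyb⟩ := R.conn r {p} ⟨p, rfl, hpr⟩ ⟨q, hpq.symm, hqr⟩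
  have hab : a ≠ b := by rintro rfl; exact hb ha
  have h2 := hT.le y .nil (by simp)
  have h3 : ({a, b} : Set V).ncard ≤ (R.dom (.nil : R.H.Walk y y)).ncard :=
    Set.ncard_le_ncard (by
      rintro c (rfl | rfl)
      · exact ⟨y, by simp, hya⟩
      · exact ⟨y, by simp, hyb⟩)
  rw [Set.ncard_pair hab] at h3
  have h4 := Set.ncard_le_one_iff_subsingleton.2 hs
  omega

theorem IsMax.exists_ear [Finite V] (hn : 3 ≤ Nat.card V) {x : W} {T : R.H.Walk x x}
    (hT : IsMax T) : ∃ (u v x₀ xr t₀ : W) (S : R.H.Walk x₀ xr), s(u, x₀) ≠ s(v, xr) ∧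
      R.H.Adj u x₀ ∧ R.H.Adj xr v ∧ S.IsPath ∧ (∀ y ∈ S.support, y ∉ T.support) ∧
      u ∈ T.support ∧ v ∈ T.support ∧ R.H.Adj x₀ t₀ ∧ t₀ ∉ T.support := by
  classical
  obtain ⟨p₀, hp₀⟩ := exists_not_mem_dom hn T hT.isTrail
  obtain ⟨a, b, hab⟩ : ∃ a b, R.ends p₀ = s(a, b) := by
    induction h : R.ends p₀ with | _ a b => exact ⟨a, b, rfl⟩
  have hadj : R.H.Adj a b := R.adj_of_ends hab
  have ha : a ∉ T.support := fun h => hp₀ ⟨a, h, by simp [hab]⟩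
  have hb : b ∉ T.support := fun h => hp₀ ⟨b, h, by simp [hab]⟩
  let H' : SimpleGraph W :=
    { Adj := fun y z => R.H.Adj y z ∧ y ∉ T.support ∧ z ∉ T.support
      symm := ⟨fun _ _ h => ⟨h.1.symm, h.2.2, h.2.1⟩⟩
      loopless := ⟨fun _ h => h.1.ne rfl⟩ }
  have hle : H' ≤ R.H := fun _ _ h => h.1
  have hab' : H'.Adj a b := ⟨hadj, ha, hb⟩
  have hnb : ∀ y, H'.Reachable a y → ∃ t, H'.Adj y t := by
    rintro y ⟨w⟩
    rcases eq_or_ne y a with rfl | hya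
    · exact ⟨b, hab'⟩
    · cases w.reverse with
      | nil => exact absurd rfl hya
      | cons h _ => exact ⟨_, h⟩
  have hKoff : ∀ y, H'.Reachable a y → y ∉ T.support := fun y hy => (hnb y hy).choose_spec.2.1
  let S : Set V := {q | ∃ y ∈ R.ends q, H'.Reachable a y}
  let A : Set V := {p | ∃ u x₀, u ∈ T.support ∧ H'.Reachable a x₀ ∧ R.ends p = s(u, x₀)}
  have hp₀S : p₀ ∈ S := ⟨a, by simp [hab], .refl a⟩
  have hp₀A : p₀ ∉ A := by
    rintro ⟨u, x₀, hu, -, he⟩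
    exact hp₀ ⟨u, hu, by simp [he]⟩
  have hSA : ∀ p y, p ∈ S → y ∈ R.ends p → ¬ H'.Reachable a y → p ∈ A := by
    rintro p y ⟨z, hz, hzK⟩ hy hyK
    have hne : z ≠ y := by rintro rfl; exact hyK hzK
    have he : R.ends p = s(z, y) := (Sym2.mem_and_mem_iff hne).1 ⟨hz, hy⟩
    refine ⟨y, z, ?_, hzK, by rw [he, Sym2.eq_swap]⟩
    by_contra hyT
    exact hyK (hzK.trans (Adj.reachable ⟨R.adj_of_ends he, hKoff z hzK, hyT⟩))
  have hcross : ∀ u, p₀ ≠ u → (∃ q, q ∉ S ∧ q ≠ u) → ∃ p ∈ A, p ≠ u := by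
    intro u hu hq
    obtain ⟨p, q, hp, hq, hpu, -, y, hyp, hyq⟩ := R.conn u S ⟨p₀, hp₀S, hu⟩ hq
    exact ⟨p, hSA p y hp hyp fun h => hq ⟨y, hyq, h⟩, hpu⟩
  have hdom : R.dom T ∩ S ⊆ A := by
    rintro p ⟨⟨y, hy, hyp⟩, hpS⟩
    exact hSA p y hpS hyp fun h => hKoff y h hy
  have hnt : A.Nontrivial := by
    by_contra hA
    rw [Set.not_nontrivial_iff] at hA
    have hout : ∃ q, q ∉ S := by
      by_contra! hall
      exact hT.not_subsingleton hn (hA.anti fun p hp => hdom ⟨hp, hall p⟩)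
    obtain ⟨q, hq⟩ := hout
    obtain ⟨p, hp⟩ : A.Nonempty := by
      have : Fintype V := Fintype.ofFinite V
      rw [Nat.card_eq_fintype_card] at hn
      obtain ⟨r, hr⟩ : ∃ r, r ∉ ({p₀, q} : Finset V) := by
        by_contra! hall
        have h1 := Finset.card_le_card (fun r _ => hall r : Finset.univ ⊆ ({p₀, q} : Finset V))
        have h2 := Finset.card_le_two (a := p₀) (b := q)
        rw [Finset.card_univ] at h1
        omega
      simp only [Finset.mem_insert, Finset.mem_singleton, not_or] at hr
      obtain ⟨p, hp, -⟩ := hcross r (Ne.symm hr.1) ⟨q, hq, Ne.symm hr.2⟩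
      exact ⟨p, hp⟩
    have hq' : ∃ q, q ∉ S ∧ q ≠ p := by
      obtain ⟨u, x₀, hu, hx₀, he⟩ := hp
      exact ⟨q, hq, by rintro rfl; exact hq ⟨x₀, by simp [he], hx₀⟩⟩
    obtain ⟨p', hp', hne⟩ := hcross p (by rintro rfl; exact hp₀A hp) hq'
    exact hne (hA hp' hp)
  obtain ⟨p, ⟨u, x₀, hu, hx₀, hep⟩, q, ⟨v, xr, hv, hxr, heq⟩, hpq⟩ := hnt
  obtain ⟨w, hw⟩ := (hx₀.symm.trans hxr).exists_isPath
  obtain ⟨t₀, ht₀⟩ := hnb x₀ hx₀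
  refine ⟨u, v, x₀, xr, t₀, w.mapLe hle, ?_, R.adj_of_ends hep, (R.adj_of_ends heq).symm,
    (Walk.isPath_mapLe hle).2 hw, ?_, hu, hv, ht₀.1, ht₀.2.2⟩
  · rw [← hep, ← heq]
    exact fun h => hpq (R.ends_inj h)
  · intro y hy
    rw [Walk.support_mapLe_eq_support] at hy
    exact hKoff y (hx₀.trans ⟨w.takeUntil y hy⟩)

end Rep

namespace Rep

variable {V W : Type*} {G : SimpleGraph V} {R : Rep G W}

theorem exists_last_exit {H : SimpleGraph W} {a u v : W} (p : H.Walk a v) (hu : u ∈ p.support)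
    (huv : u ≠ v) : ∃ (L : H.Walk a u) (w : W) (h : H.Adj u w) (M : H.Walk w v),
      p = L.append (.cons h M) ∧ u ∉ M.support := by
  induction p with
  | nil => simp at hu; exact absurd hu huv
  | @cons a c v hac p ih =>
    by_cases h : u ∈ p.support
    · obtain ⟨L, w, h', M, rfl, hM⟩ := ih h huv
      exact ⟨.cons hac L, w, h', M, rfl, hM⟩
    · have : u = a := by simpa [h] using hu
      subst this
      exact ⟨.nil, c, hac, p, rfl, h⟩

variable [DecidableEq W]

/-- Three edge-disjoint walks from `u` to `v`, where `X` meets the others only in its ends and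
no closed trail extends the closed trail formed by `P` and `Q` by all vertices of `X`. -/
structure Ear {u v : W} (P Q X : R.H.Walk u v) : Prop where
  ne : u ≠ v
  count : ∀ e, P.edges.count e + Q.edges.count e + X.edges.count e ≤ 1
  off : ∀ y ∈ X.support, y ∈ P.support ∨ y ∈ Q.support → y = u ∨ y = v
  max : ∀ (y : W) (C : R.H.Walk y y), C.IsTrail → R.dom P ∪ R.dom Q ⊆ R.dom C →
    (∀ z ∈ X.support, z ∈ C.support) → False

/-- The walk `P` passes through its ends and a single further vertex `w`, up to closed subwalks at
these three vertices, and `w` has a neighbour `t` off the other walks. -/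
def Short {u v : W} (P : R.H.Walk u v) (w t : W) (Q X : R.H.Walk u v) : Prop :=
  ∃ (Lu : R.H.Walk u u) (huw : R.H.Adj u w) (Lw : R.H.Walk w w) (hwv : R.H.Adj w v)
    (Lv : R.H.Walk v v), P = Lu.append (.cons huw (Lw.append (.cons hwv Lv))) ∧
    w ∉ Q.support ∧ R.H.Adj w t ∧ t ∉ Q.support ∧ t ∉ X.support

variable {u v w w' t : W} {P Q X : R.H.Walk u v}

theorem Ear.symm (h : Ear P Q X) : Ear Q P X where
  ne := h.ne
  count e := by have := h.count e; omega
  off y hy hy' := h.off y hy hy'.symm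
  max y C hC hd := h.max y C hC (by rwa [Set.union_comm])

theorem Ear.false_of_support (h : Ear P Q X) {y : W} {C : R.H.Walk y y}
    (hC : ∀ e, C.edges.count e ≤ 1)
    (hP : ∀ z ∈ P.support, z ∈ C.support) (hQ : ∀ z ∈ Q.support, z ∈ C.support)
    (hX : ∀ z ∈ X.support, z ∈ C.support) : False :=
  h.max y C ⟨List.nodup_iff_count_le_one.2 hC⟩ (Set.union_subset (dom_mono hP) (dom_mono hQ)) hX

theorem Ear.exists_path (h : Ear P Q X) : ∃ B : R.H.Walk u v, B.IsPath ∧ B.edges ⊆ P.edges ∧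
    2 ≤ B.length ∧ (B.length = 2 → ∃ w t, B.support = [u, w, v] ∧ Short P w t Q X) := by
  obtain ⟨Lu, w, huw, M, rfl, hM⟩ := exists_last_exit P P.start_mem_support h.ne
  by_cases hwv : w = v
  · subst hwv
    refine (h.false_of_support (C := Lu.append (X.append (M.append Q.reverse))) ?_ ?_ ?_ ?_).elim
    · intro e
      have := h.count e
      simp only [Walk.edges_append, Walk.edges_cons, Walk.edges_reverse, List.count_append,
        List.count_cons, List.count_reverse] at this ⊢
      omega
    · intro z
      simp only [Walk.mem_support_append_iff, Walk.support_cons, List.mem_cons,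
        Walk.support_reverse, List.mem_reverse]
      have := X.start_mem_support
      rintro (h | rfl | h) <;> tauto
    · intro z
      simp only [Walk.mem_support_append_iff, Walk.support_reverse, List.mem_reverse]
      tauto
    · intro z
      simp only [Walk.mem_support_append_iff, Walk.support_reverse, List.mem_reverse]
      tauto
  obtain ⟨Lw, w₂, hw₂, M, rfl, hM'⟩ := exists_last_exit M M.start_mem_support hwv
  have hMu : u ∉ M.support := fun hu => hM (by simp [Walk.mem_support_append_iff, hu])
  by_cases hv : w₂ = v
  · subst hv
    refine ⟨.cons huw (.cons hw₂ .nil), ?_, ?_, le_rfl, fun _ => ?_⟩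
    · have := h.ne
      simp only [Walk.cons_isPath_iff, Walk.IsPath.nil, Walk.support_cons, Walk.support_nil]
      simp [huw.ne, this, hwv]
    · intro e
      simp only [Walk.edges_append, Walk.edges_cons, Walk.edges_nil, List.mem_append, List.mem_cons,
        List.not_mem_nil]
      tauto
    set C := Lu.append (X.append (M.append Q.reverse)) with hCdef
    have hcount : ∀ e, C.edges.count e + Lw.edges.count e ≤ 1 := by
      intro e
      have := h.count e
      simp only [hCdef, Walk.edges_append, Walk.edges_cons, Walk.edges_reverse,
        List.count_append, List.count_cons, List.count_reverse] at this ⊢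
      omega
    have hCt : C.IsTrail :=
      ⟨List.nodup_iff_count_le_one.2 fun e => by have := hcount e; omega⟩
    have hLt : Lw.IsTrail :=
      ⟨List.nodup_iff_count_le_one.2 fun e => by have := hcount e; omega⟩
    have hmem : ∀ z, z ∈ C.support ↔ z ∈ Lu.support ∨ z ∈ X.support ∨ z ∈ M.support ∨
        z ∈ Q.support := by
      intro z
      simp only [hCdef, Walk.mem_support_append_iff, Walk.support_reverse, List.mem_reverse]
    have hPmem : ∀ z, z ∈ (Lu.append (.cons huw (Lw.append (.cons hw₂ M)))).support →
        z ∈ Lw.support ∨ z ∈ C.support := by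
      intro z
      rw [hmem]
      have h1 := X.start_mem_support
      have h2 := Lw.start_mem_support
      simp only [Walk.mem_support_append_iff, Walk.support_cons, List.mem_cons]
      rintro (h | rfl | h | rfl | h) <;> tauto
    have hdisj : ∀ y ∈ Lw.support, y ∉ C.support := by
      intro y hy hyC
      obtain ⟨E, hE, hEs⟩ := exists_trail_union C (Lw.rotate y hy) hCt
        ((Walk.isTrail_rotate hy).2 hLt) hyC (by
          intro e he he'
          rw [(Walk.rotate_edges Lw y hy).mem_iff] at he'
          have := hcount e
          have h1 := List.count_pos_iff.2 he
          have h2 := List.count_pos_iff.2 he'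
          omega)
      simp only [Walk.mem_support_rotate_iff] at hEs
      refine h.false_of_support (C := E) (List.nodup_iff_count_le_one.1 hE.edges_nodup)
        (fun z hz => (hEs z).2 (hPmem z hz).symm) (fun z hz => (hEs z).2 (.inl ?_))
        (fun z hz => (hEs z).2 (.inl ?_))
      · rw [hmem]; tauto
      · rw [hmem]; tauto
    have hwC := hdisj w Lw.start_mem_support
    obtain ⟨t, hwt, htC⟩ : ∃ t, R.H.Adj w t ∧ t ∉ C.support := by
      cases Lw with
      | cons hwt p => exact ⟨_, hwt, hdisj _ (by simp)⟩
      | nil =>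
        by_contra! hall
        refine h.max _ C hCt ?_ (fun z hz => (hmem z).2 (by tauto))
        rintro p (⟨y, hy, hyp⟩ | ⟨y, hy, hyp⟩)
        · rcases hPmem y hy with h' | h'
          · simp only [Walk.support_nil, List.mem_singleton] at h'
            subst h'
            obtain ⟨t, ht, hadj⟩ := R.ends_eq_of_mem hyp
            exact ⟨t, hall t hadj, by simp [ht]⟩
          · exact ⟨y, h', hyp⟩
        · exact ⟨y, (hmem y).2 (by tauto), hyp⟩
    rw [hmem] at hwC htC
    exact ⟨w, t, rfl, Lu, huw, Lw, hw₂, M, rfl, by tauto, hwt, by tauto, by tauto⟩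
  · have hb : ∀ z, z ∈ M.bypass.support → z ∈ M.support := fun z hz => M.support_bypass_subset_support hz
    refine ⟨.cons huw (.cons hw₂ M.bypass), ?_, ?_, by simp, fun h2 => ?_⟩
    · simp only [Walk.cons_isPath_iff, Walk.support_cons, List.mem_cons, not_or]
      exact ⟨⟨M.bypass_isPath, fun h => hM' (hb _ h)⟩, huw.ne, fun h => hMu (hb _ h)⟩
    · intro e
      have := M.edges_bypass_subset_edges (a := e)
      simp only [Walk.edges_append, Walk.edges_cons, List.mem_append, List.mem_cons]
      tauto
    · simp only [Walk.length_cons, Nat.reduceEqDiff] at h2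
      exact absurd (Walk.eq_of_length_eq_zero (by omega)) hv

theorem count_edges_eq_zero {a b : W} {H : SimpleGraph W} {p : H.Walk a b}
    {e : Sym2 W} (ht : t ∉ p.support) (hte : t ∈ e) : p.edges.count e = 0 := by
  rw [List.count_eq_zero]
  exact fun he => ht (p.mem_support_of_mem_edges he hte)

theorem Short.false_of_adj {x₀ : W} (h : Ear P Q X) (hs : Short P w t Q X) (hu : R.H.Adj u x₀)
    (hv : R.H.Adj x₀ v) (hX : X = .cons hu (.cons hv .nil)) (ht : R.H.Adj x₀ t)
    (htP : t ∉ P.support) : False := by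
  obtain ⟨Lu, huw, Lw, hwv, Lv, rfl, hwQ, hwt, htQ, htX⟩ := hs
  have hx₀w : x₀ ≠ w := by
    rintro rfl
    rcases h.off x₀ (by simp [hX]) (.inl (by simp [Walk.mem_support_append_iff])) with h' | h'
    · exact hu.ne h'.symm
    · exact hv.ne h'
  refine h.false_of_support (C := Lu.append (.cons hu (.cons ht (.cons hwt.symm
    (Lw.append (.cons hwv (Lv.append Q.reverse))))))) ?_ ?_ ?_ ?_
  · intro e
    have h1 := h.count e
    by_cases hte : t ∈ e
    · have h2 := count_edges_eq_zero htP hte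
      have h3 := count_edges_eq_zero htQ hte
      have h4 := count_edges_eq_zero htX hte
      subst hX
      simp only [Walk.edges_append, Walk.edges_cons, Walk.edges_reverse, List.count_append,
        List.count_cons, List.count_reverse, beq_iff_eq] at h2 h3 h4 ⊢
      have h5 : ¬ (s(x₀, t) = e ∧ s(t, w) = e) := by
        rintro ⟨rfl, h5⟩
        rw [Sym2.eq_iff] at h5
        have := hwt.ne
        have := ht.ne
        tauto
      split_ifs at * <;> first | omega | tauto
    · subst hX
      have h2 : s(x₀, t) ≠ e := by rintro rfl; simp at hte
      have h3 : s(t, w) ≠ e := by rintro rfl; simp at hte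
      simp only [Walk.edges_append, Walk.edges_cons, Walk.edges_reverse, List.count_append,
        List.count_cons, List.count_reverse, beq_iff_eq, h2, h3, if_false] at h1 ⊢
      omega
  · intro z
    simp only [Walk.mem_support_append_iff, Walk.support_cons, List.mem_cons]
    tauto
  · intro z
    simp only [Walk.mem_support_append_iff, Walk.support_cons, List.mem_cons, Walk.support_reverse,
      List.mem_reverse]
    tauto
  · intro z
    subst hX
    have := Lv.start_mem_support
    simp only [Walk.mem_support_append_iff, Walk.support_cons, List.mem_cons, Walk.support_nil,
      List.not_mem_nil, or_false]
    rintro (rfl | rfl | rfl) <;> tauto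

theorem Short.false_of_short (h : Ear P Q X) (hs : Short P w t Q X) (hs' : Short Q w' t P X) :
    False := by
  obtain ⟨Lu, huw, Lw, hwv, Lv, rfl, hwQ, hwt, htQ, htX⟩ := hs
  obtain ⟨Lu', huw', Lw', hwv', Lv', rfl, hwP, hwt', htP, -⟩ := hs'
  have hww : w ≠ w' := by
    rintro rfl
    exact hwQ (by simp [Walk.mem_support_append_iff])
  refine h.false_of_support (C := Lu.append (Lu'.append (X.append (Lv.append (Lv'.append
    (.cons hwv'.symm (Lw'.reverse.append (.cons hwt' (.cons hwt.symm
      (Lw.reverse.append (.cons huw.symm .nil))))))))))) ?_ ?_ ?_ ?_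
  · intro e
    have h1 := h.count e
    by_cases hte : t ∈ e
    · have h2 := count_edges_eq_zero htP hte
      have h3 := count_edges_eq_zero htQ hte
      have h4 := count_edges_eq_zero htX hte
      simp only [Walk.edges_append, Walk.edges_cons, Walk.edges_reverse, List.count_append,
        List.count_cons, List.count_reverse, beq_iff_eq, Walk.edges_nil, List.count_nil] at h2 h3 h4 ⊢
      have h5 : ¬ (s(w', t) = e ∧ s(t, w) = e) := by
        rintro ⟨rfl, h5⟩
        rw [Sym2.eq_iff] at h5
        have := hwt.ne
        have := hwt'.ne
        tauto
      have h6 : s(v, w') = s(w', v) := Sym2.eq_swap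
      have h7 : s(w, u) = s(u, w) := Sym2.eq_swap
      rw [h6, h7]
      split_ifs at * <;> first | omega | tauto
    · have h2 : s(w', t) ≠ e := by rintro rfl; simp at hte
      have h3 : s(t, w) ≠ e := by rintro rfl; simp at hte
      have h6 : s(v, w') = s(w', v) := Sym2.eq_swap
      have h7 : s(w, u) = s(u, w) := Sym2.eq_swap
      simp only [Walk.edges_append, Walk.edges_cons, Walk.edges_reverse, List.count_append,
        List.count_cons, List.count_reverse, beq_iff_eq, h2, h3, if_false, h6, h7,
        Walk.edges_nil, List.count_nil] at h1 ⊢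
      omega
  all_goals
    intro z
    simp only [Walk.mem_support_append_iff, Walk.support_cons, List.mem_cons, Walk.support_reverse,
      List.mem_reverse, Walk.support_nil]
    tauto

end Rep

namespace Rep

variable {V W : Type*} {G : SimpleGraph V} {R : Rep G W}

theorem listEdges_support {a b : W} (p : R.H.Walk a b) : listEdges p.support = p.edges := by
  induction p with
  | nil => rfl
  | cons h p ih =>
    cases p with
    | nil => rfl
    | cons h' p =>
      simp only [Walk.support_cons, Walk.edges_cons, listEdges] at ih ⊢
      rw [ih]

theorem exists_support_eq {u v : W} (huv : u ≠ v) (p : R.H.Walk u v) :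
    ∃ l, p.support = u :: (l ++ [v]) := by
  cases p with
  | nil => exact absurd rfl huv
  | cons h p => exact ⟨p.support.dropLast, by rw [Walk.support_cons, p.dropLast_support_concat]⟩

variable [DecidableEq W] {u v : W} {P Q X : R.H.Walk u v}

theorem Ear.exists_list (h : Ear P Q X) : ∃ (l : List W) (t : W),
    (u :: (l ++ [v])).IsChain R.H.Adj ∧ (u :: (l ++ [v])).Nodup ∧ l ≠ [] ∧
    (∀ e ∈ listEdges (u :: (l ++ [v])), e ∈ P.edges) ∧ (∀ y ∈ l, y ∈ P.support) ∧
    (l.length = 1 → ∃ w, l = [w] ∧ Short P w t Q X) := by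
  obtain ⟨B, hB, hBP, hlen, hshort⟩ := h.exists_path
  obtain ⟨l, hl⟩ := exists_support_eq h.ne B
  have hlen' : B.length = l.length + 1 := by
    have := B.length_support
    rw [hl] at this
    simp at this
    omega
  have hsub : ∀ y ∈ l, y ∈ P.support := by
    intro y hy
    have hyB : y ∈ B.support := by simp [hl, hy]
    rw [Walk.mem_support_iff_exists_mem_edges] at hyB
    rcases hyB with rfl | ⟨e, he, hye⟩
    · exact P.end_mem_support
    · exact P.mem_support_of_mem_edges (hBP he) hye
  have key : ∃ t, l.length = 1 → ∃ w, l = [w] ∧ Short P w t Q X := by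
    by_cases h1 : l.length = 1
    · obtain ⟨w, t, hs, hS⟩ := hshort (by omega)
      rw [hl] at hs
      exact ⟨t, fun _ => ⟨w, List.append_cancel_right (bs := [v]) (by simpa using hs), hS⟩⟩
    · exact ⟨u, fun h => absurd h h1⟩
  obtain ⟨t, ht⟩ := key
  refine ⟨l, t, hl ▸ B.isChain_adj_support, hl ▸ hB.support_nodup, ?_, ?_, hsub, ht⟩
  · rintro rfl
    simp at hlen'
    omega
  · rw [← hl, listEdges_support]
    exact fun e he => hBP he

theorem Ear.false [Finite V] (h : Ear P Q X)
    (hγ : PathHeavy G gamma1 ∨ PathHeavy G gamma2 ∨ PathHeavy G gamma3) (hX : X.IsPath)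
    (hX2 : 2 ≤ X.length) (hpend : X.length = 2 → ∃ (x₀ : W) (hu : R.H.Adj u x₀)
      (hv : R.H.Adj x₀ v) (t₀ : W), X = .cons hu (.cons hv .nil) ∧ R.H.Adj x₀ t₀ ∧
      t₀ ∉ P.support ∧ t₀ ∉ Q.support) : False := by
  obtain ⟨l₀, hl₀⟩ := exists_support_eq h.ne X
  obtain ⟨l₁, t₁, c₁, n₁, e₁, d₁, s₁, p₁⟩ := h.exists_list
  obtain ⟨l₂, t₂, c₂, n₂, e₂, d₂, s₂, p₂⟩ := h.symm.exists_list
  have hlen : X.length = l₀.length + 1 := by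
    have := X.length_support
    rw [hl₀] at this
    simp at this
    omega
  obtain ⟨t₀, ht₀⟩ : ∃ t₀, l₀.length = 1 → ∃ (x₀ : W) (hu : R.H.Adj u x₀)
      (hv : R.H.Adj x₀ v), l₀ = [x₀] ∧ X = .cons hu (.cons hv .nil) ∧ R.H.Adj x₀ t₀ ∧
      t₀ ∉ P.support ∧ t₀ ∉ Q.support := by
    by_cases h1 : l₀.length = 1
    · obtain ⟨x₀, hu, hv, t₀, rfl, hh⟩ := hpend (by omega)
      exact ⟨t₀, fun _ => ⟨x₀, hu, hv,
        List.append_cancel_right (bs := [v]) (by simpa using hl₀.symm), rfl, hh⟩⟩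
    · exact ⟨u, fun h => absurd h h1⟩
  have hn₀ : (u :: (l₀ ++ [v])).Nodup := hl₀ ▸ hX.support_nodup
  have hX₀ : ∀ y ∈ l₀, y ∈ X.support := fun y hy => by simp [hl₀, hy]
  have hend : ∀ {l : List W}, (u :: (l ++ [v])).Nodup → ∀ y ∈ l, y ≠ u ∧ y ≠ v := by
    intro l hl y hy
    constructor
    · rintro rfl
      exact (List.nodup_cons.1 hl).1 (by simp [hy])
    · rintro rfl
      exact List.disjoint_of_nodup_append (List.nodup_cons.1 hl).2 hy (by simp)
  have hoff : ∀ y ∈ l₀, y ∉ P.support ∧ y ∉ Q.support := by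
    intro y hy
    obtain ⟨h1, h2⟩ := hend hn₀ y hy
    constructor <;> intro hp
    · rcases h.off y (hX₀ y hy) (.inl hp) with h' | h'
      · exact h1 h'
      · exact h2 h'
    · rcases h.off y (hX₀ y hy) (.inr hp) with h' | h'
      · exact h1 h'
      · exact h2 h'
  have hshort : ∀ {P Q : R.H.Walk u v} {l l' : List W} {t : W}, (∀ y ∈ l', y ∈ Q.support) →
      (l.length = 1 → ∃ w, l = [w] ∧ Short P w t Q X) → l.length = 1 →
      (∀ w ∈ l, R.H.Adj w t) ∧ t ≠ u ∧ t ≠ v ∧ t ∉ l₀ ∧ t ∉ l' := by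
    intro P Q l l' t hl' hp hl
    obtain ⟨w, rfl, Lu, huw, Lw, hwv, Lv, rfl, hwQ, hwt, htQ, htX⟩ := hp hl
    refine ⟨by simpa using hwt, ?_, ?_, fun h => htX (hX₀ _ h), fun h => htQ (hl' _ h)⟩
    · rintro rfl; exact htQ Q.start_mem_support
    · rintro rfl; exact htQ Q.end_mem_support
  have hne : ∀ {P Q : R.H.Walk u v} {l : List W} {t : W}, Ear P Q X →
      (l.length = 1 → ∃ w, l = [w] ∧ Short P w t Q X) → t₀ ∉ P.support → l₀.length = 1 →
      l.length = 1 → t₀ ≠ t := by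
    rintro P Q l t hE hp htP h0 h1 rfl
    obtain ⟨w, rfl, hS⟩ := hp h1
    obtain ⟨x₀, hu, hv, -, hXe, hadj, -, -⟩ := ht₀ h0
    exact hS.false_of_adj hE hu hv hXe hadj htP
  refine Theta.false (R := R) (u := u) (v := v) (l₀ := l₀) (l₁ := l₁) (l₂ := l₂) (t₀ := t₀)
    (t₁ := t₁) (t₂ := t₂) hγ
    { chain₀ := hl₀ ▸ X.isChain_adj_support
      chain₁ := c₁
      chain₂ := c₂
      nodup₀ := hn₀
      nodup₁ := n₁
      nodup₂ := n₂
      ne_nil₀ := ?_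
      ne_nil₁ := e₁
      ne_nil₂ := e₂
      disj₁ := fun x hx hx' => (hoff x hx).1 (s₁ x hx')
      disj₂ := fun x hx hx' => (hoff x hx).2 (s₂ x hx')
      edge := ?_
      pend₀ := ?_
      pend₁ := hshort s₂ p₁
      pend₂ := hshort s₁ p₂
      pend_ne₀₁ := fun h0 h1 => hne h p₁ (by
        obtain ⟨_, _, _, _, _, _, h', -⟩ := ht₀ h0; exact h') h0 h1
      pend_ne₀₂ := fun h0 h1 => hne h.symm p₂ (by
        obtain ⟨_, _, _, _, _, _, -, h'⟩ := ht₀ h0; exact h') h0 h1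
      pend_ne₁₂ := ?_
      short₁ := ?_
      short₂ := ?_ }
  · rintro rfl
    simp at hlen
    omega
  · intro e he he'
    have := h.count e
    have h1 := List.count_pos_iff.2 (d₁ e he)
    have h2 := List.count_pos_iff.2 (d₂ e he')
    omega
  · intro h0
    obtain ⟨x₀, hu, hv, rfl, hXe, hadj, hP, hQ⟩ := ht₀ h0
    refine ⟨by simpa using hadj, ?_, ?_, fun h => hP (s₁ _ h), fun h => hQ (s₂ _ h)⟩
    · rintro rfl; exact hP P.start_mem_support
    · rintro rfl; exact hP P.end_mem_support
  · rintro h1 h2 rfl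
    obtain ⟨w, rfl, hS⟩ := p₁ h1
    obtain ⟨w', rfl, hS'⟩ := p₂ h2
    exact hS.false_of_short h hS'
  · intro h1 w hw hw'
    obtain ⟨w, rfl, _, _, _, _, _, _, hwQ, -⟩ := p₁ h1
    rw [List.mem_singleton.1 hw] at hw'
    exact hwQ (s₂ _ hw')
  · intro h1 w hw hw'
    obtain ⟨w, rfl, _, _, _, _, _, _, hwQ, -⟩ := p₂ h1
    rw [List.mem_singleton.1 hw] at hw'
    exact hwQ (s₁ _ hw')

theorem false_of_pathHeavy [Finite V] (hn : 3 ≤ Nat.card V) (R : Rep G W)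
    (hγ : PathHeavy G gamma1 ∨ PathHeavy G gamma2 ∨ PathHeavy G gamma3) : False := by
  have : Nonempty V := (Nat.card_pos_iff.1 (by omega)).1
  obtain ⟨p⟩ := this
  have : Nonempty W := by
    induction h : R.ends p with | _ a b => exact ⟨a⟩
  obtain ⟨x, T, hT⟩ := exists_isMax (R := R)
  obtain ⟨u, v, x₀, xr, t₀, S, hne, hu, hv, hS, hoff, huT, hvT, ht₀, htT⟩ := hT.exists_ear hn
  have hx₀ := hoff x₀ S.start_mem_support
  have hxr := hoff xr S.end_mem_support
  have huS : u ∉ S.support := fun h => hoff u h huT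
  have hvS : v ∉ S.support := fun h => hoff v h hvT
  set X : R.H.Walk u v := .cons hu (S.concat hv) with hXdef
  have hXT : ∀ e ∈ X.edges, e ∉ T.edges := by
    intro e he heT
    simp only [hXdef, Walk.edges_cons, Walk.edges_concat, List.concat_eq_append, List.mem_cons,
      List.mem_append, List.not_mem_nil, or_false] at he
    rcases he with rfl | he | rfl
    · exact hx₀ (T.mem_support_of_mem_edges heT (by simp))
    · induction e with
      | _ a b =>
        exact hoff a (S.fst_mem_support_of_mem_edges he) (T.fst_mem_support_of_mem_edges heT)
    · exact hxr (T.mem_support_of_mem_edges heT (by simp))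
  have hXt : X.IsTrail := by
    constructor
    simp only [hXdef, Walk.edges_cons, Walk.edges_concat, List.concat_eq_append,
      List.nodup_cons, List.nodup_append', List.mem_append, not_or, List.mem_singleton,
      List.nodup_nil, List.not_mem_nil, not_false_eq_true, and_true, List.disjoint_singleton]
    refine ⟨⟨fun h => huS (S.fst_mem_support_of_mem_edges h), fun h => hne (h.trans Sym2.eq_swap)⟩,
      hS.isTrail.edges_nodup, trivial, fun h => hvS (S.snd_mem_support_of_mem_edges h)⟩
  have hx₀X : x₀ ∈ X.support := by simp [hXdef]
  by_cases huv : u = v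
  · clear_value X
    subst huv
    obtain ⟨E, hE, hEs⟩ := exists_trail_union T X hT.isTrail hXt huT fun e he he' => hXT e he' he
    exact hT.false_of_support hE (fun z hz => (hEs z).2 (.inl hz)) ((hEs x₀).2 (.inr hx₀X)) ht₀
      hx₀ htT
  have hvT' : v ∈ (T.rotate u huT).support := by rwa [Walk.mem_support_rotate_iff]
  set P := (T.rotate u huT).takeUntil v hvT' with hP
  set Q := ((T.rotate u huT).dropUntil v hvT').reverse with hQ
  have hspec : P.append Q.reverse = T.rotate u huT := by
    rw [hP, hQ, Walk.reverse_reverse, Walk.take_spec]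
  have hsupp : ∀ z, z ∈ T.support ↔ z ∈ P.support ∨ z ∈ Q.support := by
    intro z
    rw [← Walk.mem_support_rotate_iff (h := huT), ← hspec, Walk.mem_support_append_iff,
      Walk.support_reverse, List.mem_reverse]
  have hcount : ∀ e, P.edges.count e + Q.edges.count e = T.edges.count e := by
    intro e
    have hr : Q.edges.count e = Q.reverse.edges.count e := by
      rw [Walk.edges_reverse Q, List.count_reverse]
    rw [← (Walk.rotate_edges T u huT).perm.count_eq, ← hspec, Walk.edges_append,
      List.count_append, hr]
  have hXp : X.IsPath := by
    rw [hXdef, Walk.cons_isPath_iff, Walk.support_concat]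
    refine ⟨hS.concat hvS hv, ?_⟩
    simp [huS, huv]
  refine Ear.false (P := P) (Q := Q) (X := X)
    { ne := huv, count := ?_, off := ?_, max := ?_ } hγ hXp ?_ ?_
  · intro e
    rw [hcount]
    have h1 := List.nodup_iff_count_le_one.1 hT.isTrail.edges_nodup e
    have h2 := List.nodup_iff_count_le_one.1 hXt.edges_nodup e
    by_cases he : e ∈ X.edges
    · rw [List.count_eq_zero.2 (hXT e he)]
      omega
    · rw [List.count_eq_zero.2 he]
      omega
  · intro y hy hy'
    rw [← hsupp] at hy'
    simp only [hXdef, Walk.support_cons, Walk.support_concat, List.mem_cons,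
      List.mem_append, List.not_mem_nil, or_false] at hy
    rcases hy with rfl | hy | rfl
    · exact .inl rfl
    · exact absurd hy' (hoff y hy)
    · exact .inr rfl
  · intro y C hC hd hXC
    have hTC : R.dom T ⊆ R.dom C := by
      rintro p ⟨z, hz, hzp⟩
      rcases (hsupp z).1 hz with h | h
      · exact hd (.inl ⟨z, h, hzp⟩)
      · exact hd (.inr ⟨z, h, hzp⟩)
    obtain ⟨z, hz, hzl⟩ := hT.dom_subset hC hTC
      (show R.lab x₀ t₀ ∈ R.dom C from ⟨x₀, hXC _ hx₀X, by simp [R.mem_lab ht₀]⟩)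
    rw [R.mem_lab ht₀] at hzl
    rcases hzl with rfl | rfl
    · exact hx₀ hz
    · exact htT hz
  · simp [hXdef]
  · intro hlen
    simp only [hXdef, Walk.length_cons, Walk.length_concat, Nat.reduceEqDiff] at hlen
    have hS0 : S.length = 0 := by omega
    cases S with
    | cons h p => simp at hS0
    | nil =>
      exact ⟨x₀, hu, hv, t₀, rfl, ht₀, fun h => htT ((hsupp _).2 (.inl h)),
        fun h => htT ((hsupp _).2 (.inr h))⟩

end Rep

theorem Link.exists_walk {V : Type*} {G : SimpleGraph V} {a b : V} {l : List V}
    (h : Link G a b l) : ∃ p : G.Walk a b, p.support = l := by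
  induction h with
  | single => exact ⟨.nil, rfl⟩
  | cons hab _ ih =>
    obtain ⟨p, rfl⟩ := ih
    exact ⟨.cons hab p, rfl⟩

variable {V : Type*} {G : SimpleGraph V}

theorem Ham.isHamiltonian [Fintype V] [DecidableEq V] (hn : 3 ≤ Fintype.card V) (h : Ham G) :
    G.IsHamiltonian := by
  obtain ⟨a, b, l, hl, hba⟩ := h
  have hlen := hl.length_eq
  obtain ⟨p, rfl⟩ := hl.1.exists_walk
  rw [Walk.length_support, Nat.card_eq_fintype_card] at hlen
  have hp : p.IsPath := (Walk.isPath_def p).2 hl.2.1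
  refine fun _ => ⟨b, .cons hba p, ?_⟩
  rw [Walk.isHamiltonianCycle_iff_isCycle_and_length_eq, Walk.length_cons]
  refine ⟨(Walk.cons_isCycle_iff p hba).2 ⟨hp, fun he => ?_⟩, hlen⟩
  cases p with
  | nil => exact hba.ne rfl
  | @cons _ c _ hac q =>
    rw [Walk.cons_isPath_iff] at hp
    rw [Walk.edges_cons, List.mem_cons] at he
    rcases he with he | he
    · have hcb : c = b := by
        rw [Sym2.eq_iff] at he
        rcases he with ⟨h1, -⟩ | ⟨h1, -⟩
        · exact absurd h1 hba.ne
        · exact h1.symm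
      subst hcb
      have h0 := Walk.length_eq_zero_iff.2 (Walk.isPath_iff_nil.1 hp.1)
      simp at hlen
      omega
    · exact hp.2 (q.snd_mem_support_of_mem_edges he)

variable [Fintype V] [DecidableRel G.Adj]

theorem dg_eq_degree (v : V) : dg G v = G.degree v := by
  rw [dg, ← G.card_neighborSet_eq_degree v, Set.ncard_eq_toFinset_card', Set.toFinset_card]

theorem ClawOHeavy.leafHeavy (h : ClawOHeavy G) : LeafHeavy G := by
  intro a b₁ b₂ b₃ h₁₂ h₁₃ h₂₃ h₁ h₂ h₃
  by_contra! hcon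
  obtain ⟨n₁₂, n₁₃, n₂₃, m₁₂, m₁₃, m₂₃⟩ := hcon
  obtain ⟨u, v, hu, hv, huv, hadj, hd⟩ := h a b₁ b₂ b₃ h₁₂ h₁₃ h₂₃ h₁ h₂ h₃ n₁₂ n₁₃ n₂₃
  simp only [heavyGraph_adj, dg_eq_degree, Nat.card_eq_fintype_card, not_and] at m₁₂ m₁₃ m₂₃
  have := m₁₂ h₁₂
  have := m₁₃ h₁₃
  have := m₂₃ h₂₃
  simp only [Set.mem_insert_iff, Set.mem_singleton_iff] at hu hv
  rcases hu with rfl | rfl | rfl | rfl <;> rcases hv with rfl | rfl | rfl | rfl <;>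
    first
    | exact huv rfl
    | exact hadj h₁
    | exact hadj h₂
    | exact hadj h₃
    | exact hadj h₁.symm
    | exact hadj h₂.symm
    | exact hadj h₃.symm
    | omega

theorem P6GammaHeavy.pathHeavy {γ γ' : Set (Sym2 (Fin 6))} (h : P6GammaHeavy G γ) (hs : γ ⊆ γ') :
    PathHeavy G γ' := by
  intro v hv
  obtain ⟨i, j, hij, hd⟩ := h v hv
  exact ⟨i, j, hs hij, by rwa [dg_eq_degree, dg_eq_degree, Nat.card_eq_fintype_card]⟩

end ClawHeavy

/-- If a symmetrical graph `γ` on `I` is a subgraph of `γ₁`, of `γ₂`, or of `γ₃`, then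
every 2-connected claw-o-heavy and `P₆`-`γ`-heavy graph is hamiltonian. -/
theorem stmt_4 (γ : Set (Sym2 (Fin 6))) (hsym : SymmetricalGamma γ)
    (hsub : γ ⊆ gamma1 ∨ γ ⊆ gamma2 ∨ γ ⊆ gamma3) :
    ∀ (V : Type) [Fintype V] [DecidableEq V] (G : SimpleGraph V) [DecidableRel G.Adj],
      TwoConnected G → ClawOHeavy G → P6GammaHeavy G γ → G.IsHamiltonian := by
  intro V _ _ G _ hG hclaw hpath
  by_contra hham
  classical
  have hn : 3 ≤ Nat.card V := Nat.card_eq_fintype_card (α := V) ▸ hG.1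
  obtain ⟨R⟩ := ClawHeavy.exists_rep hn hG.2 (ClawHeavy.ClawOHeavy.leafHeavy hclaw)
    fun h => hham (h.isHamiltonian hG.1)
  exact ClawHeavy.Rep.false_of_pathHeavy hn R <| hsub.imp
    (ClawHeavy.P6GammaHeavy.pathHeavy hpath) (Or.imp
    (ClawHeavy.P6GammaHeavy.pathHeavy hpath) (ClawHeavy.P6GammaHeavy.pathHeavy hpath))
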